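/- arXiv:1008.0916 — 2 statements merged into one kernel-verified Lean document; each statement's English description precedes it below -/
import Mathlib

section
/- For every smooth embedding e of the 2-sphere into ℝ³ (i.e., every injective smooth immersion e : S² → ℝ³), there exists a homotopy through immersions from e to e ∘ a, where a is the antipodal map of S². In other words, every smoothly embedded 2-sphere in ℝ³ is regularly homotopic to itself with orientation reversed (sphere eversion). -/
open scoped Manifold

noncomputable section

/-- ℝ³ as Euclidean space. -/
abbrev E3 := EuclideanSpace ℝ (Fin 3)

/-- The unit 2-sphere in ℝ³ with its standard smooth manifold structure. -/
abbrev S2 := Metric.sphere (0 : E3) 1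

/-- A smooth immersion of the 2-sphere into ℝ³: an infinitely differentiable map whose
manifold derivative is injective at every point. -/
def IsSmoothImmersion (f : S2 → E3) : Prop :=
  ContMDiff (𝓡 2) 𝓘(ℝ, E3) (⊤ : ℕ∞) f ∧
    ∀ x : S2, Function.Injective (mfderiv (𝓡 2) 𝓘(ℝ, E3) f x)

/-- A homotopy through immersions (regular homotopy) from `f` to `g`: a smooth map
`F : ℝ × S² → ℝ³` with `F (0, ·) = f`, `F (1, ·) = g`, and `F (t, ·)` a smooth
immersion for every `t`. -/
def IsRegularHomotopy (F : ℝ × S2 → E3) (f g : S2 → E3) : Prop :=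
  ContMDiff ((𝓘(ℝ, ℝ)).prod (𝓡 2)) 𝓘(ℝ, E3) (⊤ : ℕ∞) F ∧
    (∀ x, F (0, x) = f x) ∧ (∀ x, F (1, x) = g x) ∧
    ∀ t : ℝ, IsSmoothImmersion fun x => F (t, x)

/-- The antipodal map of the 2-sphere. -/
def antipodal (x : S2) : S2 := -x

open scoped ContDiff ComplexConjugate Quaternion

/-! ### The cross product on `E3` -/

/-- The cross product on Euclidean 3-space. -/
def cross (u v : E3) : E3 :=
  !₂[u 1 * v 2 - u 2 * v 1, u 2 * v 0 - u 0 * v 2, u 0 * v 1 - u 1 * v 0]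

@[simp] lemma cross_apply_zero (u v : E3) : cross u v 0 = u 1 * v 2 - u 2 * v 1 := rfl
@[simp] lemma cross_apply_one (u v : E3) : cross u v 1 = u 2 * v 0 - u 0 * v 2 := rfl
@[simp] lemma cross_apply_two (u v : E3) : cross u v 2 = u 0 * v 1 - u 1 * v 0 := rfl

lemma E3.inner_eq (u v : E3) : inner ℝ u v = u 0 * v 0 + u 1 * v 1 + u 2 * v 2 := by
  simp [PiLp.inner_apply, Fin.sum_univ_three]
  ring

lemma E3.ext_coords {u v : E3} (h0 : u 0 = v 0) (h1 : u 1 = v 1) (h2 : u 2 = v 2) : u = v := by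
  ext i
  fin_cases i <;> assumption

lemma inner_cross_left (u v : E3) : inner ℝ u (cross u v) = 0 := by
  simp [E3.inner_eq]; ring

lemma inner_cross_right (u v : E3) : inner ℝ v (cross u v) = 0 := by
  simp [E3.inner_eq]; ring

lemma ContDiffAt.cross {X : Type*} [NormedAddCommGroup X] [NormedSpace ℝ X] {n : ℕ∞ω}
    {f g : X → E3} {x : X} (hf : ContDiffAt ℝ n f x) (hg : ContDiffAt ℝ n g x) :
    ContDiffAt ℝ n (fun y => cross (f y) (g y)) x := by
  rw [contDiffAt_euclidean] at *
  intro i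
  fin_cases i
  · exact ((hf 1).mul (hg 2)).sub ((hf 2).mul (hg 1))
  · exact ((hf 2).mul (hg 0)).sub ((hf 0).mul (hg 2))
  · exact ((hf 0).mul (hg 1)).sub ((hf 1).mul (hg 0))

/-- A vector is determined by its components in the basis `p, q, p × q`. -/
lemma normSq_cross_smul_eq (p q a : E3) :
    (inner ℝ (cross p q) (cross p q)) • a =
      (inner ℝ a (cross q (cross p q))) • p + (inner ℝ a (cross (cross p q) p)) • q +
        (inner ℝ a (cross p q)) • cross p q := by
  apply E3.ext_coords <;> simp [E3.inner_eq, -inner_self_eq_norm_sq_to_K] <;> ring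

lemma eq_zero_of_comb_cross_eq_zero {p q : E3} (h : cross p q ≠ 0) {a b c : ℝ}
    (habc : a • p + b • q + c • cross p q = 0) : a = 0 ∧ b = 0 ∧ c = 0 := by
  have hn : inner ℝ (cross p q) (cross p q) ≠ 0 := inner_self_ne_zero.mpr h
  have e (w : E3) : inner ℝ w (a • p + b • q + c • cross p q) = 0 := by simp [habc]
  have e1 := e (cross q (cross p q))
  have e2 := e (cross (cross p q) p)
  have e3 := e (cross p q)
  refine ⟨?_, ?_, ?_⟩
  · refine (mul_eq_zero.mp (?_ : a * inner ℝ (cross p q) (cross p q) = 0)).resolve_right hn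
    rw [← e1]; simp [E3.inner_eq, -inner_self_eq_norm_sq_to_K]; ring
  · refine (mul_eq_zero.mp (?_ : b * inner ℝ (cross p q) (cross p q) = 0)).resolve_right hn
    rw [← e2]; simp [E3.inner_eq, -inner_self_eq_norm_sq_to_K]; ring
  · refine (mul_eq_zero.mp (?_ : c * inner ℝ (cross p q) (cross p q) = 0)).resolve_right hn
    rw [← e3]; simp [E3.inner_eq, -inner_self_eq_norm_sq_to_K]; ring

/-- Two vectors with vanishing cross product are linearly dependent. -/
lemma exists_comb_eq_zero_of_cross_eq_zero {p q : E3} (h : cross p q = 0) :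
    ∃ a b : ℝ, (a ≠ 0 ∨ b ≠ 0) ∧ a • p + b • q = 0 := by
  by_cases hp : p = 0
  · exact ⟨1, 0, by simp, by simp [hp]⟩
  · refine ⟨-inner ℝ p q, inner ℝ p p, Or.inr (inner_self_ne_zero.mpr hp), ?_⟩
    have h0 : p 1 * q 2 - p 2 * q 1 = 0 := by rw [← cross_apply_zero, h]; rfl
    have h1 : p 2 * q 0 - p 0 * q 2 = 0 := by rw [← cross_apply_one, h]; rfl
    have h2 : p 0 * q 1 - p 1 * q 0 = 0 := by rw [← cross_apply_two, h]; rfl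
    apply E3.ext_coords <;> simp [E3.inner_eq, -inner_self_eq_norm_sq_to_K]
    · linear_combination p 2 * h1 - p 1 * h2
    · linear_combination p 0 * h2 - p 2 * h0
    · linear_combination p 1 * h0 - p 0 * h1

/-! ### A family of loops in the punctured plane with prescribed mean -/

lemma exists_entire_primitive : ∃ Φ : ℂ → ℂ, Differentiable ℂ Φ ∧ Φ 0 = 0 ∧
    ∀ z, z * deriv Φ z = Complex.exp z - 1 := by
  have hd : Differentiable ℂ (dslope Complex.exp 0) := by
    rw [← differentiableOn_univ]
    exact (Complex.differentiableOn_dslope Filter.univ_mem).mpr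
      Complex.differentiable_exp.differentiableOn
  obtain ⟨F, hF0, hF⟩ := hd.isExactOn_univ.with_val_at 0 0
  refine ⟨F, fun z => (hF z trivial).differentiableAt, hF0, fun z => ?_⟩
  rw [(hF z trivial).deriv]
  have := sub_smul_dslope Complex.exp 0 z
  simpa using this

/-- An entire function with `z Φ'(z) = exp z - 1`. -/
def expPrimitive : ℂ → ℂ := exists_entire_primitive.choose

lemma differentiable_expPrimitive : Differentiable ℂ expPrimitive :=
  exists_entire_primitive.choose_spec.1

lemma expPrimitive_zero : expPrimitive 0 = 0 := exists_entire_primitive.choose_spec.2.1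

lemma mul_deriv_expPrimitive (z : ℂ) : z * deriv expPrimitive z = Complex.exp z - 1 :=
  exists_entire_primitive.choose_spec.2.2 z

/-- The loop of `u` in the unit circle with mean `1 + 2 k η`, avoiding `0` if `|k| < 1`. -/
def loop (k η u : ℂ) : ℂ := (1 + k * u) * Complex.exp (2 * η * conj u)

lemma loop_ne_zero {k u : ℂ} (η : ℂ) (hk : ‖k‖ < 1) (hu : ‖u‖ = 1) : loop k η u ≠ 0 := by
  refine mul_ne_zero (fun h => ?_) (Complex.exp_ne_zero _)
  have : k * u = -1 := by linear_combination h
  have h2 : ‖k * u‖ = 1 := by rw [this]; simp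
  rw [norm_mul, hu] at h2
  linarith

/-- A periodic primitive of `loop k η - (1 + 2 k η)`. -/
def loopPrimitive (k η u : ℂ) : ℂ :=
  Complex.I * expPrimitive (2 * η * conj u) -
    Complex.I * k * u * (Complex.exp (2 * η * conj u) - 2 * η * conj u -
      2 * η * conj u * expPrimitive (2 * η * conj u))

lemma loopPrimitive_zero_zero (u : ℂ) : loopPrimitive 0 0 u = 0 := by
  simp [loopPrimitive, expPrimitive_zero]

lemma hasDerivAt_loopPrimitive (k η : ℂ) (s : ℝ) :
    HasDerivAt (fun s : ℝ => loopPrimitive k η (Complex.exp (s * Complex.I)))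
      (loop k η (Complex.exp (s * Complex.I)) - 1 - 2 * k * η) s := by
  have hconj (s : ℝ) : conj (Complex.exp (s * Complex.I)) = Complex.exp (-(s * Complex.I)) := by
    rw [← Complex.exp_conj]; simp
  set u := Complex.exp (s * Complex.I) with hu
  have hid : HasDerivAt (fun s : ℝ => (s : ℂ) * Complex.I) Complex.I s := by
    simpa using (Complex.ofRealCLM.hasDerivAt (x := s)).mul_const Complex.I
  have h1 : HasDerivAt (fun s : ℝ => Complex.exp (s * Complex.I)) (u * Complex.I) s := hid.cexp
  set z := 2 * η * Complex.exp (-(s * Complex.I)) with hz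
  have h2 : HasDerivAt (fun s : ℝ => 2 * η * Complex.exp (-(s * Complex.I)))
      (-(Complex.I * z)) s := by
    refine (hid.neg.cexp.const_mul (2 * η)).congr_deriv ?_
    rw [hz]; simp; ring
  have h3 : HasDerivAt (fun s : ℝ => expPrimitive (2 * η * Complex.exp (-(s * Complex.I))))
      (deriv expPrimitive z * (-(Complex.I * z))) s :=
    (differentiable_expPrimitive z).hasDerivAt.comp s h2
  have h4 := (h3.const_mul Complex.I).sub
    ((h1.const_mul (Complex.I * k)).mul ((h2.cexp.sub h2).sub (h2.mul h3)))
  simp only [loopPrimitive, hconj]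
  refine h4.congr_deriv ?_
  have hk := mul_deriv_expPrimitive z
  have hui : u * Complex.exp (-(s * Complex.I)) = 1 := by rw [hu, ← Complex.exp_add]; simp
  have huz : u * z = 2 * η := by rw [hz]; linear_combination 2 * η * hui
  have hI := Complex.I_mul_I
  rw [loop, hu.symm, hu, hconj, ← hu, ← hz]
  have e1 : deriv expPrimitive z * -(Complex.I * z) = -Complex.I * (Complex.exp z - 1) := by
    rw [← hk]; ring
  simp only [Pi.sub_apply, Pi.mul_apply, e1]
  rw [← hz]
  linear_combination (-(Complex.exp z - 1) - k * u * (Complex.exp z - z - z * expPrimitive z) +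
    k * u * (Complex.exp z * z - z - z * expPrimitive z - z * (Complex.exp z - 1))) * hI - k * huz

lemma contDiff_loopPrimitive : ContDiff ℝ ∞ fun a : ℂ × ℂ × ℂ => loopPrimitive a.1 a.2.1 a.2.2 := by
  have hΦ : ContDiff ℝ ∞ expPrimitive :=
    (differentiable_expPrimitive.contDiff (n := ∞)).restrict_scalars ℝ
  have hE : ContDiff ℝ ∞ Complex.exp := Complex.contDiff_exp
  have hc : ContDiff ℝ ∞ (fun a : ℂ × ℂ × ℂ => conj a.2.2) :=
    Complex.conjCLE.contDiff.comp (contDiff_snd.comp contDiff_snd)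
  have hz : ContDiff ℝ ∞ (fun a : ℂ × ℂ × ℂ => 2 * a.2.1 * conj a.2.2) := by fun_prop
  have h1 := hΦ.comp hz
  have h2 := hE.comp hz
  simp only [Function.comp_def] at h1 h2
  unfold loopPrimitive
  fun_prop

/-- Complex multiples of a vector `q`, where `p × q` plays the role of `i q`. -/
def planeSmul (p q : E3) (ζ : ℂ) : E3 := ζ.re • q + ζ.im • cross p q

lemma hasDerivAt_planeSmul (p q : E3) {g : ℝ → ℂ} {g' : ℂ} {s : ℝ} (h : HasDerivAt g g' s) :
    HasDerivAt (fun s => planeSmul p q (g s)) (planeSmul p q g') s :=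
  ((Complex.reCLM.hasFDerivAt.comp_hasDerivAt s h).smul_const q).add
    ((Complex.imCLM.hasFDerivAt.comp_hasDerivAt s h).smul_const _)

lemma ContDiffAt.planeSmul {X : Type*} [NormedAddCommGroup X] [NormedSpace ℝ X] {n : ℕ∞ω}
    {p q : X → E3} {ζ : X → ℂ} {x : X} (hp : ContDiffAt ℝ n p x) (hq : ContDiffAt ℝ n q x)
    (hζ : ContDiffAt ℝ n ζ x) : ContDiffAt ℝ n (fun y => planeSmul (p y) (q y) (ζ y)) x :=
  ((Complex.reCLM.contDiff.contDiffAt.comp x hζ).smul hq).add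
    ((Complex.imCLM.contDiff.contDiffAt.comp x hζ).smul (hp.cross hq))

/-! ### One corrugation -/

/-- The cylinder `[0, 1] × S²`. -/
def cyl : Set (ℝ × E3) := Set.Icc 0 1 ×ˢ Metric.sphere 0 1

lemma isCompact_cyl : IsCompact cyl := isCompact_Icc.prod (isCompact_sphere 0 1)

/-- Injectivity on the tangent plane of the sphere at `x`. -/
def InjOnTangent (L : E3 →L[ℝ] E3) (x : E3) : Prop := ∀ v, inner ℝ x v = 0 → L v = 0 → v = 0

/-- The partial derivative in the space direction. -/
def spaceDeriv (f : ℝ × E3 → E3) (z : ℝ × E3) : E3 →L[ℝ] E3 :=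
  (fderiv ℝ f z).comp (ContinuousLinearMap.inr ℝ ℝ E3)

lemma ContDiffAt.spaceDeriv {f : ℝ × E3 → E3} {z : ℝ × E3} (hf : ContDiffAt ℝ ∞ f z) :
    ContDiffAt ℝ ∞ (spaceDeriv f) z :=
  (hf.fderiv_right (m := ∞) (by simp)).clm_comp contDiffAt_const

/-- The curve `s ↦ exp (i s)`. -/
def unitExp (s : ℝ) : ℂ := Complex.exp (s * Complex.I)

lemma norm_unitExp (s : ℝ) : ‖unitExp s‖ = 1 := Complex.norm_exp_ofReal_mul_I s

lemma hasDerivAt_unitExp (s : ℝ) : HasDerivAt unitExp (unitExp s * Complex.I) s := by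
  have hid : HasDerivAt (fun s : ℝ => (s : ℂ) * Complex.I) Complex.I s := by
    simpa using (Complex.ofRealCLM.hasDerivAt (x := s)).mul_const Complex.I
  exact hid.cexp

lemma contDiff_unitExp : ContDiff ℝ ∞ unitExp := by
  have : ContDiff ℝ ∞ Complex.exp := Complex.contDiff_exp
  exact this.comp (Complex.ofRealCLM.contDiff.mul contDiff_const)

lemma exists_unitExp {u : ℂ} (hu : ‖u‖ = 1) : ∃ s, unitExp s = u := by
  refine ⟨Complex.arg u, ?_⟩
  have := Complex.norm_mul_exp_arg_mul_I u
  rwa [hu, Complex.ofReal_one, one_mul] at this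

/-- The map obtained from `f` by adding a corrugation in the direction `e`. -/
def corrugate (f : ℝ × E3 → E3) (W : (ℝ × E3) × ℂ → E3) (e : E3) (N : ℝ) (z : ℝ × E3) : E3 :=
  f z + N⁻¹ • W (z, unitExp (N * inner ℝ e z.2))

lemma contDiffAt_corrugate {f : ℝ × E3 → E3} {W : (ℝ × E3) × ℂ → E3} {z : ℝ × E3} (e : E3) (N : ℝ)
    (hf : ContDiffAt ℝ ∞ f z) (hW : ∀ u, ContDiffAt ℝ ∞ W (z, u)) :
    ContDiffAt ℝ ∞ (corrugate f W e N) z := by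
  have h : ContDiff ℝ ∞ fun z : ℝ × E3 => (z, unitExp (N * inner ℝ e z.2)) :=
    contDiff_id.prodMk (contDiff_unitExp.comp
      (contDiff_const.mul (contDiff_const.inner ℝ contDiff_snd)))
  exact hf.add (((hW _).comp z h.contDiffAt).const_smul N⁻¹)

lemma spaceDeriv_corrugate {f : ℝ × E3 → E3} {W : (ℝ × E3) × ℂ → E3} {z : ℝ × E3} (e : E3) {N : ℝ}
    (hN : N ≠ 0) (hf : ContDiffAt ℝ ∞ f z) (hW : ∀ u, ContDiffAt ℝ ∞ W (z, u)) (v : E3) :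
    spaceDeriv (corrugate f W e N) z v = spaceDeriv f z v +
      inner ℝ e v • fderiv ℝ W (z, unitExp (N * inner ℝ e z.2))
        (0, unitExp (N * inner ℝ e z.2) * Complex.I) +
      N⁻¹ • fderiv ℝ W (z, unitExp (N * inner ℝ e z.2)) ((0, v), 0) := by
  have h1 : HasFDerivAt (fun z : ℝ × E3 => N * inner ℝ e z.2)
      (N • ((innerSL ℝ e).comp (ContinuousLinearMap.snd ℝ ℝ E3))) z :=
    (((innerSL ℝ e).hasFDerivAt).comp z hasFDerivAt_snd).const_mul N
  have h2 := (hasDerivAt_unitExp (N * inner ℝ e z.2)).hasFDerivAt.comp z h1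
  have h3 := (hasFDerivAt_id (𝕜 := ℝ) z).prodMk h2
  have h4 := ((hW (unitExp (N * inner ℝ e z.2))).differentiableAt (by simp)).hasFDerivAt.comp z h3
  have h5 := (hf.differentiableAt (by simp)).hasFDerivAt.add (h4.const_smul N⁻¹)
  have h6 : HasFDerivAt (corrugate f W e N) _ z := h5
  rw [spaceDeriv, h6.fderiv]
  set A := fderiv ℝ W (z, unitExp (N * inner ℝ e z.2))
  have hsplit : (((0 : ℝ), v), (N * inner ℝ e v) • (unitExp (N * inner ℝ e z.2) * Complex.I)) =
      (N * inner ℝ e v) • ((0 : ℝ × E3), unitExp (N * inner ℝ e z.2) * Complex.I) +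
        (((0 : ℝ), v), (0 : ℂ)) := by
    simp
  have : A (((0 : ℝ), v), (N * inner ℝ e v) • (unitExp (N * inner ℝ e z.2) * Complex.I)) =
      (N * inner ℝ e v) • A ((0 : ℝ × E3), unitExp (N * inner ℝ e z.2) * Complex.I) +
        A (((0 : ℝ), v), (0 : ℂ)) := by
    rw [hsplit, map_add, map_smul]
  simp only [ContinuousLinearMap.comp_apply, add_apply,
    smul_apply, ContinuousLinearMap.prod_apply,
    ContinuousLinearMap.inr_apply, ContinuousLinearMap.toSpanSingleton_apply,
    ContinuousLinearMap.id_apply, innerSL_apply_apply,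
    ContinuousLinearMap.coe_snd', smul_eq_mul, spaceDeriv]
  rw [this, smul_add, smul_smul, ← mul_assoc, inv_mul_cancel₀ hN, one_mul, add_assoc]

/-- If the ideal derivatives `D f + w ⊗ e + H` are injective on tangent planes, then so is
`D f' + H` for a sufficiently fast corrugation `f'` of `f`. -/
lemma exists_corrugate_injOnTangent {f : ℝ × E3 → E3} {W : (ℝ × E3) × ℂ → E3}
    {H : ℝ × E3 → E3 →L[ℝ] E3} {e : E3}
    (hf : ∀ z ∈ cyl, ContDiffAt ℝ ∞ f z) (hW : ∀ z ∈ cyl, ∀ u, ContDiffAt ℝ ∞ W (z, u))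
    (hH : ∀ z ∈ cyl, ContDiffAt ℝ ∞ H z)
    (hinj : ∀ z ∈ cyl, ∀ s : ℝ, InjOnTangent (spaceDeriv f z +
      (innerSL ℝ e).smulRight (fderiv ℝ W (z, unitExp s) (0, unitExp s * Complex.I)) + H z) z.2) :
    ∃ N : ℝ, ∀ z ∈ cyl, InjOnTangent (spaceDeriv (corrugate f W e N) z + H z) z.2 := by
  have hDW : ContinuousOn (fun a : (ℝ × E3) × ℂ => fderiv ℝ W a)
      (cyl ×ˢ Metric.sphere (0 : ℂ) 1) := fun a ha =>
    ((hW a.1 ha.1 a.2).fderiv_right (m := 0) (by simp)).continuousAt.continuousWithinAt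
  obtain ⟨C, hC⟩ := (isCompact_cyl.prod (isCompact_sphere (0 : ℂ) 1)).exists_bound_of_continuousOn
    hDW
  let S : Set (((ℝ × E3) × ℂ) × E3) :=
    ((cyl ×ˢ Metric.sphere (0 : ℂ) 1) ×ˢ Metric.sphere (0 : E3) 1) ∩
      {a | inner ℝ a.1.1.2 a.2 = 0}
  have hS : IsCompact S := by
    refine ((isCompact_cyl.prod (isCompact_sphere (0 : ℂ) 1)).prod
      (isCompact_sphere (0 : E3) 1)).inter_right ?_
    exact isClosed_eq (by fun_prop) continuous_const
  let M : ((ℝ × E3) × ℂ) × E3 → E3 := fun a => spaceDeriv f a.1.1 a.2 +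
    inner ℝ e a.2 • fderiv ℝ W a.1 (0, a.1.2 * Complex.I) + H a.1.1 a.2
  have hM : ContinuousOn M S := by
    have c1 : ContinuousOn (fun a : ((ℝ × E3) × ℂ) × E3 => spaceDeriv f a.1.1) S := fun a ha =>
      (((hf a.1.1 ha.1.1.1).spaceDeriv.continuousAt).comp (f := fun a : ((ℝ × E3) × ℂ) × E3 =>
        a.1.1) (by fun_prop)).continuousWithinAt
    have c2 : ContinuousOn (fun a : ((ℝ × E3) × ℂ) × E3 => H a.1.1) S := fun a ha =>
      (((hH a.1.1 ha.1.1.1).continuousAt).comp (f := fun a : ((ℝ × E3) × ℂ) × E3 =>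
        a.1.1) (by fun_prop)).continuousWithinAt
    have c3 : ContinuousOn (fun a : ((ℝ × E3) × ℂ) × E3 => fderiv ℝ W a.1) S :=
      hDW.comp continuousOn_fst fun a ha => ha.1.1
    have d1 : ContinuousOn (fun a : ((ℝ × E3) × ℂ) × E3 => spaceDeriv f a.1.1 a.2) S :=
      c1.clm_apply continuousOn_snd
    have d2 : ContinuousOn (fun a : ((ℝ × E3) × ℂ) × E3 => H a.1.1 a.2) S :=
      c2.clm_apply continuousOn_snd
    have d3 : ContinuousOn (fun a : ((ℝ × E3) × ℂ) × E3 =>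
        fderiv ℝ W a.1 ((0 : ℝ × E3), a.1.2 * Complex.I)) S :=
      c3.clm_apply (Continuous.continuousOn (by fun_prop))
    have d4 : ContinuousOn (fun a : ((ℝ × E3) × ℂ) × E3 => inner ℝ e a.2) S :=
      Continuous.continuousOn (by fun_prop)
    exact (d1.add (d4.smul d3)).add d2
  obtain ⟨c, hc, hcM⟩ : ∃ c > 0, ∀ a ∈ S, c ≤ ‖M a‖ := by
    rcases S.eq_empty_or_nonempty with h | h
    · exact ⟨1, one_pos, by simp [h]⟩
    · obtain ⟨a, ha, hmin⟩ := hS.exists_isMinOn h hM.norm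
      refine ⟨‖M a‖, norm_pos_iff.mpr fun h0 => ?_, fun b hb => hmin hb⟩
      obtain ⟨s, hs⟩ := exists_unitExp (u := a.1.2) (by simpa using ha.1.1.2)
      have := hinj a.1.1 ha.1.1.1 s a.2 ha.2 (by rw [hs]; exact h0)
      have h1 : ‖a.2‖ = 1 := by simpa using ha.1.2
      simp [this] at h1
  have hC' : 0 ≤ |C| := abs_nonneg C
  have hN : 0 < (|C| + 1) / c := by positivity
  refine ⟨(|C| + 1) / c, fun z hz v hv h0 => ?_⟩
  by_contra hv0
  have hvn : 0 < ‖v‖ := norm_pos_iff.mpr hv0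
  set u := unitExp ((|C| + 1) / c * inner ℝ e z.2) with hu
  have hun : ‖u‖ = 1 := norm_unitExp _
  have hmem : (((z, u), ‖v‖⁻¹ • v) : ((ℝ × E3) × ℂ) × E3) ∈ S := by
    refine ⟨⟨⟨hz, by simpa using hun⟩, ?_⟩, ?_⟩
    · simp [norm_smul, hvn.ne']
    · simp [inner_smul_right, hv]
  have h1 := hcM _ hmem
  have hMv : M ((z, u), ‖v‖⁻¹ • v) = ‖v‖⁻¹ • M ((z, u), v) := by
    simp only [M, map_smul, inner_smul_right, smul_add, smul_smul]
  rw [hMv, norm_smul, norm_inv, norm_norm, inv_mul_eq_div, le_div_iff₀ hvn] at h1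
  have h2 : M ((z, u), v) =
      -(((|C| + 1) / c)⁻¹ • fderiv ℝ W (z, u) ((0, v), 0)) := by
    rw [add_apply,
      spaceDeriv_corrugate e hN.ne' (hf z hz) (hW z hz), ← hu] at h0
    rw [eq_neg_iff_add_eq_zero, ← h0]
    simp only [M]
    abel
  have h3 : ‖fderiv ℝ W (z, u) ((0, v), 0)‖ ≤ |C| * ‖v‖ := by
    refine (ContinuousLinearMap.le_opNorm _ _).trans (mul_le_mul ?_ ?_ (norm_nonneg _) hC')
    · exact (hC (z, u) ⟨hz, by simpa using hun⟩).trans (le_abs_self C)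
    · simp [Prod.norm_def]
  rw [h2, norm_neg, norm_smul, norm_inv, Real.norm_of_nonneg hN.le, inv_mul_eq_div,
    le_div_iff₀ hN] at h1
  have h4 : c * ‖v‖ * ((|C| + 1) / c) = (|C| + 1) * ‖v‖ := by field_simp
  rw [h4] at h1
  nlinarith

/-- The squared distance from `x` to the line spanned by the unit vector `e`. -/
def axisDistSq (e x : E3) : ℝ := inner ℝ x x - inner ℝ e x ^ 2

/-- A cutoff function, vanishing near the axis `e` and at times `0` and `1`. -/
def corrCutoff (e : E3) (z : ℝ × E3) : ℝ :=
  Real.smoothTransition (4 * z.1) * Real.smoothTransition (4 * (1 - z.1)) *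
    Real.smoothTransition (12 * axisDistSq e z.2 - 1)

lemma contDiff_axisDistSq (e : E3) : ContDiff ℝ ∞ (axisDistSq e) :=
  (contDiff_id.inner ℝ contDiff_id).sub ((contDiff_const.inner ℝ contDiff_id).pow 2)

lemma contDiff_corrCutoff (e : E3) : ContDiff ℝ ∞ (corrCutoff e) := by
  have h : ContDiff ℝ ∞ Real.smoothTransition := Real.smoothTransition.contDiff
  have h2 := (contDiff_axisDistSq e).comp (contDiff_snd (𝕜 := ℝ) (E := ℝ) (F := E3))
  exact ((h.comp (by fun_prop)).mul (h.comp (by fun_prop))).mul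
    (h.comp ((contDiff_const.mul h2).sub contDiff_const))

lemma corrCutoff_nonneg (e : E3) (z : ℝ × E3) : 0 ≤ corrCutoff e z :=
  mul_nonneg (mul_nonneg (Real.smoothTransition.nonneg _) (Real.smoothTransition.nonneg _))
    (Real.smoothTransition.nonneg _)

lemma corrCutoff_le_one (e : E3) (z : ℝ × E3) : corrCutoff e z ≤ 1 :=
  mul_le_one₀ (mul_le_one₀ (Real.smoothTransition.le_one _) (Real.smoothTransition.nonneg _)
    (Real.smoothTransition.le_one _)) (Real.smoothTransition.nonneg _)
    (Real.smoothTransition.le_one _)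

lemma corrCutoff_eq_zero {e : E3} {z : ℝ × E3} (h : axisDistSq e z.2 < 1 / 12) :
    corrCutoff e z = 0 := by
  rw [corrCutoff, Real.smoothTransition.zero_of_nonpos (x := 12 * axisDistSq e z.2 - 1)
    (by linarith), mul_zero]

lemma corrCutoff_eq_one {e : E3} {z : ℝ × E3} (ht : z.1 ∈ Set.Icc (1 / 4 : ℝ) (3 / 4))
    (h : 1 / 6 ≤ axisDistSq e z.2) : corrCutoff e z = 1 := by
  rw [corrCutoff, Real.smoothTransition.one_of_one_le (by linarith [ht.1]),
    Real.smoothTransition.one_of_one_le (by linarith [ht.2]),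
    Real.smoothTransition.one_of_one_le (by linarith), one_mul, one_mul]

lemma corrCutoff_zero_left (e x : E3) : corrCutoff e (0, x) = 0 := by
  simp [corrCutoff]

lemma corrCutoff_one_left (e x : E3) : corrCutoff e (1, x) = 0 := by
  simp [corrCutoff]

/-- The component of `e` tangent to the sphere at `x`. -/
def axisGrad (e x : E3) : E3 := e - (inner ℝ e x) • x

lemma inner_axisGrad_self {x : E3} (hx : ‖x‖ = 1) (e : E3) : inner ℝ x (axisGrad e x) = 0 := by
  rw [axisGrad, inner_sub_right, inner_smul_right, real_inner_self_eq_norm_sq, hx,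
    real_inner_comm x e]
  ring

lemma inner_cross_axisGrad (e x : E3) : inner ℝ (cross x e) (axisGrad e x) = 0 := by
  rw [axisGrad, inner_sub_right, inner_smul_right, real_inner_comm e, inner_cross_right,
    real_inner_comm x (cross x e), inner_cross_left]
  ring

lemma normSq_cross_eq_axisDistSq {e x : E3} (he : ‖e‖ = 1) (hx : ‖x‖ = 1) :
    inner ℝ (cross x e) (cross x e) = axisDistSq e x := by
  have h1 : inner ℝ e e = (1 : ℝ) := by rw [real_inner_self_eq_norm_sq, he, one_pow]
  have h2 : inner ℝ x x = (1 : ℝ) := by rw [real_inner_self_eq_norm_sq, hx, one_pow]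
  have : inner ℝ (cross x e) (cross x e) = inner ℝ x x * inner ℝ e e - inner ℝ e x ^ 2 := by
    simp only [E3.inner_eq, cross_apply_zero, cross_apply_one, cross_apply_two]; ring
  rw [this, h1, mul_one, axisDistSq]

lemma axisDistSq_nonneg {e x : E3} (he : ‖e‖ = 1) (hx : ‖x‖ = 1) : 0 ≤ axisDistSq e x := by
  rw [← normSq_cross_eq_axisDistSq he hx]
  exact real_inner_self_nonneg

lemma axisDistSq_smul_eq {e x : E3} (he : ‖e‖ = 1) (hx : ‖x‖ = 1)
    {v : E3} (hv : inner ℝ x v = 0) :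
    axisDistSq e x • v = (inner ℝ v (cross x e)) • cross x e + (inner ℝ e v) • axisGrad e x := by
  have h2 : inner ℝ x x = (1 : ℝ) := by rw [real_inner_self_eq_norm_sq, hx, one_pow]
  have h := normSq_cross_smul_eq x e v
  have hν : inner ℝ v (cross (cross x e) x) = inner ℝ e v := by
    have : inner ℝ v (cross (cross x e) x) = inner ℝ x x * inner ℝ e v -
        inner ℝ x e * inner ℝ x v := by
      simp only [E3.inner_eq, cross_apply_zero, cross_apply_one, cross_apply_two]; ring
    rw [this, h2, hv]; ring
  rw [normSq_cross_eq_axisDistSq he hx, hν] at h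
  have h3 := congrArg (inner ℝ x) h
  simp only [inner_add_right, inner_smul_right, hv, h2, inner_cross_left] at h3
  rw [h, axisGrad, real_inner_comm x e, smul_sub, smul_smul,
    show inner ℝ v (cross e (cross x e)) = -(inner ℝ e v * inner ℝ x e) by linarith]
  module

lemma inner_axisGrad_right {e x : E3} (he : ‖e‖ = 1) (hx : ‖x‖ = 1) :
    inner ℝ e (axisGrad e x) = axisDistSq e x := by
  rw [axisGrad, axisDistSq, inner_sub_right, inner_smul_right, real_inner_self_eq_norm_sq, he,
    real_inner_self_eq_norm_sq, hx]
  ring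

lemma cross_map_ne_zero {e x : E3} (he : ‖e‖ = 1) (hx : ‖x‖ = 1)
    {L : E3 →L[ℝ] E3} (hL : InjOnTangent L x) (hm : 0 < axisDistSq e x) :
    cross (L (cross x e)) (L (axisGrad e x)) ≠ 0 := by
  intro h
  obtain ⟨a, b, hab, h0⟩ := exists_comb_eq_zero_of_cross_eq_zero h
  rw [← map_smul, ← map_smul, ← map_add] at h0
  have hz := hL _ (by rw [inner_add_right, inner_smul_right, inner_smul_right, inner_cross_left,
    inner_axisGrad_self hx]; ring) h0
  have h1 := congrArg (inner ℝ (cross x e)) hz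
  have h2 := congrArg (inner ℝ e) hz
  rw [inner_add_right, inner_smul_right, inner_smul_right, inner_zero_right] at h1 h2
  rw [inner_cross_axisGrad, normSq_cross_eq_axisDistSq he hx, mul_zero, add_zero] at h1
  rw [inner_cross_right, inner_axisGrad_right he hx, mul_zero, zero_add] at h2
  rcases hab with h | h
  · exact h ((mul_eq_zero.mp h1).resolve_right hm.ne')
  · exact h ((mul_eq_zero.mp h2).resolve_right hm.ne')

/-- The complex coordinate of `-m a` in the plane spanned by `q` and `p × q`, modulo `p`. -/
def planeCoord (p q a : E3) (m : ℝ) : ℂ :=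
  ((-(m / inner ℝ (cross p q) (cross p q)) * inner ℝ a (cross (cross p q) p) : ℝ) : ℂ) +
    ((-(m / inner ℝ (cross p q) (cross p q)) * inner ℝ a (cross p q) : ℝ) : ℂ) * Complex.I

lemma planeCoord_zero (p q : E3) (m : ℝ) : planeCoord p q 0 m = 0 := by simp [planeCoord]

lemma exists_neg_smul_eq_planeSmul {p q : E3} (h : cross p q ≠ 0) (a : E3) (m : ℝ) :
    ∃ l : ℝ, -(m • a) = l • p + planeSmul p q (planeCoord p q a m) := by
  have hn : inner ℝ (cross p q) (cross p q) ≠ 0 := inner_self_ne_zero.mpr h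
  refine ⟨-(m / inner ℝ (cross p q) (cross p q)) * inner ℝ a (cross q (cross p q)), ?_⟩
  have h1 := congrArg (fun y => (-(m / inner ℝ (cross p q) (cross p q))) • y)
    (normSq_cross_smul_eq p q a)
  simp only [smul_smul, smul_add] at h1
  have h2 : -(m / inner ℝ (cross p q) (cross p q)) * inner ℝ (cross p q) (cross p q) = -m := by
    field_simp
  rw [h2] at h1
  rw [← neg_smul, h1, planeSmul, planeCoord, add_assoc]
  simp only [Complex.add_re, Complex.add_im, Complex.ofReal_re, Complex.ofReal_im,
    Complex.re_ofReal_mul, Complex.im_ofReal_mul, Complex.I_re, Complex.I_im, mul_zero, mul_one,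
    add_zero, zero_add]

lemma ContDiffAt.planeCoord {X : Type*} [NormedAddCommGroup X] [NormedSpace ℝ X] {n : ℕ∞ω}
    {p q a : X → E3} {m : X → ℝ} {x : X} (hp : ContDiffAt ℝ n p x) (hq : ContDiffAt ℝ n q x)
    (ha : ContDiffAt ℝ n a x) (hm : ContDiffAt ℝ n m x) (h : _root_.cross (p x) (q x) ≠ 0) :
    ContDiffAt ℝ n (fun y => _root_.planeCoord (p y) (q y) (a y) (m y)) x := by
  have hc := hp.cross hq
  have hd := (hm.div (hc.inner ℝ hc) (inner_self_ne_zero.mpr h)).neg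
  exact (Complex.ofRealCLM.contDiff.contDiffAt.comp x (hd.mul (ha.inner ℝ (hc.cross hp)))).add
    ((Complex.ofRealCLM.contDiff.contDiffAt.comp x (hd.mul (ha.inner ℝ hc))).mul contDiffAt_const)

/-- The profile of the corrugation in direction `e` with formal derivative `L` and increment `a`. -/
def corrProfile (e : E3) (L : ℝ × E3 → E3 →L[ℝ] E3) (a : ℝ × E3 → E3) (b : (ℝ × E3) × ℂ) : E3 :=
  (axisDistSq e b.1.2)⁻¹ • planeSmul (L b.1 (cross b.1.2 e)) (L b.1 (axisGrad e b.1.2))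
    (loopPrimitive ((corrCutoff e b.1 / 2 : ℝ) : ℂ)
      (planeCoord (L b.1 (cross b.1.2 e)) (L b.1 (axisGrad e b.1.2)) (a b.1)
        (axisDistSq e b.1.2)) b.2)

lemma corrProfile_eq_zero {e : E3} {a : ℝ × E3 → E3} {z : ℝ × E3} (L : ℝ × E3 → E3 →L[ℝ] E3)
    (u : ℂ) (hχ : corrCutoff e z = 0) (ha : a z = 0) : corrProfile e L a (z, u) = 0 := by
  simp [corrProfile, hχ, ha, planeCoord_zero, loopPrimitive_zero_zero, planeSmul]

lemma corrProfile_eventually_eq_zero {e : E3} {a : ℝ × E3 → E3} (L : ℝ × E3 → E3 →L[ℝ] E3)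
    (hsupp : ∀ z : ℝ × E3, axisDistSq e z.2 < 1 / 6 → a z = 0) {z : ℝ × E3}
    (hz : axisDistSq e z.2 < 1 / 12) (u : ℂ) :
    corrProfile e L a =ᶠ[nhds (z, u)] fun _ => 0 := by
  have hc : Continuous fun b : (ℝ × E3) × ℂ => axisDistSq e b.1.2 :=
    (contDiff_axisDistSq e).continuous.comp (continuous_snd.comp continuous_fst)
  filter_upwards [hc.continuousAt.eventually (gt_mem_nhds hz)] with b hb
  exact corrProfile_eq_zero L b.2 (corrCutoff_eq_zero hb) (hsupp _ (hb.trans (by norm_num)))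

lemma contDiffAt_corrProfile {e : E3} (he : ‖e‖ = 1) {L : ℝ × E3 → E3 →L[ℝ] E3}
    {a : ℝ × E3 → E3} (hsupp : ∀ z : ℝ × E3, axisDistSq e z.2 < 1 / 6 → a z = 0) {z : ℝ × E3}
    (hz : z ∈ cyl) (hL : ContDiffAt ℝ ∞ L z) (ha : ContDiffAt ℝ ∞ a z)
    (hinj : InjOnTangent (L z) z.2) (u : ℂ) : ContDiffAt ℝ ∞ (corrProfile e L a) (z, u) := by
  have hx : ‖z.2‖ = 1 := by simpa using hz.2
  rcases (axisDistSq_nonneg he hx).eq_or_lt with h | h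
  · exact contDiffAt_const.congr_of_eventuallyEq
      (corrProfile_eventually_eq_zero L hsupp (by rw [← h]; norm_num) u)
  · have hfst : ContDiffAt ℝ ∞ (fun b : (ℝ × E3) × ℂ => b.1) (z, u) := contDiffAt_fst
    have hx2 : ContDiffAt ℝ ∞ (fun b : (ℝ × E3) × ℂ => b.1.2) (z, u) := hfst.snd
    have hL' : ContDiffAt ℝ ∞ (fun b : (ℝ × E3) × ℂ => L b.1) (z, u) :=
      ContDiffAt.comp (z, u) (g := L) hL hfst
    have ha' : ContDiffAt ℝ ∞ (fun b : (ℝ × E3) × ℂ => a b.1) (z, u) :=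
      ContDiffAt.comp (z, u) (g := a) ha hfst
    have hm : ContDiffAt ℝ ∞ (fun b : (ℝ × E3) × ℂ => axisDistSq e b.1.2) (z, u) :=
      (contDiff_axisDistSq e).contDiffAt.comp (z, u) hx2
    have hχ : ContDiffAt ℝ ∞ (fun b : (ℝ × E3) × ℂ => ((corrCutoff e b.1 / 2 : ℝ) : ℂ)) (z, u) :=
      Complex.ofRealCLM.contDiff.contDiffAt.comp (z, u)
        (((contDiff_corrCutoff e).contDiffAt.comp (z, u) hfst).div_const 2)
    have hp : ContDiffAt ℝ ∞ (fun b : (ℝ × E3) × ℂ => L b.1 (cross b.1.2 e)) (z, u) :=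
      hL'.clm_apply (hx2.cross contDiffAt_const)
    have hq : ContDiffAt ℝ ∞ (fun b : (ℝ × E3) × ℂ => L b.1 (axisGrad e b.1.2)) (z, u) :=
      hL'.clm_apply (contDiffAt_const.sub ((contDiffAt_const.inner ℝ hx2).smul hx2))
    have hη := hp.planeCoord hq ha' hm (cross_map_ne_zero he hx hinj h)
    have hu : ContDiffAt ℝ ∞ (fun b : (ℝ × E3) × ℂ => b.2) (z, u) := contDiffAt_snd
    have hl := ContDiffAt.comp (z, u) contDiff_loopPrimitive.contDiffAt (hχ.prodMk (hη.prodMk hu))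
    exact (hm.inv h.ne').smul (hp.planeSmul hq hl)

lemma injOnTangent_corrProfile {e : E3} (he : ‖e‖ = 1) {L : ℝ × E3 → E3 →L[ℝ] E3}
    {a : ℝ × E3 → E3} (hsupp : ∀ z : ℝ × E3, axisDistSq e z.2 < 1 / 6 → a z = 0) {z : ℝ × E3}
    (hz : z ∈ cyl) (htime : z.1 ∉ Set.Icc (1 / 4 : ℝ) (3 / 4) → a z = 0)
    (hL : ContDiffAt ℝ ∞ L z) (ha : ContDiffAt ℝ ∞ a z)
    (hinj : InjOnTangent (L z) z.2) (s : ℝ) :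
    InjOnTangent (L z + (innerSL ℝ e).smulRight
      (fderiv ℝ (corrProfile e L a) (z, unitExp s) (0, unitExp s * Complex.I) - a z)) z.2 := by
  have hx : ‖z.2‖ = 1 := by simpa using hz.2
  rcases (axisDistSq_nonneg he hx).eq_or_lt with h | h
  · rw [(corrProfile_eventually_eq_zero L hsupp (by rw [← h]; norm_num) _).fderiv_eq,
      hsupp z (by rw [← h]; norm_num)]
    intro v hv h0
    exact hinj v hv (by simpa using h0)
  · set p := L z (cross z.2 e) with hp
    set q := L z (axisGrad e z.2) with hq
    set m := axisDistSq e z.2 with hm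
    set k := corrCutoff e z with hk
    set η := planeCoord p q (a z) m with hη
    have hpq : cross p q ≠ 0 := cross_map_ne_zero he hx hinj h
    have hderiv : fderiv ℝ (corrProfile e L a) (z, unitExp s) (0, unitExp s * Complex.I) =
        m⁻¹ • planeSmul p q (loop ((k / 2 : ℝ) : ℂ) η (unitExp s) - 1 -
          2 * ((k / 2 : ℝ) : ℂ) * η) := by
      have h1 : HasDerivAt (fun s => corrProfile e L a (z, unitExp s))
          (fderiv ℝ (corrProfile e L a) (z, unitExp s) (0, unitExp s * Complex.I)) s :=
        HasFDerivAt.comp_hasDerivAt (f := fun s => (z, unitExp s)) s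
          ((contDiffAt_corrProfile he hsupp hz hL ha hinj
            (unitExp s)).differentiableAt (by simp)).hasFDerivAt
          ((hasDerivAt_const s z).prodMk (hasDerivAt_unitExp s))
      exact h1.unique ((hasDerivAt_planeSmul p q
        (hasDerivAt_loopPrimitive ((k / 2 : ℝ) : ℂ) η s)).const_smul m⁻¹)
    have hkη : (k : ℂ) * η = η := by
      by_cases ha0 : a z = 0
      · rw [hη, ha0, planeCoord_zero, mul_zero]
      · have hk1 : k = 1 := corrCutoff_eq_one (by_contra fun h => ha0 (htime h))
          (le_of_not_gt fun h => ha0 (hsupp z h))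
        rw [hk1, Complex.ofReal_one, one_mul]
    have hloop : loop ((k / 2 : ℝ) : ℂ) η (unitExp s) ≠ 0 := by
      refine loop_ne_zero η ?_ (norm_unitExp s)
      rw [Complex.norm_real, Real.norm_of_nonneg (by linarith [corrCutoff_nonneg e z])]
      linarith [corrCutoff_le_one e z]
    set ζ := loop ((k / 2 : ℝ) : ℂ) η (unitExp s) with hζ
    have hζ' : ζ - 1 - 2 * ((k / 2 : ℝ) : ℂ) * η = ζ - 1 - η := by
      push_cast
      linear_combination -hkη
    obtain ⟨l, hl⟩ := exists_neg_smul_eq_planeSmul hpq (a z) m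
    rw [← hη] at hl
    intro v hv h0
    rw [hderiv, hζ'] at h0
    have h1 : m • (L z v) = (inner ℝ v (cross z.2 e)) • p + (inner ℝ e v) • q := by
      rw [← map_smul, axisDistSq_smul_eq he hx hv, map_add, map_smul, map_smul]
    have h2 : (inner ℝ v (cross z.2 e) + inner ℝ e v * l) • p + (inner ℝ e v * ζ.re) • q +
        (inner ℝ e v * ζ.im) • cross p q = 0 := by
      have h3 : m • (L z v) + inner ℝ e v • (planeSmul p q (ζ - 1 - η) + -(m • a z)) = 0 := by
        have := congrArg (fun y => m • y) h0
        simp only [add_apply, ContinuousLinearMap.smulRight_apply, innerSL_apply_apply,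
          smul_add, smul_zero, smul_sub] at this
        rw [smul_comm m (inner ℝ e v), smul_inv_smul₀ h.ne', smul_comm m (inner ℝ e v)] at this
        rw [← this]
        module
      rw [h1, hl] at h3
      rw [← h3]
      simp only [planeSmul, Complex.sub_re, Complex.sub_im, Complex.one_re, Complex.one_im]
      module
    obtain ⟨e1, e2, e3⟩ := eq_zero_of_comb_cross_eq_zero hpq h2
    have hev : inner ℝ e v = 0 := by
      by_contra hne
      exact hloop (Complex.ext ((mul_eq_zero.mp e2).resolve_left hne)
        ((mul_eq_zero.mp e3).resolve_left hne))
    have h4 := axisDistSq_smul_eq he hx hv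
    rw [hev, zero_mul, add_zero] at e1
    rw [hev, e1, zero_smul, zero_smul, add_zero] at h4
    exact (smul_eq_zero.mp h4).resolve_left h.ne'

/-- One step of convex integration: the formal term `a ⊗ e` is absorbed into the derivative of
a map `f'`, which agrees with `f` at times `0` and `1`. -/
lemma exists_absorb {e : E3} (he : ‖e‖ = 1) {f a : ℝ × E3 → E3} {H : ℝ × E3 → E3 →L[ℝ] E3}
    (hf : ∀ z ∈ cyl, ContDiffAt ℝ ∞ f z) (ha : ∀ z ∈ cyl, ContDiffAt ℝ ∞ a z)
    (hH : ∀ z ∈ cyl, ContDiffAt ℝ ∞ H z)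
    (hsupp : ∀ z : ℝ × E3, axisDistSq e z.2 < 1 / 6 → a z = 0)
    (htime : ∀ z ∈ cyl, z.1 ∉ Set.Icc (1 / 4 : ℝ) (3 / 4) → a z = 0)
    (hinj : ∀ z ∈ cyl,
      InjOnTangent (spaceDeriv f z + (innerSL ℝ e).smulRight (a z) + H z) z.2) :
    ∃ f' : ℝ × E3 → E3, (∀ z ∈ cyl, ContDiffAt ℝ ∞ f' z) ∧
      (∀ x : E3, ‖x‖ = 1 → f' (0, x) = f (0, x) ∧ f' (1, x) = f (1, x)) ∧
      ∀ z ∈ cyl, InjOnTangent (spaceDeriv f' z + H z) z.2 := by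
  set L : ℝ × E3 → E3 →L[ℝ] E3 :=
    fun z => spaceDeriv f z + (innerSL ℝ e).smulRight (a z) + H z with hLdef
  have hL : ∀ z ∈ cyl, ContDiffAt ℝ ∞ L z := fun z hz =>
    ((hf z hz).spaceDeriv.add (contDiffAt_const.smulRight (ha z hz))).add (hH z hz)
  have hW : ∀ z ∈ cyl, ∀ u, ContDiffAt ℝ ∞ (corrProfile e L a) (z, u) := fun z hz u =>
    contDiffAt_corrProfile he hsupp hz (hL z hz) (ha z hz) (hinj z hz) u
  obtain ⟨N, hN⟩ := exists_corrugate_injOnTangent (e := e) hf hW hH fun z hz s => by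
    have := injOnTangent_corrProfile he hsupp hz (htime z hz) (hL z hz) (ha z hz) (hinj z hz) s
    convert this using 1
    ext1 v
    simp only [hLdef, add_apply, ContinuousLinearMap.smulRight_apply, innerSL_apply_apply]
    module
  refine ⟨corrugate f (corrProfile e L a) e N,
    fun z hz => contDiffAt_corrugate e N (hf z hz) (hW z hz), fun x hx => ⟨?_, ?_⟩, hN⟩
  · rw [corrugate, corrProfile_eq_zero L _ (corrCutoff_zero_left e x)
      (htime _ ⟨by simp, by simpa using hx⟩ (by norm_num)), smul_zero, add_zero]
  · rw [corrugate, corrProfile_eq_zero L _ (corrCutoff_one_left e x)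
      (htime _ ⟨by simp, by simpa using hx⟩ (by norm_num)), smul_zero, add_zero]

/-! ### Formal immersions are homotopic to immersions -/

/-- The standard basis of `E3`. -/
def stdVec (i : Fin 3) : E3 := EuclideanSpace.single i 1

lemma inner_stdVec (i : Fin 3) (x : E3) : inner ℝ (stdVec i) x = x i := by
  simp [stdVec, EuclideanSpace.inner_single_left]

lemma norm_stdVec (i : Fin 3) : ‖stdVec i‖ = 1 := by simp [stdVec]

lemma sum_smul_stdVec (x : E3) : ∑ i, x i • stdVec i = x := by
  ext k
  fin_cases k <;> simp [stdVec, Fin.sum_univ_three]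

lemma sq_le_axisDistSq {i j : Fin 3} (h : j ≠ i) (x : E3) : x j ^ 2 ≤ axisDistSq (stdVec i) x := by
  rw [axisDistSq, inner_stdVec, E3.inner_eq]
  fin_cases i <;> fin_cases j <;> simp at h ⊢ <;>
    nlinarith [sq_nonneg (x 0), sq_nonneg (x 1), sq_nonneg (x 2)]

/-- A cutoff function, supported where the `j`-th coordinate is large. -/
def coordCutoff (j : Fin 3) (x : E3) : ℝ := Real.smoothTransition (12 * x j ^ 2 - 2)

lemma coordCutoff_eq_zero {j : Fin 3} {x : E3} (h : x j ^ 2 < 1 / 6) : coordCutoff j x = 0 :=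
  Real.smoothTransition.zero_of_nonpos (by linarith)

lemma contDiff_coordCutoff (j : Fin 3) : ContDiff ℝ ∞ (coordCutoff j) := by
  have h : ContDiff ℝ ∞ Real.smoothTransition := Real.smoothTransition.contDiff
  exact h.comp (by fun_prop)

/-- The normalisation making the functions `coordCutoff j x * x j ^ 2` a partition of unity. -/
def coordCutoffSum (x : E3) : ℝ := ∑ k, coordCutoff k x * x k ^ 2

lemma contDiff_coordCutoffSum : ContDiff ℝ ∞ coordCutoffSum :=
  ContDiff.sum fun k _ => (contDiff_coordCutoff k).mul (by fun_prop)

lemma coordCutoffSum_pos {x : E3} (hx : ‖x‖ = 1) : 0 < coordCutoffSum x := by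
  have h1 : x 0 * x 0 + x 1 * x 1 + x 2 * x 2 = 1 := by
    rw [← E3.inner_eq, real_inner_self_eq_norm_sq, hx, one_pow]
  have hnn : ∀ k ∈ Finset.univ, 0 ≤ coordCutoff k x * x k ^ 2 := fun k _ =>
    mul_nonneg (Real.smoothTransition.nonneg _) (sq_nonneg _)
  obtain ⟨k, hk⟩ : ∃ k : Fin 3, 1 / 3 ≤ x k ^ 2 := by
    by_contra! h
    nlinarith [h 0, h 1, h 2]
  refine Finset.sum_pos' hnn ⟨k, Finset.mem_univ k, ?_⟩
  rw [coordCutoff, Real.smoothTransition.one_of_one_le (by linarith)]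
  linarith

/-- The coefficient of `stdVec i` when the restriction of `A` to tangent vectors at `x` is written
as a sum of tensors vanishing near the respective axes. -/
def tangentCoeff (A : E3 →L[ℝ] E3) (i : Fin 3) (x : E3) : E3 :=
  ∑ j, (coordCutoff j x / coordCutoffSum x * x j) • A (x j • stdVec i - x i • stdVec j)

lemma tangentCoeff_eq_zero (A : E3 →L[ℝ] E3) {i : Fin 3} {x : E3}
    (h : axisDistSq (stdVec i) x < 1 / 6) : tangentCoeff A i x = 0 := by
  refine Finset.sum_eq_zero fun j _ => ?_
  by_cases hj : j = i
  · rw [hj, sub_self, map_zero, smul_zero]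
  · rw [coordCutoff_eq_zero ((sq_le_axisDistSq hj x).trans_lt h), zero_div, zero_mul, zero_smul]

lemma tangentCoeff_eq_zero_of_tangent {A : E3 →L[ℝ] E3} {x : E3}
    (h : ∀ v, inner ℝ x v = 0 → A v = 0) (i : Fin 3) : tangentCoeff A i x = 0 := by
  refine Finset.sum_eq_zero fun j _ => ?_
  rw [h, smul_zero]
  rw [inner_sub_right, inner_smul_right, inner_smul_right, real_inner_comm, inner_stdVec,
    real_inner_comm, inner_stdVec, mul_comm, sub_self]

lemma sum_smul_tangentCoeff (A : E3 →L[ℝ] E3) {x v : E3} (hx : ‖x‖ = 1) (hv : inner ℝ x v = 0) :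
    ∑ i, v i • tangentCoeff A i x = A v := by
  have h1 : ∀ j, ∑ i, v i • (x j • stdVec i - x i • stdVec j) = x j • v := fun j => by
    have h2 : ∑ i, v i * x i = 0 := by rw [← hv, E3.inner_eq, Fin.sum_univ_three]; ring
    simp_rw [smul_sub, Finset.sum_sub_distrib, smul_smul, ← Finset.sum_smul, h2, zero_smul,
      sub_zero, mul_comm _ (x j), mul_smul, ← Finset.smul_sum, sum_smul_stdVec]
  simp_rw [tangentCoeff, Finset.smul_sum]
  rw [Finset.sum_comm]
  have h2 : ∀ j, ∑ i, v i • ((coordCutoff j x / coordCutoffSum x * x j) •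
      A (x j • stdVec i - x i • stdVec j)) =
        (coordCutoff j x * x j ^ 2 / coordCutoffSum x) • A v := fun j => by
    simp_rw [smul_comm (v _)]
    rw [← Finset.smul_sum]
    simp_rw [← map_smul A]
    rw [← map_sum, h1, map_smul, map_smul, smul_smul]
    ring_nf
  simp_rw [h2]
  rw [← Finset.sum_smul, ← Finset.sum_div]
  convert one_smul ℝ (A v)
  exact div_self (coordCutoffSum_pos hx).ne'

lemma ContDiffAt.tangentCoeff {A : ℝ × E3 → E3 →L[ℝ] E3} {z : ℝ × E3} (hA : ContDiffAt ℝ ∞ A z)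
    (hz : ‖z.2‖ = 1) (i : Fin 3) : ContDiffAt ℝ ∞ (fun z => tangentCoeff (A z) i z.2) z := by
  refine ContDiffAt.sum fun j _ => ?_
  have hw : ContDiffAt ℝ ∞ (fun z : ℝ × E3 => coordCutoff j z.2 / coordCutoffSum z.2 * z.2 j) z :=
    (((contDiff_coordCutoff j).contDiffAt.comp z contDiffAt_snd).div
      (contDiff_coordCutoffSum.contDiffAt.comp z contDiffAt_snd) (coordCutoffSum_pos hz).ne').mul
      (by fun_prop)
  have hv : ContDiffAt ℝ ∞ (fun z : ℝ × E3 => z.2 j • stdVec i - z.2 i • stdVec j) z := by fun_prop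
  exact hw.smul (hA.clm_apply hv)

/-- A family of formal immersions `G` that is holonomic near times `0` and `1` can be replaced by
a family of immersions without changing times `0` and `1`. -/
lemma exists_holonomic {f : ℝ × E3 → E3} {G : ℝ × E3 → E3 →L[ℝ] E3}
    (hf : ∀ z ∈ cyl, ContDiffAt ℝ ∞ f z) (hG : ∀ z ∈ cyl, ContDiffAt ℝ ∞ G z)
    (htime : ∀ z ∈ cyl, z.1 ∉ Set.Icc (1 / 4 : ℝ) (3 / 4) → G z = spaceDeriv f z)
    (hinj : ∀ z ∈ cyl, InjOnTangent (G z) z.2) :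
    ∃ f' : ℝ × E3 → E3, (∀ z ∈ cyl, ContDiffAt ℝ ∞ f' z) ∧
      (∀ x : E3, ‖x‖ = 1 → f' (0, x) = f (0, x) ∧ f' (1, x) = f (1, x)) ∧
      ∀ z ∈ cyl, InjOnTangent (spaceDeriv f' z) z.2 := by
  set a : Fin 3 → ℝ × E3 → E3 := fun i z => tangentCoeff (G z - spaceDeriv f z) i z.2 with hadef
  have hnorm : ∀ z ∈ cyl, ‖z.2‖ = 1 := fun z hz => by simpa using hz.2
  have ha : ∀ i, ∀ z ∈ cyl, ContDiffAt ℝ ∞ (a i) z := fun i z hz =>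
    ((hG z hz).sub (hf z hz).spaceDeriv).tangentCoeff (hnorm z hz) i
  have hsupp : ∀ i, ∀ z : ℝ × E3, axisDistSq (stdVec i) z.2 < 1 / 6 → a i z = 0 := fun i z h =>
    tangentCoeff_eq_zero _ h
  have ht : ∀ i, ∀ z ∈ cyl, z.1 ∉ Set.Icc (1 / 4 : ℝ) (3 / 4) → a i z = 0 := fun i z hz h =>
    tangentCoeff_eq_zero_of_tangent (fun v _ => by rw [htime z hz h, sub_self, zero_apply]) i
  set B : Fin 3 → ℝ × E3 → E3 →L[ℝ] E3 := fun i z => (innerSL ℝ (stdVec i)).smulRight (a i z)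
    with hBdef
  have hB : ∀ i, ∀ z ∈ cyl, ContDiffAt ℝ ∞ (B i) z := fun i z hz =>
    contDiffAt_const.smulRight (ha i z hz)
  obtain ⟨f1, hf1, hb1, hi1⟩ := exists_absorb (norm_stdVec 0) (H := fun z => B 1 z + B 2 z) hf
    (ha 0) (fun z hz => (hB 1 z hz).add (hB 2 z hz)) (hsupp 0) (ht 0) fun z hz v hv h0 => by
      refine hinj z hz v hv ?_
      have := sum_smul_tangentCoeff (G z - spaceDeriv f z) (hnorm z hz) hv
      rw [Fin.sum_univ_three, sub_apply] at this
      rw [← h0, sub_eq_iff_eq_add'.mp this.symm]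
      simp only [hBdef, hadef, add_apply, ContinuousLinearMap.smulRight_apply,
        innerSL_apply_apply, inner_stdVec]
      abel
  obtain ⟨f2, hf2, hb2, hi2⟩ := exists_absorb (norm_stdVec 1) (H := B 2) hf1
    (ha 1) (hB 2) (hsupp 1) (ht 1) fun z hz => by
      rw [add_assoc]; exact hi1 z hz
  obtain ⟨f3, hf3, hb3, hi3⟩ := exists_absorb (norm_stdVec 2) (H := fun _ => 0) hf2
    (ha 2) (fun z _ => contDiffAt_const) (hsupp 2) (ht 2) fun z hz => by
      rw [add_zero]; exact hi2 z hz
  refine ⟨f3, hf3, fun x hx => ?_, fun z hz => by simpa using hi3 z hz⟩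
  rw [(hb3 x hx).1, (hb3 x hx).2, (hb2 x hx).1, (hb2 x hx).2]
  exact hb1 x hx

/-! ### Quaternions and rotations -/

/-- The imaginary quaternion associated with a vector. -/
def vecQuat (v : E3) : ℍ[ℝ] := ⟨0, v 0, v 1, v 2⟩

/-- The imaginary part of a quaternion, as a vector. -/
def quatVec (q : ℍ[ℝ]) : E3 := !₂[q.imI, q.imJ, q.imK]

@[simp] lemma re_vecQuat (v : E3) : (vecQuat v).re = 0 := rfl
@[simp] lemma imI_vecQuat (v : E3) : (vecQuat v).imI = v 0 := rfl
@[simp] lemma imJ_vecQuat (v : E3) : (vecQuat v).imJ = v 1 := rfl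
@[simp] lemma imK_vecQuat (v : E3) : (vecQuat v).imK = v 2 := rfl

lemma vecQuat_eq_sum (v : E3) : vecQuat v = v 0 • vecQuat (stdVec 0) + v 1 • vecQuat (stdVec 1) +
    v 2 • vecQuat (stdVec 2) := by
  ext <;> simp [stdVec]

lemma continuous_vecQuat : Continuous vecQuat := by
  have h : ∀ i : Fin 3, Continuous fun v : E3 => v i • vecQuat (stdVec i) := fun i =>
    (EuclideanSpace.proj (𝕜 := ℝ) i).continuous.smul continuous_const
  exact (((h 0).add (h 1)).add (h 2)).congr fun v => (vecQuat_eq_sum v).symm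

lemma continuous_quatVec : Continuous quatVec := by
  have h1 := Quaternion.continuous_imI
  have h2 := Quaternion.continuous_imJ
  have h3 := Quaternion.continuous_imK
  refine (PiLp.continuous_toLp 2 _).comp (continuous_pi fun i => ?_)
  fin_cases i <;> assumption

/-- The linear map with given columns. -/
def ofCols (a : Fin 3 → E3) : E3 →L[ℝ] E3 := ∑ i, (innerSL ℝ (stdVec i)).smulRight (a i)

lemma ofCols_apply (a : Fin 3 → E3) (v : E3) : ofCols a v = ∑ i, v i • a i := by
  simp [ofCols, inner_stdVec]

lemma ofCols_stdVec (A : E3 →L[ℝ] E3) : ofCols (fun i => A (stdVec i)) = A := by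
  ext1 v
  simp_rw [ofCols_apply, ← map_smul A, ← map_sum A, sum_smul_stdVec]

lemma continuous_ofCols : Continuous ofCols := by
  have h : ∀ i : Fin 3, Continuous fun a : Fin 3 → E3 => (innerSL ℝ (stdVec i)).smulRight (a i) :=
    fun i => (ContinuousLinearMap.smulRightL ℝ E3 E3 (innerSL ℝ (stdVec i))).continuous.comp
      (continuous_apply i)
  unfold ofCols
  fun_prop

/-- The linear map `v ↦ q v q̄` on imaginary quaternions. -/
def quatConj (q : ℍ[ℝ]) : E3 →L[ℝ] E3 :=
  ofCols fun i => quatVec (q * vecQuat (stdVec i) * star q)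

lemma continuous_quatConj : Continuous quatConj :=
  continuous_ofCols.comp (continuous_pi fun _ => continuous_quatVec.comp
    ((continuous_id.mul continuous_const).mul continuous_star))

lemma quatConj_apply (q : ℍ[ℝ]) (v : E3) : quatConj q v = quatVec (q * vecQuat v * star q) := by
  rw [quatConj, ofCols_apply]
  ext i
  fin_cases i <;> simp [quatVec, stdVec, Fin.sum_univ_three] <;> ring

lemma quatConj_one : quatConj 1 = ContinuousLinearMap.id ℝ E3 := by
  ext v i
  rw [quatConj_apply]
  fin_cases i <;> simp [quatVec]

lemma quatConj_injective {q : ℍ[ℝ]} (hq : q ≠ 0) {v : E3} (h : quatConj q v = 0) : v = 0 := by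
  rw [quatConj_apply] at h
  have h1 : q * vecQuat v * star q = 0 := by
    have e0 := congrArg (fun w : E3 => w 0) h
    have e1 := congrArg (fun w : E3 => w 1) h
    have e2 := congrArg (fun w : E3 => w 2) h
    simp only [quatVec] at e0 e1 e2
    ext
    · simp; ring
    · simpa using e0
    · simpa using e1
    · simpa using e2
  have h2 : vecQuat v = 0 := by
    have hs : star q ≠ 0 := star_ne_zero.mpr hq
    simpa [hq, hs] using h1
  ext i
  fin_cases i
  · exact congrArg QuaternionAlgebra.imI h2
  · exact congrArg QuaternionAlgebra.imJ h2
  · exact congrArg QuaternionAlgebra.imK h2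

/-- The `ℝ`-linear projection of `ℍ` onto the line of those `q` with `uᵢ q = q eᵢ`, for an oriented
orthonormal frame `u`. -/
def frameProj (u : Fin 3 → E3) : ℍ[ℝ] →L[ℝ] ℍ[ℝ] :=
  (1 / 4 : ℝ) • (ContinuousLinearMap.id ℝ ℍ[ℝ] - ∑ i,
    (ContinuousLinearMap.mul ℝ ℍ[ℝ] (vecQuat (u i))).comp
      ((ContinuousLinearMap.mul ℝ ℍ[ℝ]).flip (vecQuat (stdVec i))))

lemma frameProj_apply (u : Fin 3 → E3) (q : ℍ[ℝ]) :
    frameProj u q = (1 / 4 : ℝ) • (q - ∑ i, vecQuat (u i) * (q * vecQuat (stdVec i))) := by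
  simp [frameProj]

lemma continuous_frameProj : Continuous frameProj := by
  have h : ∀ i : Fin 3, Continuous fun u : Fin 3 → E3 =>
      (ContinuousLinearMap.mul ℝ ℍ[ℝ] (vecQuat (u i))).comp
      ((ContinuousLinearMap.mul ℝ ℍ[ℝ]).flip (vecQuat (stdVec i))) := fun i =>
    ((ContinuousLinearMap.mul ℝ ℍ[ℝ]).continuous.comp
      (continuous_vecQuat.comp (continuous_apply i))).clm_comp continuous_const
  unfold frameProj
  fun_prop

lemma exists_frameProj_ne_zero (u : Fin 3 → E3) : ∃ q, frameProj u q ≠ 0 := by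
  by_contra! h
  have h0 := congrArg QuaternionAlgebra.re (h 1)
  have h1 := congrArg QuaternionAlgebra.imI (h (vecQuat (stdVec 0)))
  have h2 := congrArg QuaternionAlgebra.imJ (h (vecQuat (stdVec 1)))
  have h3 := congrArg QuaternionAlgebra.imK (h (vecQuat (stdVec 2)))
  simp [frameProj_apply, Fin.sum_univ_three, stdVec] at h0 h1 h2 h3
  linarith

/-- Multiplication rules of an oriented orthonormal frame, as imaginary quaternions. -/
structure IsQuatFrame (p : Fin 3 → ℍ[ℝ]) : Prop where
  sq : ∀ i, p i * p i = -1
  mul01 : p 0 * p 1 = p 2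
  mul12 : p 1 * p 2 = p 0
  mul20 : p 2 * p 0 = p 1

namespace IsQuatFrame

lemma mul02 {p : Fin 3 → ℍ[ℝ]} (hp : IsQuatFrame p) :
    p 0 * p 2 = -p 1 := by rw [← hp.mul12, mul_assoc, hp.sq, mul_neg_one]

lemma mul10 {p : Fin 3 → ℍ[ℝ]} (hp : IsQuatFrame p) :
    p 1 * p 0 = -p 2 := by rw [← hp.mul20, mul_assoc, hp.sq, mul_neg_one]

lemma mul21 {p : Fin 3 → ℍ[ℝ]} (hp : IsQuatFrame p) :
    p 2 * p 1 = -p 0 := by rw [← hp.mul01, mul_assoc, hp.sq, mul_neg_one]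

lemma mul_sub_sum {p : Fin 3 → ℍ[ℝ]} {r : Fin 3 → ℍ[ℝ]}
    (hp : IsQuatFrame p) (hr : IsQuatFrame r) (q : ℍ[ℝ]) (i : Fin 3) :
    p i * (q - ∑ j, p j * (q * r j)) = (q - ∑ j, p j * (q * r j)) * r i := by
  have key : ∀ {i j : Fin 3} {s : ℍ[ℝ]} (t : ℍ[ℝ]), p i * p j = s → p i * (p j * t) = s * t :=
    fun t h => by rw [← mul_assoc, h]
  fin_cases i <;> simp only [Fin.zero_eta, Fin.mk_one, Fin.reduceFinMk, Fin.sum_univ_three,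
      mul_sub, sub_mul, mul_add, add_mul, mul_assoc, hr.sq,
      hr.mul01, hr.mul12, hr.mul20, hr.mul02, hr.mul10, hr.mul21, key _ (hp.sq _),
      key _ hp.mul01, key _ hp.mul12, key _ hp.mul20, key _ hp.mul02, key _ hp.mul10,
      key _ hp.mul21] <;> noncomm_ring

end IsQuatFrame

lemma E3.exists_coords (v : E3) : ∃ a b c : ℝ, v = !₂[a, b, c] :=
  ⟨v 0, v 1, v 2, E3.ext_coords rfl rfl rfl⟩

lemma isQuatFrame_of_orthonormal {p q : E3} (hp : ‖p‖ = 1) (hq : ‖q‖ = 1) (hpq : inner ℝ p q = 0) :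
    IsQuatFrame fun i => vecQuat (![p, cross q p, q] i) := by
  obtain ⟨a, b, c, rfl⟩ := E3.exists_coords p
  obtain ⟨a', b', c', rfl⟩ := E3.exists_coords q
  have h1 : a * a + b * b + c * c = 1 := by
    have := real_inner_self_eq_norm_sq (!₂[a, b, c] : E3)
    rw [hp, one_pow, E3.inner_eq] at this
    exact this
  have h2 : a' * a' + b' * b' + c' * c' = 1 := by
    have := real_inner_self_eq_norm_sq (!₂[a', b', c'] : E3)
    rw [hq, one_pow, E3.inner_eq] at this
    exact this
  have h3 : a * a' + b * b' + c * c' = 0 := by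
    rw [E3.inner_eq] at hpq
    exact hpq
  refine ⟨fun i => ?_, ?_, ?_, ?_⟩
  · fin_cases i <;> ext <;> simp <;> grind
  · ext <;> simp <;> grind
  · ext <;> simp <;> grind
  · ext <;> simp <;> grind

lemma isQuatFrame_stdVec : IsQuatFrame fun i => vecQuat (stdVec i) := by
  refine ⟨fun i => ?_, ?_, ?_, ?_⟩
  · fin_cases i <;> ext <;> simp [stdVec]
  all_goals ext <;> simp [stdVec]

lemma frameProj_intertwine {u : Fin 3 → E3} (hu : IsQuatFrame fun i => vecQuat (u i)) (q : ℍ[ℝ])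
    (i : Fin 3) :
    vecQuat (u i) * frameProj u q = frameProj u q * vecQuat (stdVec i) := by
  rw [frameProj_apply, mul_smul_comm, smul_mul_assoc,
    hu.mul_sub_sum isQuatFrame_stdVec q i]

lemma frameProj_eq_self {u : Fin 3 → E3} {q : ℍ[ℝ]}
    (h : ∀ i, vecQuat (u i) * q = q * vecQuat (stdVec i)) : frameProj u q = q := by
  have h1 : ∀ i, vecQuat (u i) * (q * vecQuat (stdVec i)) = -q := fun i => by
    rw [← mul_assoc, h, mul_assoc, isQuatFrame_stdVec.sq i, mul_neg_one]
  rw [frameProj_apply]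
  simp_rw [h1, Fin.sum_univ_three]
  module

lemma intertwine_of_frameProj {u : Fin 3 → E3} (hu : IsQuatFrame fun i => vecQuat (u i)) {q : ℍ[ℝ]}
    (h : frameProj u q = q) (i : Fin 3) : vecQuat (u i) * q = q * vecQuat (stdVec i) := by
  rw [← h, frameProj_intertwine hu]

lemma star_vecQuat (v : E3) : star (vecQuat v) = -vecQuat v := by
  ext <;> simp

lemma mul_star_self_of_norm_one {q : ℍ[ℝ]} (hq : ‖q‖ = 1) : q * star q = 1 := by
  rw [Quaternion.self_mul_star, Quaternion.normSq_eq_norm_mul_self, hq]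
  simp

lemma star_mul_self_of_norm_one {q : ℍ[ℝ]} (hq : ‖q‖ = 1) : star q * q = 1 := by
  rw [Quaternion.star_mul_self, Quaternion.normSq_eq_norm_mul_self, hq]
  simp

/-- Unit quaternions inducing the same rotation are proportional. -/
lemma eq_smul_of_intertwine {u : Fin 3 → E3} {q r : ℍ[ℝ]} (hq1 : ‖q‖ = 1)
    (hq : ∀ i, vecQuat (u i) * q = q * vecQuat (stdVec i))
    (hr : ∀ i, vecQuat (u i) * r = r * vecQuat (stdVec i)) : r = (star q * r).re • q := by
  have hs : ∀ i, vecQuat (stdVec i) * star q = star q * vecQuat (u i) := fun i => by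
    have := congrArg star (hq i)
    simpa [star_vecQuat] using this.symm
  have hc : ∀ i, vecQuat (stdVec i) * (star q * r) = star q * r * vecQuat (stdVec i) := fun i => by
    rw [← mul_assoc, hs, mul_assoc, hr, mul_assoc]
  have hreal : ∀ w : ℍ[ℝ], (∀ i, vecQuat (stdVec i) * w = w * vecQuat (stdVec i)) →
      w = ((w.re : ℝ) : ℍ[ℝ]) := fun w hw => by
    have h0 := hw 0
    have h1 := hw 1
    have a2 := congrArg QuaternionAlgebra.imJ h0
    have a3 := congrArg QuaternionAlgebra.imK h0
    have a1 := congrArg QuaternionAlgebra.imK h1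
    simp [stdVec] at a1 a2 a3
    ext <;> simp <;> linarith
  calc r = q * (star q * r) := by rw [← mul_assoc, mul_star_self_of_norm_one hq1, one_mul]
    _ = (star q * r).re • q := by
      rw [hreal _ (hc ·), Quaternion.mul_coe_eq_smul, Quaternion.re_coe]

lemma quatConj_eq_ofCols {u : Fin 3 → E3} {q : ℍ[ℝ]} (hq1 : ‖q‖ = 1)
    (hq : ∀ i, vecQuat (u i) * q = q * vecQuat (stdVec i)) : quatConj q = ofCols u := by
  rw [quatConj]
  congr 1
  funext i
  rw [← hq, mul_assoc, mul_star_self_of_norm_one hq1, mul_one]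
  ext k
  fin_cases k <;> simp [quatVec]

/-- Continuous nonvanishing fixed vectors for a family of projections on a ball. -/
lemma exists_nonvanishing_fixed {V E : Type*} [NormedAddCommGroup V] [NormedSpace ℝ V]
    [ProperSpace V] [NormedAddCommGroup E] [NormedSpace ℝ E] {K : V → E →L[ℝ] E}
    (hK : Continuous K) (hid : ∀ z v, K z (K z v) = K z v) (h0 : ∃ v, K 0 v ≠ 0) :
    ∃ q : V → E, Continuous q ∧ ∀ z ∈ Metric.closedBall (0 : V) 1, q z ≠ 0 ∧ K z (q z) = q z := by
  obtain ⟨δ, hδ, h⟩ := Metric.uniformContinuousOn_iff.mp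
    ((isCompact_closedBall (0 : V) 1).uniformContinuousOn_of_continuous hK.continuousOn) 1 one_pos
  obtain ⟨N, hN⟩ := exists_nat_gt (1 / δ)
  have hN0 : (0 : ℝ) < N := lt_trans (by positivity) hN
  have key : ∀ n : ℕ, n ≤ N → ∃ q : V → E, Continuous q ∧ ∀ z ∈ Metric.closedBall (0 : V) 1,
      q z ≠ 0 ∧ K (((n : ℝ) / N) • z) (q z) = q z := by
    intro n
    induction n with
    | zero =>
      intro _
      obtain ⟨v, hv⟩ := h0
      exact ⟨fun _ => K 0 v, continuous_const, fun z _ => ⟨hv, by simp [hid]⟩⟩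
    | succ n ih =>
      intro hn
      obtain ⟨q, hq, hqz⟩ := ih (by omega)
      refine ⟨fun z => K ((((n + 1 : ℕ) : ℝ) / N) • z) (q z),
        (hK.comp (continuous_const.smul continuous_id)).clm_apply hq, fun z hz => ⟨?_, hid _ _⟩⟩
      have hz1 : ‖z‖ ≤ 1 := by simpa using hz
      have hball : ∀ m : ℕ, m ≤ N → ((m : ℝ) / N) • z ∈ Metric.closedBall (0 : V) 1 :=
          fun m hm => by
        have hm' : (m : ℝ) / N ≤ 1 := (div_le_one hN0).mpr (by exact_mod_cast hm)
        rw [mem_closedBall_zero_iff, norm_smul, Real.norm_of_nonneg (by positivity)]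
        exact mul_le_one₀ hm' (norm_nonneg z) hz1
      have hd : dist ((((n + 1 : ℕ) : ℝ) / N) • z) (((n : ℝ) / N) • z) < δ := by
        have e : (((n + 1 : ℕ) : ℝ) / N) • z - ((n : ℝ) / N) • z = (1 / (N : ℝ)) • z := by
          rw [← sub_smul]; push_cast; congr 1; ring
        rw [dist_eq_norm, e, norm_smul, Real.norm_of_nonneg (by positivity)]
        refine (mul_le_of_le_one_right (by positivity) hz1).trans_lt ?_
        rwa [div_lt_comm₀ hN0 hδ]
      have hlt := h _ (hball _ hn) _ (hball n (by omega)) hd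
      rw [dist_eq_norm] at hlt
      intro hzero
      beta_reduce at hzero
      obtain ⟨hne, hfix⟩ := hqz z hz
      have h1 : ‖(K ((((n + 1 : ℕ) : ℝ) / N) • z) - K (((n : ℝ) / N) • z)) (q z)‖ = ‖q z‖ := by
        rw [sub_apply, hzero, hfix, zero_sub, norm_neg]
      have h2 := ContinuousLinearMap.le_opNorm
        (K ((((n + 1 : ℕ) : ℝ) / N) • z) - K (((n : ℝ) / N) • z)) (q z)
      rw [h1] at h2
      nlinarith [norm_pos_iff.mpr hne]
  obtain ⟨q, hq, hqz⟩ := key N le_rfl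
  refine ⟨q, hq, fun z hz => ?_⟩
  have := hqz z hz
  rwa [div_self hN0.ne', one_smul] at this

/-! ### Lifting frame fields to quaternions -/

/-- The radial retraction of the plane onto the closed unit disc. -/
def discRetract (z : ℂ) : ℂ := ((max 1 ‖z‖)⁻¹ : ℝ) • z

lemma continuous_discRetract : Continuous discRetract := by
  have h : Continuous fun z : ℂ => (max 1 ‖z‖)⁻¹ :=
    (continuous_const.max continuous_norm).inv₀ fun z => (lt_max_of_lt_left one_pos).ne'
  exact h.smul continuous_id

lemma norm_discRetract_le (z : ℂ) : ‖discRetract z‖ ≤ 1 := by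
  have h : (0 : ℝ) < max 1 ‖z‖ := lt_max_of_lt_left one_pos
  rw [discRetract, norm_smul, norm_inv, Real.norm_of_nonneg h.le, inv_mul_le_one₀ h]
  exact le_max_right _ _

lemma discRetract_eq_self {z : ℂ} (hz : ‖z‖ ≤ 1) : discRetract z = z := by
  rw [discRetract, max_eq_left hz, inv_one, one_smul]

/-- The map from the plane to `E3` sending the unit disc onto the sphere and its boundary to the
south pole. -/
def discMapAux (z : ℂ) : E3 :=
  !₂[2 * √(1 - Complex.normSq (discRetract z)) * (discRetract z).re,
    2 * √(1 - Complex.normSq (discRetract z)) * (discRetract z).im,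
    1 - 2 * Complex.normSq (discRetract z)]

lemma normSq_discRetract_le (z : ℂ) : Complex.normSq (discRetract z) ≤ 1 := by
  rw [Complex.normSq_eq_norm_sq]
  exact pow_le_one₀ (norm_nonneg _) (norm_discRetract_le z)

lemma norm_discMapAux (z : ℂ) : ‖discMapAux z‖ = 1 := by
  have h := Real.sq_sqrt (sub_nonneg.mpr (normSq_discRetract_le z))
  have h1 : inner ℝ (discMapAux z) (discMapAux z) = (1 : ℝ) := by
    rw [E3.inner_eq]
    simp only [discMapAux, PiLp.toLp_apply, Matrix.cons_val_zero, Matrix.cons_val_one,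
      Matrix.cons_val]
    have e := Complex.normSq_apply (discRetract z)
    set s := √(1 - Complex.normSq (discRetract z))
    set w := discRetract z
    calc _ = 4 * s ^ 2 * (w.re * w.re + w.im * w.im) + (1 - 2 * Complex.normSq w) ^ 2 := by ring
      _ = 1 := by rw [h, ← e]; ring
  rw [real_inner_self_eq_norm_sq] at h1
  exact (pow_eq_one_iff_of_nonneg (norm_nonneg _) two_ne_zero).mp h1

/-- The map from the plane to the sphere collapsing the boundary of the unit disc. -/
def discMap : C(ℂ, S2) where
  toFun z := ⟨discMapAux z, by simpa using norm_discMapAux z⟩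
  continuous_toFun := by
    refine Continuous.subtype_mk ((PiLp.continuous_toLp 2 _).comp (continuous_pi fun i => ?_)) _
    have h := continuous_discRetract
    have h1 := Complex.continuous_normSq.comp h
    have h2 := Complex.continuous_re.comp h
    have h3 := Complex.continuous_im.comp h
    have h4 := (continuous_const (y := (1 : ℝ))).sub h1 |>.sqrt
    fin_cases i
    · exact (continuous_const.mul h4).mul h2
    · exact (continuous_const.mul h4).mul h3
    · exact continuous_const.sub (continuous_const.mul h1)

lemma discMap_eq {z w : ℂ} (hz : ‖z‖ ≤ 1) (hw : ‖w‖ ≤ 1) (h : discMap z = discMap w) :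
    z = w ∨ (‖z‖ = 1 ∧ ‖w‖ = 1) := by
  have h' : discMapAux z = discMapAux w := congrArg Subtype.val h
  have h0 : 2 * √(1 - Complex.normSq z) * z.re = 2 * √(1 - Complex.normSq w) * w.re := by
    simpa [discMapAux, discRetract_eq_self, hz, hw] using congrArg (fun v : E3 => v 0) h'
  have h1 : 2 * √(1 - Complex.normSq z) * z.im = 2 * √(1 - Complex.normSq w) * w.im := by
    simpa [discMapAux, discRetract_eq_self, hz, hw] using congrArg (fun v : E3 => v 1) h'
  have h2 : Complex.normSq z = Complex.normSq w := by
    simpa [discMapAux, discRetract_eq_self, hz, hw] using congrArg (fun v : E3 => v 2) h'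
  rcases hw.eq_or_lt with h3 | h3
  · refine .inr ⟨?_, h3⟩
    rw [Complex.normSq_eq_norm_sq, Complex.normSq_eq_norm_sq, h3, one_pow] at h2
    exact (pow_eq_one_iff_of_nonneg (norm_nonneg _) two_ne_zero).mp h2
  · have h4 : Complex.normSq w < 1 := by
      rw [Complex.normSq_eq_norm_sq]
      exact pow_lt_one₀ (norm_nonneg w) h3 two_ne_zero
    have h5 : 0 < 2 * √(1 - Complex.normSq w) := by
      have := Real.sqrt_pos.mpr (sub_pos.mpr h4)
      positivity
    rw [h2] at h0 h1
    exact .inl (Complex.ext (mul_left_cancel₀ h5.ne' h0) (mul_left_cancel₀ h5.ne' h1))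

lemma exists_discMap_eq (x : S2) : ∃ z : ℂ, ‖z‖ ≤ 1 ∧ discMap z = x := by
  obtain ⟨v, hv⟩ := x
  obtain ⟨a, b, c, rfl⟩ := E3.exists_coords v
  have h1 : a * a + b * b + c * c = 1 := by
    have := real_inner_self_eq_norm_sq (!₂[a, b, c] : E3)
    rw [mem_sphere_zero_iff_norm.mp hv, one_pow, E3.inner_eq] at this
    exact this
  rcases (show -1 ≤ c by nlinarith).eq_or_lt with hc | hc
  · subst hc
    have ha : a = 0 := by nlinarith
    have hb : b = 0 := by nlinarith
    subst ha hb
    refine ⟨1, by simp, Subtype.ext ?_⟩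
    change discMapAux 1 = _
    apply E3.ext_coords <;> simp [discMapAux, discRetract_eq_self]
    norm_num
  · set k := √(2 * (1 + c)) with hk
    have hk2 : k ^ 2 = 2 * (1 + c) := Real.sq_sqrt (by linarith)
    have hk0 : 0 < k := Real.sqrt_pos.mpr (by linarith)
    have hs : Complex.normSq ⟨a / k, b / k⟩ = (1 - c) / 2 := by
      rw [Complex.normSq_mk]
      field_simp
      rw [hk2]
      linear_combination 2 * h1
    have hz : ‖(⟨a / k, b / k⟩ : ℂ)‖ ≤ 1 := by
      rw [← sq_le_one_iff₀ (norm_nonneg _), ← Complex.normSq_eq_norm_sq, hs]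
      linarith
    have hsq : √(1 - (1 - c) / 2) = k / 2 := by
      rw [show 1 - (1 - c) / 2 = (k / 2) ^ 2 by linear_combination -hk2 / 4,
        Real.sqrt_sq (by positivity)]
    refine ⟨⟨a / k, b / k⟩, hz, Subtype.ext ?_⟩
    change discMapAux _ = _
    apply E3.ext_coords <;>
      simp only [discMapAux, discRetract_eq_self hz, hs, hsq, PiLp.toLp_apply,
        Matrix.cons_val_zero, Matrix.cons_val_one, Matrix.cons_val] <;> field_simp
    ring

lemma discMap_eq_of_norm_one {z w : ℂ} (hz : ‖z‖ = 1) (hw : ‖w‖ = 1) : discMap z = discMap w := by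
  refine Subtype.ext ?_
  change discMapAux z = discMapAux w
  simp [discMapAux, discRetract_eq_self, hz, hw, Complex.normSq_eq_norm_sq]

/-- A frame field on the sphere lifts to unit quaternions. -/
lemma exists_quaternion_lift (u : C(S2, Fin 3 → E3))
    (hu : ∀ x, IsQuatFrame fun i => vecQuat (u x i)) :
    ∃ q : C(S2, ℍ[ℝ]), ∀ x, ‖q x‖ = 1 ∧ ∀ i, vecQuat (u x i) * q x = q x * vecQuat (stdVec i) := by
  obtain ⟨q, hq, hqz⟩ := exists_nonvanishing_fixed (V := ℂ)
    (K := fun z => frameProj (u (discMap z)))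
    (continuous_frameProj.comp (u.continuous.comp discMap.continuous))
    (fun z v => frameProj_eq_self (frameProj_intertwine (hu _) v)) (exists_frameProj_ne_zero _)
  let D := Metric.closedBall (0 : ℂ) 1
  let r : C(D, ℍ[ℝ]) :=
    { toFun := fun z => (‖q z‖⁻¹ : ℝ) • q z
      continuous_toFun := by
        have hc : Continuous fun z : D => q z := hq.comp continuous_subtype_val
        exact (hc.norm.inv₀ fun z => norm_ne_zero_iff.mpr (hqz z z.2).1).smul hc }
  have hr1 : ∀ z, ‖r z‖ = 1 := fun z => norm_smul_inv_norm (𝕜 := ℝ) (hqz z z.2).1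
  have hr2 : ∀ (z : D) (i : Fin 3), vecQuat (u (discMap z) i) *
      r z = r z * vecQuat (stdVec i) := fun z i => by
    change vecQuat _ * ((‖q z‖⁻¹ : ℝ) • q z) = ((‖q z‖⁻¹ : ℝ) • q z) * _
    rw [mul_smul_comm, smul_mul_assoc, intertwine_of_frameProj (hu _) (hqz z z.2).2]
  let c : C(D, S2) := discMap.comp ⟨Subtype.val, continuous_subtype_val⟩
  have hc : Topology.IsQuotientMap c := by
    refine c.continuous.isClosedMap.isQuotientMap c.continuous fun x => ?_
    obtain ⟨z, hz, hzx⟩ := exists_discMap_eq x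
    exact ⟨⟨z, by simpa [D] using hz⟩, hzx⟩
  have hbd : ∀ z w : D, ‖(z : ℂ)‖ = 1 → ‖(w : ℂ)‖ = 1 → r z = r w := by
    intro z w hz hw
    let f : ℂ → ℝ := fun y => (star (r w) * ((‖q y‖⁻¹ : ℝ) • q y)).re
    have hsub : Metric.sphere (0 : ℂ) 1 ⊆ D := Metric.sphere_subset_closedBall
    have hf : ContinuousOn f (Metric.sphere 0 1) :=
      Quaternion.continuous_re.comp_continuousOn (continuousOn_const.mul
        ((hq.norm.continuousOn.inv₀ fun y hy => norm_ne_zero_iff.mpr (hqz y (hsub hy)).1).smul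
          hq.continuousOn))
    have hfr : ∀ y : D, ‖(y : ℂ)‖ = 1 → r y = f y • r w := fun y hy =>
      eq_smul_of_intertwine (hr1 w) (hr2 w) (discMap_eq_of_norm_one hy hw ▸ hr2 y)
    have hsq : Set.EqOn (f ^ 2) 1 (Metric.sphere 0 1) := fun y hy => by
      have h1 := congrArg norm (hfr ⟨y, hsub hy⟩ (mem_sphere_zero_iff_norm.mp hy))
      rw [norm_smul, hr1, hr1, mul_one, Real.norm_eq_abs] at h1
      change f y ^ 2 = 1
      rw [← sq_abs, ← h1, one_pow]
    have hw1 : f w = 1 := by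
      change (star (r w) * r w).re = 1
      rw [star_mul_self_of_norm_one (hr1 w), Quaternion.re_one]
    rcases (isPreconnected_sphere (by simp) (0 : ℂ) 1).eq_one_or_eq_neg_one_of_sq_eq hf hsq
      with h | h
    · rw [hfr z hz, h (mem_sphere_zero_iff_norm.mpr hz), Pi.one_apply, one_smul]
    · have := h (mem_sphere_zero_iff_norm.mpr hw)
      rw [hw1] at this
      norm_num at this
  have hfac : ∀ z w, c z = c w → r z = r w := fun z w h => by
    rcases discMap_eq (mem_closedBall_zero_iff.mp z.2) (mem_closedBall_zero_iff.mp w.2) h with h | h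
    · rw [Subtype.ext h]
    · exact hbd z w h.1 h.2
  refine ⟨hc.lift r hfac, fun x => ?_⟩
  obtain ⟨z, rfl⟩ := hc.surjective x
  have : hc.lift r hfac (c z) = r z := DFunLike.congr_fun (hc.lift_comp r hfac) z
  rw [this]
  exact ⟨hr1 z, hr2 z⟩

/-! ### Null-homotopy of maps from the sphere to nonzero quaternions -/

lemma exists_spherical (x : S2) : ∃ θ φ : ℝ,
    (x : E3) = !₂[Real.sin θ * Real.cos φ, Real.sin θ * Real.sin φ, Real.cos θ] := by
  obtain ⟨x, hx⟩ := x
  obtain ⟨a, b, c, rfl⟩ := E3.exists_coords x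
  have h1 : a ^ 2 + b ^ 2 + c ^ 2 = 1 := by
    have := EuclideanSpace.norm_sq_eq (𝕜 := ℝ) !₂[a, b, c]
    rw [mem_sphere_zero_iff_norm.mp hx] at this
    simpa [Fin.sum_univ_three] using this.symm
  have hab : ‖(⟨a, b⟩ : ℂ)‖ = √(1 - c ^ 2) := by
    rw [Complex.norm_def, Complex.normSq_mk]
    congr 1
    linarith
  have hcos := Complex.norm_mul_cos_arg ⟨a, b⟩
  have hsin := Complex.norm_mul_sin_arg ⟨a, b⟩
  rw [hab] at hcos hsin
  refine ⟨Real.arccos c, Complex.arg ⟨a, b⟩, ?_⟩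
  rw [Real.sin_arccos, Real.cos_arccos (by nlinarith) (by nlinarith), hcos, hsin]

lemma exists_notMem_cone {g : E3 → ℍ[ℝ]} (hg : ContDiff ℝ ∞ g) :
    ∃ y : ℍ[ℝ], ∀ (r : ℝ) (x : S2), r • g x ≠ y := by
  let Φ : ℝ × ℝ × ℝ → ℍ[ℝ] := fun p => p.1 • g !₂[Real.sin p.2.1 * Real.cos p.2.2,
    Real.sin p.2.1 * Real.sin p.2.2, Real.cos p.2.1]
  have hΦ : ContDiff ℝ 1 Φ := by
    refine contDiff_fst.smul ((hg.of_le (by simp)).comp (contDiff_euclidean.mpr fun i => ?_))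
    fin_cases i
    · exact contDiff_snd.fst.sin.mul contDiff_snd.snd.cos
    · exact contDiff_snd.fst.sin.mul contDiff_snd.snd.sin
    · exact contDiff_snd.fst.cos
  have hd : Dense (Set.range Φ)ᶜ := hΦ.dense_compl_range_of_finrank_lt_finrank (by
    simp [Quaternion.finrank_eq_four])
  obtain ⟨y, hy⟩ := hd.nonempty
  refine ⟨y, fun r x h => hy ?_⟩
  obtain ⟨θ, φ, hx⟩ := exists_spherical x
  exact ⟨(r, θ, φ), by rw [← h, hx]⟩

lemma joinedIn_ne_zero_const_one (q : C(S2, ℍ[ℝ])) (hq : ∀ x, ‖q x‖ = 1) :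
    JoinedIn {p : C(S2, ℍ[ℝ]) | ∀ x, p x ≠ 0} q (ContinuousMap.const S2 1) := by
  obtain ⟨q', hq'⟩ := q.exists_extension Metric.isClosed_sphere.isClosedEmbedding_subtypeVal
  obtain ⟨g, hg, hgq, -⟩ := q'.continuous.exists_contDiff_approx ⊤ (ε := fun _ => 1)
    continuous_const fun _ => one_pos
  obtain ⟨y, hy⟩ := exists_notMem_cone hg
  let G : C(S2, ℍ[ℝ]) := ⟨fun x => g x, hg.continuous.comp continuous_subtype_val⟩
  have hball : Metric.ball q 1 ⊆ {p : C(S2, ℍ[ℝ]) | ∀ x, p x ≠ 0} := fun p hp x h => by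
    have := (ContinuousMap.dist_lt_iff one_pos).mp (Metric.mem_ball.mp hp) x
    rw [h, dist_zero_left, hq] at this
    exact this.false
  have hG : G ∈ Metric.ball q 1 := (ContinuousMap.dist_lt_iff one_pos).mpr fun x => by
    have hqx : q' x = q x := DFunLike.congr_fun hq' x
    rw [← hqx]
    exact hgq x
  have h1 := (JoinedIn.of_segment_subset
    ((convex_ball q 1).segment_subset (Metric.mem_ball_self one_pos) hG)).mono hball
  have h2 : JoinedIn {p : C(S2, ℍ[ℝ]) | ∀ x, p x ≠ 0} G (ContinuousMap.const S2 (-y)) := by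
    refine JoinedIn.of_segment_subset ?_
    rintro _ ⟨a, b, ha, hb, hab, rfl⟩ x h
    change a • G x + b • -y = 0 at h
    rcases eq_or_ne b 0 with rfl | hb0
    · obtain rfl : a = 1 := by linarith
      exact hball hG x (by simpa using h)
    · refine hy (b⁻¹ * a) x ?_
      rw [smul_neg, ← sub_eq_add_neg, sub_eq_zero] at h
      change (b⁻¹ * a) • G x = y
      rw [mul_smul, h, inv_smul_smul₀ hb0]
  have hy0 : -y ≠ 0 := neg_ne_zero.mpr fun h => hy 0 ⟨stdVec 0, by simp [norm_stdVec]⟩ (by simp [h])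
  have h3 : JoinedIn {(0 : ℍ[ℝ])}ᶜ (-y) 1 :=
    (isPathConnected_compl_singleton_of_one_lt_rank (by simp [Quaternion.rank_eq_four]) 0).joinedIn
      _ hy0 _ one_ne_zero
  refine h1.trans (h2.trans ((h3.map ContinuousMap.continuous_const').mono ?_))
  rintro _ ⟨p, hp, rfl⟩ x
  exact hp

/-! ### The space of tangentially injective matrix fields -/

/-- Matrix fields on the sphere which are injective on tangent planes. -/
def tangentMono : Set C(S2, E3 →L[ℝ] E3) := {A | ∀ x : S2, InjOnTangent (A x) x}

/-- The matrices which are upper triangular with positive diagonal with respect to the standard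
basis of the source and the vectors `u` of the target. -/
def posTriangular (u : Fin 3 → E3) : Set (E3 →L[ℝ] E3) :=
  {L | (∀ i, 0 < inner ℝ (u i) (L (stdVec i))) ∧ ∀ i, ∀ j < i, inner ℝ (u i) (L (stdVec j)) = 0}

lemma convex_posTriangular (u : Fin 3 → E3) : Convex ℝ (posTriangular u) := by
  have hf : ∀ i j, IsLinearMap ℝ fun L : E3 →L[ℝ] E3 => inner ℝ (u i) (L (stdVec j)) := fun i j =>
    ⟨fun L M => inner_add_right _ _ _, fun c L => inner_smul_right _ _ _⟩
  simp only [posTriangular, Set.ofPred_and, Set.ofPred_forall]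
  exact (convex_iInter fun i => convex_halfSpace_gt (hf i i) 0).inter <| convex_iInter fun i =>
    convex_iInter fun j => convex_iInter fun _ => convex_hyperplane (hf i j) 0

lemma eq_zero_of_posTriangular {u : Fin 3 → E3} {L : E3 →L[ℝ] E3} (hL : L ∈ posTriangular u)
    {v : E3} (hv : L v = 0) : v = 0 := by
  obtain ⟨hd, ho⟩ := hL
  have h : ∀ i, ∑ j, v j * inner ℝ (u i) (L (stdVec j)) = 0 := fun i => by
    have := congrArg (inner ℝ (u i)) hv
    rwa [← ofCols_stdVec L, ofCols_apply, inner_sum, inner_zero_right,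
      Finset.sum_congr rfl fun j _ => inner_smul_right _ _ _] at this
  have h2 : v 2 = 0 := by
    have := h 2
    rw [Fin.sum_univ_three, ho 2 0 (by decide), ho 2 1 (by decide)] at this
    simpa [(hd 2).ne'] using this
  have h1 : v 1 = 0 := by
    have := h 1
    rw [Fin.sum_univ_three, ho 1 0 (by decide), h2] at this
    simpa [(hd 1).ne'] using this
  have h0 : v 0 = 0 := by
    have := h 0
    rw [Fin.sum_univ_three, h1, h2] at this
    simpa [(hd 0).ne'] using this
  exact E3.ext_coords h0 h1 h2

lemma joinedIn_tangentMono_of_posTriangular {A B : C(S2, E3 →L[ℝ] E3)} {u : S2 → Fin 3 → E3}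
    (hA : ∀ x, A x ∈ posTriangular (u x)) (hB : ∀ x, B x ∈ posTriangular (u x)) :
    JoinedIn tangentMono A B := by
  refine JoinedIn.of_segment_subset ?_
  rintro _ ⟨a, b, ha, hb, hab, rfl⟩ x v - h
  exact eq_zero_of_posTriangular (convex_posTriangular (u x) (hA x) (hB x) ha hb hab) h

/-- The determinant, as a triple product of columns. -/
def tripleDet (L : E3 →L[ℝ] E3) : ℝ := inner ℝ (cross (L (stdVec 0)) (L (stdVec 1))) (L (stdVec 2))

/-- The cofactor matrix of `L`, applied to `x`. -/
def cofactor (L : E3 →L[ℝ] E3) (x : E3) : E3 :=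
  x 0 • cross (L (stdVec 1)) (L (stdVec 2)) + x 1 • cross (L (stdVec 2)) (L (stdVec 0)) +
    x 2 • cross (L (stdVec 0)) (L (stdVec 1))

lemma cross_map_map (L : E3 →L[ℝ] E3) (v w : E3) : cross (L v) (L w) = cofactor L (cross v w) := by
  rw [← ofCols_stdVec L]
  generalize (fun i => L (stdVec i)) = a
  apply E3.ext_coords <;>
    simp [ofCols_apply, Fin.sum_univ_three, cofactor, stdVec] <;> ring

lemma cofactor_ne_zero {L : E3 →L[ℝ] E3} {x : E3} (hx : ‖x‖ = 1) (hL : InjOnTangent L x) :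
    cofactor L x ≠ 0 := by
  intro h
  have hxx : x 0 * x 0 + x 1 * x 1 + x 2 * x 2 = 1 := by
    rw [← E3.inner_eq, real_inner_self_eq_norm_sq, hx, one_pow]
  have hy : ∀ y : E3, inner ℝ x y = 0 → y = 0 := by
    intro y hy
    have hxy : cross y (cross x y) = inner ℝ y y • x := by
      obtain ⟨a, b, c, rfl⟩ := E3.exists_coords x
      obtain ⟨a', b', c', rfl⟩ := E3.exists_coords y
      simp [E3.inner_eq, -inner_self_eq_norm_sq_to_K] at hy
      apply E3.ext_coords <;> simp [E3.inner_eq, -inner_self_eq_norm_sq_to_K]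
      · linear_combination -a' * hy
      · linear_combination -b' * hy
      · linear_combination -c' * hy
    have hcof : cofactor L (inner ℝ y y • x) = 0 := by
      have : cofactor L (inner ℝ y y • x) = inner ℝ y y • cofactor L x := by
        simp [cofactor, mul_smul, -inner_self_eq_norm_sq_to_K]
      rw [this, h, smul_zero]
    rw [← hxy, ← cross_map_map] at hcof
    obtain ⟨a, b, hab, h0⟩ := exists_comb_eq_zero_of_cross_eq_zero hcof
    have h1 : a • y + b • cross x y = 0 := by
      refine hL _ ?_ (by rw [map_add, map_smul, map_smul, h0])
      rw [inner_add_right, inner_smul_right, inner_smul_right, hy, inner_cross_left]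
      simp
    have h2 : inner ℝ (cross x y) (cross x y) = inner ℝ y y := by
      obtain ⟨a, b, c, rfl⟩ := E3.exists_coords x
      obtain ⟨a', b', c', rfl⟩ := E3.exists_coords y
      simp [E3.inner_eq, -inner_self_eq_norm_sq_to_K] at hy hxx ⊢
      linear_combination (a' ^ 2 + b' ^ 2 + c' ^ 2) * hxx - (a * a' + b * b' + c * c') * hy
    rcases hab with ha | hb
    · have := congrArg (inner ℝ y) h1
      rw [inner_add_right, inner_smul_right, inner_smul_right, inner_cross_right] at this
      simpa [ha] using this
    · have := congrArg (inner ℝ (cross x y)) h1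
      rw [inner_add_right, inner_smul_right, inner_smul_right, real_inner_comm,
        inner_cross_right, h2] at this
      simpa [hb] using this
  have hc : ∀ i, cross x (stdVec i) = 0 := fun i => hy _ (inner_cross_left _ _)
  have e0 := congrArg (fun w : E3 => w 2) (hc 1)
  have e1 := congrArg (fun w : E3 => w 0) (hc 2)
  have e2 := congrArg (fun w : E3 => w 1) (hc 0)
  simp [stdVec] at e0 e1 e2
  simp [e0, e1, e2] at hxx

lemma tripleDet_add_smulRight {L : E3 →L[ℝ] E3} {x : E3} (hx : ‖x‖ = 1) (hLx : L x = 0) :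
    tripleDet (L + (innerSL ℝ x).smulRight (cofactor L x)) =
      inner ℝ (cofactor L x) (cofactor L x) := by
  have hxx : x 0 * x 0 + x 1 * x 1 + x 2 * x 2 = 1 := by
    rw [← E3.inner_eq, real_inner_self_eq_norm_sq, hx, one_pow]
  have h0 : tripleDet L = 0 := by
    rw [← ofCols_stdVec L, ofCols_apply, Fin.sum_univ_three] at hLx
    have hi : ∀ w, inner ℝ w (L (stdVec 0)) * x 0 + inner ℝ w (L (stdVec 1)) * x 1 +
        inner ℝ w (L (stdVec 2)) * x 2 = 0 := fun w => by
      have := congrArg (inner ℝ w) hLx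
      simp only [inner_add_right, inner_smul_right, inner_zero_right] at this
      linear_combination this
    have i0 := hi (cross (L (stdVec 1)) (L (stdVec 2)))
    have i1 := hi (cross (L (stdVec 2)) (L (stdVec 0)))
    have i2 := hi (cross (L (stdVec 0)) (L (stdVec 1)))
    simp only [E3.inner_eq, cross_apply_zero, cross_apply_one, cross_apply_two] at i0 i1 i2
    rw [← mul_one (tripleDet L), ← hxx]
    simp only [tripleDet, E3.inner_eq, cross_apply_zero, cross_apply_one, cross_apply_two]
    linear_combination x 0 * i0 + x 1 * i1 + x 2 * i2
  have h1 : ∀ n, tripleDet (L + (innerSL ℝ x).smulRight n) =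
      tripleDet L + inner ℝ n (cofactor L x) := fun n => by
    have h2 : ∀ i, (L + (innerSL ℝ x).smulRight n) (stdVec i) = L (stdVec i) + x i • n :=
        fun i => by
      rw [add_apply, ContinuousLinearMap.smulRight_apply, innerSL_apply_apply, real_inner_comm,
        inner_stdVec]
    simp only [tripleDet, h2, E3.inner_eq, cross_apply_zero, cross_apply_one, cross_apply_two,
      cofactor, PiLp.add_apply, PiLp.smul_apply, smul_eq_mul]
    ring
  rw [h1, h0, zero_add]

/-- The oriented orthonormal frame obtained from two vectors. -/
def gramSchmidt₂ (a b : E3) : Fin 3 → E3 :=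
  let p : E3 := ‖a‖⁻¹ • a
  let q : E3 := ‖cross a b‖⁻¹ • cross a b
  ![p, cross q p, q]

lemma continuous_cross : Continuous fun p : E3 × E3 => cross p.1 p.2 :=
  ContDiff.continuous (𝕜 := ℝ) (n := 0) <| contDiff_iff_contDiffAt.mpr fun _ =>
    contDiffAt_fst.cross contDiffAt_snd

lemma left_ne_zero_of_cross_ne_zero {a b : E3} (h : cross a b ≠ 0) : a ≠ 0 := by
  rintro rfl
  exact h (E3.ext_coords (by simp) (by simp) (by simp))

lemma continuousOn_gramSchmidt₂ :
    ContinuousOn (fun p : E3 × E3 => gramSchmidt₂ p.1 p.2) {p | cross p.1 p.2 ≠ 0} := by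
  have hp : ContinuousOn (fun p : E3 × E3 => ‖p.1‖⁻¹ • p.1) {p | cross p.1 p.2 ≠ 0} :=
    (continuous_fst.norm.continuousOn.inv₀ fun p h =>
      norm_ne_zero_iff.mpr (left_ne_zero_of_cross_ne_zero h)).smul continuousOn_fst
  have hq : ContinuousOn (fun p : E3 × E3 => ‖cross p.1 p.2‖⁻¹ • cross p.1 p.2)
      {p | cross p.1 p.2 ≠ 0} :=
    (continuous_cross.norm.continuousOn.inv₀ fun p h => norm_ne_zero_iff.mpr h).smul
      continuous_cross.continuousOn
  refine continuousOn_pi.mpr fun i => ?_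
  fin_cases i
  · exact hp
  · exact continuous_cross.comp_continuousOn (hq.prodMk hp)
  · exact hq

lemma isQuatFrame_gramSchmidt₂ {a b : E3} (h : cross a b ≠ 0) :
    IsQuatFrame fun i => vecQuat (gramSchmidt₂ a b i) :=
  isQuatFrame_of_orthonormal (norm_smul_inv_norm (𝕜 := ℝ) (left_ne_zero_of_cross_ne_zero h))
    (norm_smul_inv_norm (𝕜 := ℝ) h) (by simp [inner_smul_left, inner_smul_right, inner_cross_left])

lemma inner_cross_cross_self {p q : E3} (h : inner ℝ p q = 0) :
    inner ℝ (cross q p) (cross q p) = inner ℝ p p * inner ℝ q q := by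
  rw [E3.inner_eq] at h
  simp only [E3.inner_eq, cross_apply_zero, cross_apply_one, cross_apply_two]
  linear_combination -(p 0 * q 0 + p 1 * q 1 + p 2 * q 2) * h

lemma ofCols_apply_stdVec (a : Fin 3 → E3) (i : Fin 3) : ofCols a (stdVec i) = a i := by
  rw [ofCols_apply, Fin.sum_univ_three]
  fin_cases i <;> simp [stdVec]

lemma ofCols_mem_posTriangular {p q : E3} (hp : ‖p‖ = 1) (hq : ‖q‖ = 1) (hpq : inner ℝ p q = 0) :
    ofCols ![p, cross q p, q] ∈ posTriangular ![p, cross q p, q] := by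
  have hp' : inner ℝ p p = 1 := by rw [real_inner_self_eq_norm_sq, hp, one_pow]
  have hq' : inner ℝ q q = 1 := by rw [real_inner_self_eq_norm_sq, hq, one_pow]
  refine ⟨fun i => ?_, fun i j hij => ?_⟩ <;> rw [ofCols_apply_stdVec]
  · fin_cases i
    · exact hp'.symm ▸ one_pos
    · change 0 < inner ℝ (cross q p) (cross q p)
      rw [inner_cross_cross_self hpq, hp', hq', one_mul]
      exact one_pos
    · exact hq'.symm ▸ one_pos
  · fin_cases i <;> fin_cases j <;> first | exact absurd hij (by decide) | skip
    · exact (real_inner_comm _ _).trans (inner_cross_right q p)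
    · exact (real_inner_comm _ _).trans hpq
    · exact inner_cross_left q p

lemma ofCols_gramSchmidt₂_mem {a b : E3} (h : cross a b ≠ 0) :
    ofCols (gramSchmidt₂ a b) ∈ posTriangular (gramSchmidt₂ a b) :=
  ofCols_mem_posTriangular (norm_smul_inv_norm (𝕜 := ℝ) (left_ne_zero_of_cross_ne_zero h))
    (norm_smul_inv_norm (𝕜 := ℝ) h) (by simp [inner_smul_left, inner_smul_right, inner_cross_left])

lemma mem_posTriangular_gramSchmidt₂ {L : E3 →L[ℝ] E3} (h : 0 < tripleDet L) :
    L ∈ posTriangular (gramSchmidt₂ (L (stdVec 0)) (L (stdVec 1))) := by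
  have hc : cross (L (stdVec 0)) (L (stdVec 1)) ≠ 0 := by
    intro h0
    rw [tripleDet, h0, inner_zero_left] at h
    exact h.false
  have ha := left_ne_zero_of_cross_ne_zero hc
  unfold tripleDet at h
  simp only [posTriangular, gramSchmidt₂]
  generalize hA : L (stdVec 0) = a at *
  generalize hB : L (stdVec 1) = b at *
  generalize hC : L (stdVec 2) = c at *
  have ha0 : 0 < ‖a‖⁻¹ := by positivity
  have hc0 : 0 < ‖cross a b‖⁻¹ := by positivity
  have hcr : cross (‖cross a b‖⁻¹ • cross a b) (‖a‖⁻¹ • a) =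
      (‖cross a b‖⁻¹ * ‖a‖⁻¹) • cross (cross a b) a := by
    apply E3.ext_coords <;> simp only [cross_apply_zero, cross_apply_one, cross_apply_two,
      PiLp.smul_apply, smul_eq_mul] <;> ring
  rw [hcr]
  constructor
  · intro i
    fin_cases i
    · change 0 < inner ℝ (‖a‖⁻¹ • a) (L (stdVec 0))
      rw [hA, real_inner_smul_left]
      exact mul_pos ha0 (real_inner_self_pos.mpr ha)
    · change 0 < inner ℝ ((‖cross a b‖⁻¹ * ‖a‖⁻¹) • cross (cross a b) a) (L (stdVec 1))
      have : inner ℝ (cross (cross a b) a) b = inner ℝ (cross a b) (cross a b) := by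
        simp only [E3.inner_eq, cross_apply_zero, cross_apply_one, cross_apply_two]
        ring
      rw [hB, real_inner_smul_left, this]
      exact mul_pos (mul_pos hc0 ha0) (real_inner_self_pos.mpr hc)
    · change 0 < inner ℝ (‖cross a b‖⁻¹ • cross a b) (L (stdVec 2))
      rw [hC, real_inner_smul_left]
      exact mul_pos hc0 h
  · intro i j hij
    fin_cases i <;> fin_cases j <;> first | exact absurd hij (by decide) | skip
    · change inner ℝ ((‖cross a b‖⁻¹ * ‖a‖⁻¹) • cross (cross a b) a) (L (stdVec 0)) = 0
      rw [hA, real_inner_smul_left, real_inner_comm, inner_cross_right, mul_zero]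
    · change inner ℝ (‖cross a b‖⁻¹ • cross a b) (L (stdVec 0)) = 0
      rw [hA, real_inner_smul_left, real_inner_comm, inner_cross_left, mul_zero]
    · change inner ℝ (‖cross a b‖⁻¹ • cross a b) (L (stdVec 1)) = 0
      rw [hB, real_inner_smul_left, real_inner_comm, inner_cross_right, mul_zero]

lemma joinedIn_tangentMono_id_of_eq_quatConj {A : C(S2, E3 →L[ℝ] E3)} {q : C(S2, ℍ[ℝ])}
    (hq : ∀ x, ‖q x‖ = 1) (hA : ∀ x, A x = quatConj (q x)) :
    JoinedIn tangentMono A (ContinuousMap.const S2 (ContinuousLinearMap.id ℝ E3)) := by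
  let Q : C(ℍ[ℝ], E3 →L[ℝ] E3) := ⟨quatConj, continuous_quatConj⟩
  have h := (joinedIn_ne_zero_const_one q hq).map Q.continuous_postcomp
  have h0 : Q.comp q = A := ContinuousMap.ext fun x => (hA x).symm
  have h1 : Q.comp (ContinuousMap.const S2 1) =
      ContinuousMap.const S2 (ContinuousLinearMap.id ℝ E3) :=
    ContinuousMap.ext fun x => quatConj_one
  rw [h0, h1] at h
  refine h.mono ?_
  rintro _ ⟨p, hp, rfl⟩ x v - hv
  exact quatConj_injective (hp x) hv

lemma joinedIn_tangentMono_id_of_tripleDet_pos {A : C(S2, E3 →L[ℝ] E3)}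
    (hA : ∀ x, 0 < tripleDet (A x)) :
    JoinedIn tangentMono A (ContinuousMap.const S2 (ContinuousLinearMap.id ℝ E3)) := by
  have hc : ∀ x, cross (A x (stdVec 0)) (A x (stdVec 1)) ≠ 0 := fun x h0 => by
    have := hA x
    rw [tripleDet, h0, inner_zero_left] at this
    exact this.false
  have hAi : ∀ i, Continuous fun x => A x (stdVec i) := fun i =>
    A.continuous.clm_apply continuous_const
  obtain ⟨u, hu⟩ : ∃ u : C(S2, Fin 3 → E3),
      ∀ x, u x = gramSchmidt₂ (A x (stdVec 0)) (A x (stdVec 1)) :=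
    ⟨⟨_, continuousOn_gramSchmidt₂.comp_continuous ((hAi 0).prodMk (hAi 1)) hc⟩, fun _ => rfl⟩
  obtain ⟨q, hq⟩ := exists_quaternion_lift u fun x => hu x ▸ isQuatFrame_gramSchmidt₂ (hc x)
  let B : C(S2, E3 →L[ℝ] E3) := ⟨fun x => ofCols (u x), continuous_ofCols.comp u.continuous⟩
  have h1 : JoinedIn tangentMono A B := by
    refine joinedIn_tangentMono_of_posTriangular (u := u) (fun x => ?_) fun x => ?_
    · exact hu x ▸ mem_posTriangular_gramSchmidt₂ (hA x)
    · change ofCols (u x) ∈ _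
      exact hu x ▸ ofCols_gramSchmidt₂_mem (hc x)
  exact h1.trans (joinedIn_tangentMono_id_of_eq_quatConj (fun x => (hq x).1) fun x =>
    (quatConj_eq_ofCols (hq x).1 (hq x).2).symm)

lemma continuous_cofactor {X : Type*} [TopologicalSpace X] {L : X → E3 →L[ℝ] E3} {x : X → E3}
    (hL : Continuous L) (hx : Continuous x) : Continuous fun z => cofactor (L z) (x z) := by
  have hi : ∀ i, Continuous fun z => x z i := fun i =>
    (EuclideanSpace.proj (𝕜 := ℝ) i).continuous.comp hx
  have hc : ∀ i j, Continuous fun z => cross (L z (stdVec i)) (L z (stdVec j)) := fun i j =>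
    continuous_cross.comp ((hL.clm_apply continuous_const).prodMk (hL.clm_apply continuous_const))
  exact (((hi 0).smul (hc 1 2)).add ((hi 1).smul (hc 2 0))).add ((hi 2).smul (hc 0 1))

lemma joinedIn_tangentMono_id {D : C(S2, E3 →L[ℝ] E3)} (hD : D ∈ tangentMono)
    (hDx : ∀ x, D x x = 0) :
    JoinedIn tangentMono D (ContinuousMap.const S2 (ContinuousLinearMap.id ℝ E3)) := by
  have hx : ∀ x : S2, ‖(x : E3)‖ = 1 := fun x => mem_sphere_zero_iff_norm.mp x.2
  let N : C(S2, E3 →L[ℝ] E3) :=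
    ⟨fun x => (innerSL ℝ (x : E3)).smulRight (cofactor (D x) x), by
      have h1 : Continuous fun x : S2 => innerSL ℝ (x : E3) :=
        (innerSL ℝ (E := E3)).continuous.comp continuous_subtype_val
      exact (((ContinuousLinearMap.smulRightL ℝ E3 E3).continuous.comp h1).clm_apply
        (continuous_cofactor D.continuous continuous_subtype_val))⟩
  have h1 : JoinedIn tangentMono D (D + N) := by
    refine JoinedIn.of_segment_subset ?_
    rintro _ ⟨a, b, ha, hb, hab, rfl⟩ x v hv h
    refine hD x v hv ?_
    have hN : N x v = 0 := by
      change inner ℝ (x : E3) v • _ = (0 : E3)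
      rw [hv, zero_smul]
    change a • D x v + b • (D x v + N x v) = 0 at h
    rwa [hN, add_zero, ← add_smul, hab, one_smul] at h
  refine h1.trans (joinedIn_tangentMono_id_of_tripleDet_pos fun x => ?_)
  change 0 < tripleDet (D x + (innerSL ℝ (x : E3)).smulRight (cofactor (D x) x))
  rw [tripleDet_add_smulRight (hx x) (hDx x)]
  exact real_inner_self_pos.mpr (cofactor_ne_zero (hx x) (hD x))

/-! ### Smoothing a formal homotopy -/

/-- A smooth cutoff, vanishing near the origin and equal to `1` near the unit sphere. -/
def radialCutoff (x : E3) : ℝ := Real.smoothTransition (4 * ‖x‖ ^ 2 - 1)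

lemma contDiff_radialCutoff : ContDiff ℝ ∞ radialCutoff :=
  Real.smoothTransition.contDiff.comp ((contDiff_const.mul (contDiff_norm_sq ℝ)).sub contDiff_const)

lemma radialCutoff_eq_one {x : E3} (hx : 1 / 2 ≤ ‖x‖ ^ 2) : radialCutoff x = 1 :=
  Real.smoothTransition.one_of_one_le (by linarith)

lemma radialCutoff_eventuallyEq_zero : radialCutoff =ᶠ[nhds 0] 0 := by
  filter_upwards [Metric.ball_mem_nhds (0 : E3) (one_half_pos (α := ℝ))] with x hx
  have := mem_ball_zero_iff.mp hx
  exact Real.smoothTransition.zero_of_nonpos (by nlinarith [norm_nonneg x])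

lemma contDiff_radialCutoff_smul {F : Type*} [NormedAddCommGroup F] [NormedSpace ℝ F] {h : E3 → F}
    (hh : ∀ x, x ≠ 0 → ContDiffAt ℝ ∞ h x) : ContDiff ℝ ∞ fun x => radialCutoff x • h x := by
  refine contDiff_iff_contDiffAt.mpr fun x => ?_
  rcases eq_or_ne x 0 with rfl | hx
  · refine (contDiffAt_const (c := (0 : F))).congr_of_eventuallyEq ?_
    filter_upwards [radialCutoff_eventuallyEq_zero] with y hy
    rw [hy, Pi.zero_apply, zero_smul]
  · exact contDiff_radialCutoff.contDiffAt.smul (hh x hx)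

/-- Radial projection to the unit sphere (with a junk value at the origin). -/
def radialProj (x : E3) : S2 :=
  if h : x = 0 then ⟨stdVec 0, by simp [norm_stdVec]⟩
  else ⟨‖x‖⁻¹ • x, by simpa using norm_smul_inv_norm (𝕜 := ℝ) h⟩

lemma coe_radialProj {x : E3} (hx : x ≠ 0) : (radialProj x : E3) = ‖x‖⁻¹ • x := by
  simp [radialProj, hx]

lemma radialProj_coe (x : S2) : radialProj x = x := by
  have hx : ‖(x : E3)‖ = 1 := mem_sphere_zero_iff_norm.mp x.2
  refine Subtype.ext ?_
  rw [coe_radialProj (norm_ne_zero_iff.mp (by simp [hx])), hx, inv_one, one_smul]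

lemma radialProj_smul {c : ℝ} (hc : 0 < c) (x : E3) : radialProj (c • x) = radialProj x := by
  rcases eq_or_ne x 0 with rfl | hx
  · rw [smul_zero]
  · refine Subtype.ext ?_
    rw [coe_radialProj hx, coe_radialProj (smul_ne_zero hc.ne' hx), norm_smul,
      Real.norm_of_nonneg hc.le, smul_smul]
    congr 1
    field_simp

lemma contDiffAt_coe_radialProj {x : E3} (hx : x ≠ 0) :
    ContDiffAt ℝ ∞ (fun x => (radialProj x : E3)) x := by
  refine (((contDiffAt_norm ℝ hx).inv (norm_ne_zero_iff.mpr hx)).smul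
    contDiffAt_id).congr_of_eventuallyEq ?_
  filter_upwards [isOpen_compl_singleton.mem_nhds hx] with y hy
  exact coe_radialProj hy

lemma continuousAt_radialProj {x : E3} (hx : x ≠ 0) : ContinuousAt radialProj x :=
  Topology.IsInducing.subtypeVal.continuousAt_iff.mpr (contDiffAt_coe_radialProj hx).continuousAt

/-- The extension of a map from the sphere which is constant along rays, cut off near the origin. -/
def radialExt {F : Type*} [SMul ℝ F] (h : S2 → F) (x : E3) : F := radialCutoff x • h (radialProj x)

lemma radialExt_coe {F : Type*} [AddCommGroup F] [Module ℝ F] (h : S2 → F) (x : S2) :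
    radialExt h x = h x := by
  rw [radialExt, radialProj_coe, radialCutoff_eq_one, one_smul]
  rw [mem_sphere_zero_iff_norm.mp x.2]
  norm_num

lemma fderiv_radialExt_self (h : S2 → E3) (hd : ContDiff ℝ ∞ (radialExt h)) (x : S2) :
    fderiv ℝ (radialExt h) x x = 0 := by
  have hx : ‖(x : E3)‖ = 1 := mem_sphere_zero_iff_norm.mp x.2
  have h1 : HasDerivAt (fun s : ℝ => s • (x : E3)) (x : E3) 1 := by
    simpa using (hasDerivAt_id (1 : ℝ)).smul_const (x : E3)
  have h2 := ((hd.differentiable (by simp)).differentiableAt (x := (1 : ℝ) • (x : E3))).hasFDerivAt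
    |>.comp_hasDerivAt (1 : ℝ) h1
  have h3 : (radialExt h ∘ fun s : ℝ => s • (x : E3)) =ᶠ[nhds 1] fun _ => h x := by
    have h9 : (9 / 10 : ℝ) < 1 := by norm_num
    filter_upwards [lt_mem_nhds h9] with s hs
    rw [Function.comp_apply, radialExt, radialProj_smul (by linarith), radialProj_coe,
      radialCutoff_eq_one, one_smul]
    rw [norm_smul, hx, mul_one, Real.norm_eq_abs, sq_abs]
    nlinarith
  have h4 := h2.unique ((hasDerivAt_const (1 : ℝ) (h x)).congr_of_eventuallyEq h3)
  rwa [one_smul] at h4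

lemma continuous_radialCutoff_smul_eval {F : Type*} [NormedAddCommGroup F] [NormedSpace ℝ F]
    {γ : ℝ → C(S2, F)} (hγ : Continuous γ) :
    Continuous fun z : ℝ × E3 => radialCutoff z.2 • γ z.1 (radialProj z.2) := by
  refine continuous_iff_continuousAt.mpr fun ⟨t, x⟩ => ?_
  rcases eq_or_ne x 0 with rfl | hx
  · refine (continuousAt_const (y := (0 : F))).congr ?_
    filter_upwards [continuousAt_snd.eventually radialCutoff_eventuallyEq_zero] with z hz
    rw [hz, Pi.zero_apply, zero_smul]
  · have h1 : ContinuousAt (fun z : ℝ × E3 => radialProj z.2) (t, x) :=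
      ContinuousAt.comp (f := Prod.snd) (continuousAt_radialProj hx) continuousAt_snd
    exact (contDiff_radialCutoff.continuous.continuousAt.comp continuousAt_snd).smul
      ((hγ.continuousAt.comp continuousAt_fst).eval h1)

lemma exists_pos_injOnTangent {G : ℝ × E3 → E3 →L[ℝ] E3} (hG : Continuous G)
    (hinj : ∀ z ∈ cyl, InjOnTangent (G z) z.2) :
    ∃ ε > 0, ∀ z ∈ cyl, ∀ L : E3 →L[ℝ] E3, dist L (G z) < ε → InjOnTangent L z.2 := by
  have hK : IsCompact ((cyl ×ˢ Metric.sphere (0 : E3) 1) ∩ {p | inner ℝ p.1.2 p.2 = 0}) :=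
    (isCompact_cyl.prod (isCompact_sphere 0 1)).inter_right
      (isClosed_eq (continuous_fst.snd.inner continuous_snd) continuous_const)
  have hc : Continuous fun p : (ℝ × E3) × E3 => ‖G p.1 p.2‖ :=
    ((hG.comp continuous_fst).clm_apply continuous_snd).norm
  have hpos : ∀ p ∈ (cyl ×ˢ Metric.sphere (0 : E3) 1) ∩ {p | inner ℝ p.1.2 p.2 = 0},
      0 < ‖G p.1 p.2‖ := by
    intro p hp
    refine norm_pos_iff.mpr fun h0 => ?_
    have hv := mem_sphere_zero_iff_norm.mp hp.1.2
    rw [hinj p.1 hp.1.1 p.2 hp.2 h0] at hv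
    simp at hv
  obtain ⟨ε, hε, h⟩ := hK.exists_forall_le' hc.continuousOn hpos
  refine ⟨ε, hε, fun z hz L hL v hv hLv => ?_⟩
  by_contra hv0
  have h1 := h (z, (‖v‖⁻¹ : ℝ) • v) ⟨⟨hz, by simpa using norm_smul_inv_norm (𝕜 := ℝ) hv0⟩, by
    change inner ℝ z.2 ((‖v‖⁻¹ : ℝ) • v) = 0
    rw [inner_smul_right, hv, mul_zero]⟩
  have h2 : G z ((‖v‖⁻¹ : ℝ) • v) = -((L - G z) ((‖v‖⁻¹ : ℝ) • v)) := by
    rw [sub_apply, map_smul L, hLv, smul_zero, zero_sub, neg_neg]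
  have h3 := (L - G z).le_opNorm ((‖v‖⁻¹ : ℝ) • v)
  have h4 : ‖(‖v‖⁻¹ : ℝ) • v‖ = 1 := by simpa using norm_smul_inv_norm (𝕜 := ℝ) hv0
  rw [h4, mul_one, ← dist_eq_norm] at h3
  simp only [h2, norm_neg] at h1
  linarith

lemma exists_immersion_family {f₀ f₁ : S2 → E3} (h₀ : ContDiff ℝ ∞ (radialExt f₀))
    (h₁ : ContDiff ℝ ∞ (radialExt f₁)) (hi₀ : ∀ x : S2, InjOnTangent (fderiv ℝ (radialExt f₀) x) x)
    (hi₁ : ∀ x : S2, InjOnTangent (fderiv ℝ (radialExt f₁) x) x) :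
    ∃ f : ℝ × E3 → E3, (∀ z ∈ cyl, ContDiffAt ℝ ∞ f z) ∧
      (∀ x : S2, f (0, x) = f₀ x ∧ f (1, x) = f₁ x) ∧
      ∀ z ∈ cyl, InjOnTangent (spaceDeriv f z) z.2 := by
  have hc₀ := h₀.fderiv_right (m := ∞) (by simp)
  have hc₁ := h₁.fderiv_right (m := ∞) (by simp)
  let D₀ : C(S2, E3 →L[ℝ] E3) := ⟨_, hc₀.continuous.comp continuous_subtype_val⟩
  let D₁ : C(S2, E3 →L[ℝ] E3) := ⟨_, hc₁.continuous.comp continuous_subtype_val⟩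
  obtain ⟨γ, hγ⟩ : JoinedIn tangentMono D₀ D₁ :=
    (joinedIn_tangentMono_id (D := D₀) hi₀ (fderiv_radialExt_self f₀ h₀)).trans
      (joinedIn_tangentMono_id (D := D₁) hi₁ (fderiv_radialExt_self f₁ h₁)).symm
  let H : ℝ × E3 → E3 →L[ℝ] E3 := fun z =>
    radialCutoff z.2 • γ.extend (3 * z.1 - 1) (radialProj z.2)
  have hHc : Continuous H := continuous_radialCutoff_smul_eval
    (γ := fun t => γ.extend (3 * t - 1)) (γ.continuous_extend.comp (by fun_prop))
  have hH₀ : ∀ z : ℝ × E3, z.1 ≤ 1 / 3 →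
      H z = radialCutoff z.2 • fderiv ℝ (radialExt f₀) (radialProj z.2) := fun z hz => by
    change _ • γ.extend _ _ = _
    rw [γ.extend_of_le_zero (by linarith)]
    rfl
  have hH₁ : ∀ z : ℝ × E3, 2 / 3 ≤ z.1 →
      H z = radialCutoff z.2 • fderiv ℝ (radialExt f₁) (radialProj z.2) := fun z hz => by
    change _ • γ.extend _ _ = _
    rw [γ.extend_of_one_le (by linarith)]
    rfl
  have hcut : ∀ x ∈ Metric.sphere (0 : E3) 1, radialCutoff x = 1 := fun x hx =>
    radialCutoff_eq_one (by rw [mem_sphere_zero_iff_norm.mp hx]; norm_num)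
  have hHinj : ∀ z ∈ cyl, InjOnTangent (H z) z.2 := by
    rintro ⟨t, x⟩ ⟨-, hx⟩
    have h1 : γ.extend (3 * t - 1) ∈ tangentMono := hγ _
    change InjOnTangent (_ • γ.extend _ _) _
    rw [hcut x hx, one_smul, radialProj_coe ⟨x, hx⟩]
    exact h1 ⟨x, hx⟩
  obtain ⟨ε, hε, hεinj⟩ := exists_pos_injOnTangent hHc hHinj
  have hsm : ∀ {f : S2 → E3}, ContDiff ℝ ∞ (fderiv ℝ (radialExt f)) → ContDiff ℝ ∞ fun z : ℝ × E3 =>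
      radialCutoff z.2 • fderiv ℝ (radialExt f) (radialProj z.2) := fun hf =>
    (contDiff_radialCutoff_smul fun x hx =>
      hf.contDiffAt.comp x (contDiffAt_coe_radialProj hx)).comp contDiff_snd
  obtain ⟨G, hG, hGH, hGeq, -⟩ := hHc.exists_contDiff_approx_and_eqOn ⊤ (ε := fun _ => ε)
    continuous_const (fun _ => hε) (S := {z | z.1 ≤ 1 / 4} ∪ {z | 3 / 4 ≤ z.1})
    (U := {z | z.1 < 1 / 3} ∪ {z | 2 / 3 < z.1})
    ((isClosed_le continuous_fst continuous_const).union
      (isClosed_le continuous_const continuous_fst))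
    (((isOpen_lt continuous_fst continuous_const).union
      (isOpen_lt continuous_const continuous_fst)).mem_nhdsSet.mpr
      (Set.union_subset_union (fun z (hz : z.1 ≤ 1 / 4) => show z.1 < 1 / 3 by linarith)
        fun z (hz : 3 / 4 ≤ z.1) => show 2 / 3 < z.1 by linarith))
    (ContDiffOn.union_of_isOpen
      ((hsm hc₀).contDiffOn.congr fun z (hz : z.1 < 1 / 3) => hH₀ z hz.le)
      ((hsm hc₁).contDiffOn.congr fun z (hz : 2 / 3 < z.1) => hH₁ z hz.le)
      (isOpen_lt continuous_fst continuous_const) (isOpen_lt continuous_const continuous_fst))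
  let σ : ℝ → ℝ := fun t => Real.smoothTransition (3 * t - 1)
  let f : ℝ × E3 → E3 := fun z => radialExt f₀ z.2 + σ z.1 • (radialExt f₁ z.2 - radialExt f₀ z.2)
  have hσ : ContDiff ℝ ∞ σ :=
    Real.smoothTransition.contDiff.comp ((contDiff_const.mul contDiff_id).sub contDiff_const)
  have hf : ContDiff ℝ ∞ f := (h₀.comp contDiff_snd).add ((hσ.comp contDiff_fst).smul
    ((h₁.comp contDiff_snd).sub (h₀.comp contDiff_snd)))
  have hfd : ∀ z, spaceDeriv f z = fderiv ℝ (radialExt f₀) z.2 +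
      σ z.1 • (fderiv ℝ (radialExt f₁) z.2 - fderiv ℝ (radialExt f₀) z.2) := by
    rintro ⟨t, x⟩
    have hd : HasFDerivAt (fun y => f (t, y)) (spaceDeriv f (t, x)) x :=
      (hf.differentiable (by simp) (t, x)).hasFDerivAt.comp x (hasFDerivAt_prodMk_right t x)
    have hd₀ := (h₀.differentiable (by simp) x).hasFDerivAt
    have hd₁ := (h₁.differentiable (by simp) x).hasFDerivAt
    exact hd.unique (hd₀.add ((hd₁.sub hd₀).const_smul (σ t)))
  have hσ₀ : ∀ t ≤ 1 / 3, σ t = 0 := fun t ht => Real.smoothTransition.zero_of_nonpos (by linarith)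
  have hσ₁ : ∀ t, 2 / 3 ≤ t → σ t = 1 := fun t ht =>
    Real.smoothTransition.one_of_one_le (by linarith)
  obtain ⟨f', hf', hend, hinj'⟩ := exists_holonomic (f := f) (G := G)
    (fun z _ => hf.contDiffAt) (fun z _ => hG.contDiffAt) (by
      rintro ⟨t, x⟩ ⟨-, hx⟩ ht
      have hp : radialProj x = ⟨x, hx⟩ := radialProj_coe ⟨x, hx⟩
      rw [hfd]
      change ¬(_ ∧ _) at ht
      rw [not_and_or, not_le, not_le] at ht
      change t < 1 / 4 ∨ 3 / 4 < t at ht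
      rcases ht with ht | ht
      · rw [hGeq (Or.inl ht.le), hH₀ _ (by change t ≤ _; linarith), hcut x hx, hp,
          hσ₀ _ (by change t ≤ _; linarith), one_smul]
        exact (add_eq_left.mpr
          (zero_smul ℝ (fderiv ℝ (radialExt f₁) x - fderiv ℝ (radialExt f₀) x))).symm
      · rw [hGeq (Or.inr ht.le), hH₁ _ (by change _ ≤ t; linarith), hcut x hx, hp,
          hσ₁ _ (by change _ ≤ t; linarith), one_smul, one_smul, add_sub_cancel])
    fun z hz => hεinj z hz _ (hGH z)
  refine ⟨f', hf', fun x => ?_, hinj'⟩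
  obtain ⟨e0, e1⟩ := hend x (mem_sphere_zero_iff_norm.mp x.2)
  rw [e0, e1]
  constructor
  · change radialExt f₀ x + σ 0 • _ = _
    rw [hσ₀ 0 (by norm_num), zero_smul, add_zero, radialExt_coe]
  · change radialExt f₀ x + σ 1 • _ = _
    rw [hσ₁ 1 (by norm_num), one_smul, add_sub_cancel, radialExt_coe]

/-! ### Immersions of the sphere as a manifold -/

lemma fact_finrank_E3 : Fact (Module.finrank ℝ E3 = 2 + 1) := ⟨finrank_euclideanSpace_fin⟩

lemma contMDiff_coe_S2 {m : ℕ∞ω} : ContMDiff (𝓡 2) 𝓘(ℝ, E3) m ((↑) : S2 → E3) :=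
  have := fact_finrank_E3
  contMDiff_coe_sphere

lemma contMDiffAt_radialProj {x : E3} (hx : x ≠ 0) :
    ContMDiffAt 𝓘(ℝ, E3) (𝓡 2) ∞ radialProj x := by
  let U : TopologicalSpace.Opens E3 := ⟨{0}ᶜ, isOpen_compl_singleton⟩
  have hU : ContMDiff 𝓘(ℝ, E3) 𝓘(ℝ, E3) ∞ fun y : U => (radialProj y : E3) := fun y =>
    contMDiffAt_subtype_iff.2 (contDiffAt_coe_radialProj y.2).contMDiffAt
  have := fact_finrank_E3
  have h : ContMDiff 𝓘(ℝ, E3) (𝓡 2) ∞ fun y : U => radialProj y :=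
    hU.codRestrict_sphere fun y => (radialProj y).2
  exact contMDiffAt_subtype_iff.1 (h ⟨x, hx⟩)

lemma ContMDiff.contDiff_radialExt {e : S2 → E3} (he : ContMDiff (𝓡 2) 𝓘(ℝ, E3) ∞ e) :
    ContDiff ℝ ∞ (radialExt e) :=
  contDiff_radialCutoff_smul (h := e ∘ radialProj) fun x hx =>
    ((he (radialProj x)).comp x (contMDiffAt_radialProj hx)).contDiffAt

lemma injective_mfderiv_iff_injOnTangent {g : E3 → E3} {x : S2}
    (hg : DifferentiableAt ℝ g x) :
    Function.Injective (mfderiv (𝓡 2) 𝓘(ℝ, E3) (fun y : S2 => g y) x) ↔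
      InjOnTangent (fderiv ℝ g x) x := by
  have := fact_finrank_E3
  have hc : MDifferentiableAt (𝓡 2) 𝓘(ℝ, E3) ((↑) : S2 → E3) x :=
    (contMDiff_coe_S2 (m := 1) x).mdifferentiableAt one_ne_zero
  have hcomp : mfderiv (𝓡 2) 𝓘(ℝ, E3) (fun y : S2 => g y) x =
      (fderiv ℝ g x).comp (mvfderiv (𝓡 2) ((↑) : S2 → E3) x) := by
    have := mfderiv_comp (I := 𝓡 2) (I' := 𝓘(ℝ, E3)) (I'' := 𝓘(ℝ, E3)) x
      (g := g) hg.mdifferentiableAt hc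
    rw [mfderiv_eq_fderiv] at this
    exact this
  have hr : ∀ v : E3, inner ℝ (x : E3) v = 0 ↔
      ∃ w, mvfderiv (𝓡 2) ((↑) : S2 → E3) x w = v := fun v => by
    rw [← Submodule.mem_orthogonal_singleton_iff_inner_right,
      ← range_mvfderiv_subtypeVal (n := 2) x]
    rfl
  have hinj := injective_mvfderiv_subtypeVal_sphere (n := 2) x
  rw [hcomp]
  refine ⟨fun h v hv hgv => ?_, fun h => ?_⟩
  · obtain ⟨w, rfl⟩ := (hr v).1 hv
    have : w = 0 := h (hgv.trans (map_zero _).symm)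
    rw [this, map_zero]
  · refine (injective_iff_map_eq_zero _).2 fun w hw => ?_
    exact hinj ((h _ ((hr _).2 ⟨w, rfl⟩) hw).trans (map_zero _).symm)

lemma IsSmoothImmersion.injOnTangent {e : S2 → E3} (he : IsSmoothImmersion e) (x : S2) :
    InjOnTangent (fderiv ℝ (radialExt e) x) x := by
  refine (injective_mfderiv_iff_injOnTangent
    (he.1.contDiff_radialExt.differentiable (by simp) _)).1 ?_
  rw [show (fun y : S2 => radialExt e (y : E3)) = e from funext (radialExt_coe e)]
  exact he.2 x

lemma radialExt_comp_antipodal (e : S2 → E3) (x : E3) :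
    radialExt (e ∘ antipodal) x = radialExt e (-x) := by
  rcases eq_or_ne x 0 with rfl | hx
  · simp [radialExt, radialCutoff, Real.smoothTransition.zero_of_nonpos]
  · have : antipodal (radialProj x) = radialProj (-x) := Subtype.ext <| by
      simp [antipodal, coe_radialProj hx, coe_radialProj (neg_ne_zero.2 hx)]
    simp [radialExt, radialCutoff, this]

lemma InjOnTangent.comp_neg {g : E3 → E3} {x : E3} (h : InjOnTangent (fderiv ℝ g (-x)) (-x)) :
    InjOnTangent (fderiv ℝ (fun y => g (-y)) x) x := fun v hv hgv =>
  h v (by simp [hv]) <| by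
    have hd := fderiv_comp_smul (𝕜 := ℝ) (f := g) (x := x) (-1)
    simp only [neg_smul, one_smul] at hd
    rwa [hd, neg_apply, neg_eq_zero] at hgv

/-- **Sphere eversion** (Smale): every smoothly embedded 2-sphere in ℝ³ (injective smooth
immersion `e : S² → ℝ³`) is regularly homotopic to itself with orientation reversed, i.e.
there is a homotopy through immersions from `e` to `e ∘ a` where `a` is the antipodal map. -/
theorem sphere_eversion_of_embedded (e : S2 → E3)
    (he : IsSmoothImmersion e) (he_inj : Function.Injective e) :
    ∃ F : ℝ × S2 → E3, IsRegularHomotopy F e (e ∘ antipodal) := by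
  have hneg : radialExt (e ∘ antipodal) = fun x => radialExt e (-x) :=
    funext (radialExt_comp_antipodal e)
  have h₀ := he.1.contDiff_radialExt
  obtain ⟨f, hf, hends, himm⟩ := exists_immersion_family h₀
    (hneg ▸ h₀.comp contDiff_neg : ContDiff ℝ ∞ (radialExt (e ∘ antipodal)))
    he.injOnTangent fun x => hneg ▸ (he.injOnTangent (-x)).comp_neg
  have hmem (t : ℝ) (x : S2) : (Real.smoothTransition t, (x : E3)) ∈ cyl :=
    ⟨⟨Real.smoothTransition.nonneg t, Real.smoothTransition.le_one t⟩, x.2⟩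
  have hslice (t : ℝ) (x : S2) :
      ContDiffAt ℝ ∞ (fun y => f (Real.smoothTransition t, y)) (x : E3) :=
    (hf _ (hmem t x)).comp (x : E3) (contDiffAt_const.prodMk contDiffAt_id)
  refine ⟨fun p => f (Real.smoothTransition p.1, p.2), fun p => ?_, fun x => ?_, fun x => ?_,
    fun t => ⟨fun x => (hslice t x).contMDiffAt.comp x (contMDiff_coe_S2 x), fun x => ?_⟩⟩
  · have hp : ContMDiffAt ((𝓘(ℝ, ℝ)).prod (𝓡 2)) 𝓘(ℝ, ℝ × E3) ∞
        (fun p : ℝ × S2 => (Real.smoothTransition p.1, (p.2 : E3))) p :=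
      ((Real.smoothTransition.contDiff.contMDiff.comp contMDiff_fst) p).prodMk_space
        ((contMDiff_coe_S2.comp contMDiff_snd) p)
    exact (hf _ (hmem p.1 p.2)).contMDiffAt.comp p hp
  · simpa using (hends x).1
  · simpa using (hends x).2
  · refine (injective_mfderiv_iff_injOnTangent
      (g := fun y => f (Real.smoothTransition t, y)) ((hslice t x).differentiableAt (by simp))).2 ?_
    have hd : fderiv ℝ (fun y => f (Real.smoothTransition t, y)) x =
        spaceDeriv f (Real.smoothTransition t, (x : E3)) :=
      (((hf _ (hmem t x)).differentiableAt (by simp)).hasFDerivAt.comp (x : E3)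
        (hasFDerivAt_prodMk_right _ _)).fderiv
    rw [hd]
    exact himm _ (hmem t x)
end
end

section
/- There exists a smooth map F : ℝ × S² → ℝ³ such that for every t the map x ↦ F(t,x) is a smooth immersion, F(0,x) = x (the standard inclusion of the unit sphere into ℝ³), and F(1,x) = −x for all x ∈ S². That is, the standard round sphere in ℝ³ can be everted by a regular homotopy. -/
open scoped Manifold

noncomputable section

theorem cap_polynomial_pos {x : ℝ} (hx : 0 ≤ x) :
    0 < 1 + 4 / 5 * x - 27 / 25 * x ^ 2 + 36 / 125 * x ^ 3 := by
  nlinarith [mul_nonneg hx (sq_nonneg (x - 2)), sq_nonneg (x - 2), sq_nonneg (x - 1)]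

theorem radial_derivs_eq_zero {e g g' q q' D D' X Y X' Y' : ℝ} (hq : 0 ≤ q)
    (hS : X ^ 2 + Y ^ 2 = q * D - 9 / 25 * q ^ 3)
    (hS' : 2 * (X * X' + Y * Y') = q' * D + q * D' - 27 / 25 * q ^ 2 * q')
    (hD : g ^ 4 * D = 1) (hD' : 4 * g' * D + g * D' = 0)
    (h₁ : e * X * g + X' * g + 3 * X * g' = 0) (h₂ : e * Y * g + Y' * g + 3 * Y * g' = 0)
    (h₃ : e * (1 - 4 / 5 * q * g ^ 2) - 4 / 5 * (q' * g ^ 2 + 2 * q * g * g') = 0) :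
    e = 0 ∧ q' * g ^ 2 + 2 * q * g * g' = 0 := by
  have hpos := cap_polynomial_pos (mul_nonneg hq (sq_nonneg g))
  have h₄ : 2 * e * (q * g ^ 2 - 9 / 25 * (q * g ^ 2) ^ 3)
      + (1 - 27 / 25 * (q * g ^ 2) ^ 2) * (q' * g ^ 2 + 2 * q * g * g') = 0 := by
    have h₅ : e * (X ^ 2 + Y ^ 2) * g + (X * X' + Y * Y') * g + 3 * (X ^ 2 + Y ^ 2) * g' = 0 := by
      linear_combination X * h₁ + Y * h₂
    linear_combination 2 * g ^ 5 * h₅ - (2 * e * g ^ 6 + 6 * g ^ 5 * g') * hS - g ^ 6 * hS'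
      - (2 * e * q * g ^ 2 + q' * g ^ 2 + 2 * q * g * g') * hD - q * g ^ 5 * hD'
  have h₆ : e * (1 + 4 / 5 * (q * g ^ 2) - 27 / 25 * (q * g ^ 2) ^ 2
      + 36 / 125 * (q * g ^ 2) ^ 3) = 0 := by
    linear_combination 4 / 5 * h₄ + (1 - 27 / 25 * (q * g ^ 2) ^ 2) * h₃
  have he : e = 0 := (mul_eq_zero.1 h₆).resolve_right hpos.ne'
  refine ⟨he, ?_⟩
  rw [he] at h₃
  linarith

theorem quadratic_form_pos {t p a b c : ℝ} (htp : t ^ 2 + p ^ 2 = 1)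
    (h : a ^ 2 + b ^ 2 + c ^ 2 = 1) (hq : 0 < a ^ 2 + b ^ 2)
    (hc : 2 * c = 4 / 5 * p * (a ^ 2 - b ^ 2)) :
    0 < 3 / 2 * (1 + 8 * c ^ 2 - c ^ 4) * (t ^ 2 * (a ^ 2 + b ^ 2) - 2 * p * t * a * b)
      + 2 * p ^ 2 * (2 * (a ^ 2 + b ^ 2) ^ 2 - 4 * a ^ 2 * b ^ 2) := by
  have hp : p ^ 2 ≤ 1 := by nlinarith [sq_nonneg t]
  have hc2 : c ^ 2 ≤ 4 / 25 * (1 - c ^ 2) ^ 2 := by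
    have h₁ : c ^ 2 = 4 / 25 * p ^ 2 * (a ^ 2 - b ^ 2) ^ 2 := by
      have : c = 2 / 5 * p * (a ^ 2 - b ^ 2) := by linarith
      rw [this]; ring
    have h₂ : (a ^ 2 - b ^ 2) ^ 2 ≤ (1 - c ^ 2) ^ 2 := by
      have : 1 - c ^ 2 = a ^ 2 + b ^ 2 := by linarith
      rw [this]; nlinarith [mul_nonneg (sq_nonneg a) (sq_nonneg b)]
    have := mul_le_mul hp h₂ (sq_nonneg _) zero_le_one
    linarith
  have hc3 : c ^ 2 ≤ 1 / 8 := by nlinarith [sq_nonneg c]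
  obtain ⟨q, hqd⟩ : ∃ q, q = a ^ 2 + b ^ 2 := ⟨_, rfl⟩
  obtain ⟨s, hs⟩ : ∃ s, s = 2 * a * b := ⟨_, rfl⟩
  obtain ⟨J, hJ⟩ : ∃ J, J = 1 + 8 * c ^ 2 - c ^ 4 := ⟨_, rfl⟩
  have hJ1 : 1 ≤ J := by nlinarith [sq_nonneg c]
  have hJ2 : J ≤ 2 := by nlinarith [sq_nonneg (c ^ 2)]
  have hsq : s ^ 2 ≤ q ^ 2 := by rw [hs, hqd]; nlinarith [sq_nonneg (a ^ 2 - b ^ 2)]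
  have hq' : 7 / 8 ≤ q := by linarith
  have key : 0 < 3 / 2 * J * (t ^ 2 * q - p * t * s) + 2 * p ^ 2 * (2 * q ^ 2 - s ^ 2) := by
    have h1 : 2 * p ^ 2 * q ^ 2 ≤ 2 * p ^ 2 * (2 * q ^ 2 - s ^ 2) := by
      nlinarith [sq_nonneg p]
    have h2 : p * t * s ≤ q / 2 * (t ^ 2 + p ^ 2) := by
      have : |p * t| * |s| ≤ (t ^ 2 + p ^ 2) / 2 * q := by
        apply mul_le_mul _ (abs_le_of_sq_le_sq hsq (by linarith)) (abs_nonneg _) (by positivity)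
        rw [abs_le]; constructor <;> nlinarith [sq_nonneg (t + p), sq_nonneg (t - p)]
      rw [← abs_mul] at this
      linarith [le_abs_self (p * t * s)]
    have h3 : q / 2 * (t ^ 2 - p ^ 2) ≤ t ^ 2 * q - p * t * s := by linarith
    have h4 := mul_le_mul_of_nonneg_left h3 (by linarith : 0 ≤ 3 / 2 * J)
    have h5 : 0 < q * (3 / 4 * J * t ^ 2 + (2 * q - 3 / 4 * J) * p ^ 2) := by
      apply mul_pos (by linarith)
      nlinarith [mul_nonneg (sub_nonneg.2 hJ1) (sq_nonneg t),
        mul_nonneg (by linarith : 0 ≤ 2 * q - 3 / 4 * J - 1 / 4) (sq_nonneg p)]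
    linarith
  rw [hJ, hs, hqd] at key
  convert key using 2 <;> ring

theorem tangent_eq_zero_of_scaled_derivs {t p a b c a' b' c' : ℝ}
    (htp : t ^ 2 + p ^ 2 = 1) (h : a ^ 2 + b ^ 2 + c ^ 2 = 1) (h' : a * a' + b * b' + c * c' = 0)
    (hq : 0 < a ^ 2 + b ^ 2) {q q' X Y N X' Y' N' : ℝ} (hqd : q = a ^ 2 + b ^ 2)
    (hqd' : q' = 2 * (a * a' + b * b'))
    (hX : X = 4 / 5 * t * q * a - 2 * c * b + 4 / 5 * p * q * b)
    (hY : Y = 4 / 5 * t * q * b + 2 * c * a + 4 / 5 * p * q * a)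
    (hN : N = 3 * t * c * (1 + c ^ 2) ^ 2
      - 2 * p * (4 * a * b * c - 2 / 5 * t * (a ^ 2 - b ^ 2) * q))
    (hX' : X' = 4 / 5 * t * (q' * a + q * a') - 2 * (c' * b + c * b')
      + 4 / 5 * p * (q' * b + q * b'))
    (hY' : Y' = 4 / 5 * t * (q' * b + q * b') + 2 * (c' * a + c * a')
      + 4 / 5 * p * (q' * a + q * a'))
    (hN' : N' = 3 * t * (c' * (1 + c ^ 2) ^ 2 + 4 * c ^ 2 * (1 + c ^ 2) * c')
      - 2 * p * (4 * (a' * b * c + a * b' * c + a * b * c')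
        - 2 / 5 * t * (2 * (a * a' - b * b') * q + (a ^ 2 - b ^ 2) * q')))
    (h₁ : 2 * q * X' = 3 * q' * X) (h₂ : 2 * q * Y' = 3 * q' * Y) (h₃ : q * N' = 2 * q' * N) :
    a' = 0 ∧ b' = 0 ∧ c' = 0 := by
  obtain ⟨δ, hδ⟩ : ∃ δ, δ = (a * b' - b * a') / q := ⟨_, rfl⟩
  obtain ⟨κ, hκ⟩ : ∃ κ, κ = -c' / q := ⟨_, rfl⟩
  have hq0 : 0 < q := hqd ▸ hq
  have hqc : q = 1 - c ^ 2 := by linarith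
  have hc' : c' = -(q * κ) := by rw [hκ]; field_simp
  have hδ' : a * b' - b * a' = q * δ := by rw [hδ]; field_simp
  have ha' : a' = -b * δ + a * c * κ := by
    apply mul_left_cancel₀ hq0.ne'
    linear_combination -b * hδ' + a * h' - a * c * hc' + a' * hqd
  have hb' : b' = a * δ + b * c * κ := by
    apply mul_left_cancel₀ hq0.ne'
    linear_combination a * hδ' + b * h' - b * c * hc' + b' * hqd
  have hq' : q' = 2 * q * c * κ := by
    rw [hqd', ha', hb', hqd]; ring
  have e₁ : X' = 3 * c * κ * X := by
    apply mul_left_cancel₀ (mul_pos two_pos hq0).ne'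
    rw [h₁, hq']; ring
  have e₂ : Y' = 3 * c * κ * Y := by
    apply mul_left_cancel₀ (mul_pos two_pos hq0).ne'
    rw [h₂, hq']; ring
  have e₃ : N' = 4 * c * κ * N := by
    apply mul_left_cancel₀ hq0.ne'
    rw [h₃, hq']; ring
  have f₁ : δ * (2 * c - 4 / 5 * p * (a ^ 2 - b ^ 2)) = 0 := by
    apply mul_left_cancel₀ hq0.ne'
    rw [hX', hX, hq', ha', hb', hc'] at e₁
    rw [hY', hY, hq', ha', hb', hc'] at e₂
    linear_combination -a * e₁ - b * e₂ + 2 * δ * c * hqd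
  have f₂ : 2 * κ * (1 + c ^ 2) = δ * (4 / 5 * t * q - 8 / 5 * p * a * b) := by
    apply mul_left_cancel₀ (pow_pos hq0 2).ne'
    rw [hX', hX, hq', ha', hb', hc'] at e₁
    rw [hY', hY, hq', ha', hb', hc'] at e₂
    linear_combination q * b * e₁ - q * a * e₂
      + (4 * q * κ * c ^ 2 + 2 * q ^ 2 * κ - 4 / 5 * q ^ 2 * t * δ) * hqd - 2 * q ^ 2 * κ * hqc
  by_cases hδ0 : δ = 0
  · have hκ0 : κ = 0 := by
      rw [hδ0, zero_mul] at f₂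
      have : 2 * κ = 0 := (mul_eq_zero.1 f₂).resolve_right (by positivity)
      linarith
    simp [ha', hb', hc', hδ0, hκ0]
  exfalso
  have g₁ : 2 * c = 4 / 5 * p * (a ^ 2 - b ^ 2) := by
    linarith [(mul_eq_zero.1 f₁).resolve_left hδ0]
  have hpos := quadratic_form_pos htp h hq g₁
  have g₃ : δ * (3 / 2 * (1 + 8 * c ^ 2 - c ^ 4) * (t ^ 2 * q - 2 * p * t * a * b)
      + 2 * p ^ 2 * (2 * q ^ 2 - 4 * a ^ 2 * b ^ 2)) = 0 := by
    rw [hN', hN, hq', ha', hb', hc'] at e₃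
    have e₄ : 3 * t * κ * (1 + c ^ 2) * (1 + 8 * c ^ 2 - c ^ 4)
        + 2 * p * (4 * c * δ * (a ^ 2 - b ^ 2) - 4 * a * b * κ * (1 + c ^ 2)
          + 8 / 5 * t * a * b * q * δ) = 0 := by
      linear_combination -e₃ + (8 * p * a * b * κ
        - 3 * t * κ * (1 + c ^ 2) * (1 + 5 * c ^ 2)) * hqc
    linear_combination 5 / 4 * e₄
      - 5 / 4 * (3 / 2 * t * (1 + 8 * c ^ 2 - c ^ 4) - 4 * p * a * b) * f₂
      - 5 * p * δ * (a ^ 2 - b ^ 2) * g₁ + 4 * p ^ 2 * δ * (q + a ^ 2 + b ^ 2) * hqd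
  rw [hqd] at g₃
  exact (mul_ne_zero hδ0 hpos.ne') g₃

/-- The real part of `w (T |w|² + 2 i c) + i P |w|² conj w`, where `w = a + b i`, `T = 4 t / 5` and
`P = 4 p / 5`. -/
def ruledX (t p a b c : ℝ) : ℝ :=
  4 / 5 * t * (a ^ 2 + b ^ 2) * a - 2 * c * b + 4 / 5 * p * (a ^ 2 + b ^ 2) * b

/-- The imaginary part of `w (T |w|² + 2 i c) + i P |w|² conj w`, where `w = a + b i`, `T = 4 t / 5` and
`P = 4 p / 5`. -/
def ruledY (t p a b c : ℝ) : ℝ :=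
  4 / 5 * t * (a ^ 2 + b ^ 2) * b + 2 * c * a + 4 / 5 * p * (a ^ 2 + b ^ 2) * a

/-- The height of the deformed ruled surface, multiplied by `-(a² + b²)²`. -/
def ruledHeight (t p a b c : ℝ) : ℝ :=
  3 * t * c * (1 + c ^ 2) ^ 2
    - 2 * p * (4 * a * b * c - 2 / 5 * t * (a ^ 2 - b ^ 2) * (a ^ 2 + b ^ 2))

/-- The polynomial for which `(a² + b²) D = 9/25 (a² + b²)³ + X² + Y²` when `t² + p² = 1`. -/
def ruledDenom (t p a b c : ℝ) : ℝ :=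
  (a ^ 2 + b ^ 2) ^ 2 + 4 * c ^ 2
    + 16 / 5 * p * (c * (a ^ 2 - b ^ 2) + 4 / 5 * t * a * b * (a ^ 2 + b ^ 2))

/-- The power `D ^ (-1/4)` of `ruledDenom`. -/
def ruledScale (t p a b c : ℝ) : ℝ := (√√(ruledDenom t p a b c))⁻¹

/-- The radial factor of the map wrapping the ruled surface around the origin. -/
def ruledExp (t p a b c : ℝ) : ℝ :=
  Real.exp (ruledHeight t p a b c * ruledScale t p a b c ^ 4)

/-- First coordinate of the ruled surface closed up to a sphere. -/
def closedX (t p a b c : ℝ) : ℝ :=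
  ruledExp t p a b c * (ruledX t p a b c * ruledScale t p a b c ^ 3)

/-- Second coordinate of the ruled surface closed up to a sphere. -/
def closedY (t p a b c : ℝ) : ℝ :=
  ruledExp t p a b c * (ruledY t p a b c * ruledScale t p a b c ^ 3)

/-- Third coordinate of the ruled surface closed up to a sphere. -/
def closedZ (t p a b c : ℝ) : ℝ :=
  ruledExp t p a b c * (1 - 4 / 5 * ((a ^ 2 + b ^ 2) * ruledScale t p a b c ^ 2))

theorem ruledX_sq_add_ruledY_sq {t p : ℝ} (htp : t ^ 2 + p ^ 2 = 1) (a b c : ℝ) :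
    ruledX t p a b c ^ 2 + ruledY t p a b c ^ 2 =
      (a ^ 2 + b ^ 2) * ruledDenom t p a b c - 9 / 25 * (a ^ 2 + b ^ 2) ^ 3 := by
  unfold ruledX ruledY ruledDenom
  linear_combination 16 / 25 * (a ^ 2 + b ^ 2) ^ 3 * htp

theorem ruledDenom_pos {t p a b c : ℝ} (htp : t ^ 2 + p ^ 2 = 1)
    (h : a ^ 2 + b ^ 2 + c ^ 2 ≠ 0) : 0 < ruledDenom t p a b c := by
  rcases (add_nonneg (sq_nonneg a) (sq_nonneg b)).eq_or_lt with hq | hq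
  · have ha : a = 0 := by nlinarith [sq_nonneg a, sq_nonneg b]
    have hb : b = 0 := by nlinarith [sq_nonneg a, sq_nonneg b]
    have hc : c ≠ 0 := by rintro rfl; simp [ha, hb] at h
    have : 0 < c ^ 2 := by positivity
    simp only [ruledDenom, ha, hb]
    linarith
  · have h₁ := ruledX_sq_add_ruledY_sq htp a b c
    have h₂ : 0 < (a ^ 2 + b ^ 2) * ruledDenom t p a b c := by
      have : 0 < 9 / 25 * (a ^ 2 + b ^ 2) ^ 3 := by positivity
      nlinarith [sq_nonneg (ruledX t p a b c), sq_nonneg (ruledY t p a b c)]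
    exact (mul_pos_iff_of_pos_left hq).1 h₂

theorem ruledScale_pos {t p a b c : ℝ} (h : 0 < ruledDenom t p a b c) :
    0 < ruledScale t p a b c := by
  unfold ruledScale; positivity

theorem ruledScale_pow_four {t p a b c : ℝ} (h : 0 < ruledDenom t p a b c) :
    ruledScale t p a b c ^ 4 * ruledDenom t p a b c = 1 := by
  have h₁ : √√(ruledDenom t p a b c) ^ 4 = ruledDenom t p a b c := by
    rw [show 4 = 2 * 2 from rfl, pow_mul, Real.sq_sqrt (Real.sqrt_nonneg _), Real.sq_sqrt h.le]
  rw [ruledScale, inv_pow, h₁, inv_mul_cancel₀ h.ne']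

section Derivatives

variable {t p : ℝ} {a b c : ℝ → ℝ} {a' b' c' s : ℝ}

theorem hasDerivAt_ruledX (ha : HasDerivAt a a' s) (hb : HasDerivAt b b' s)
    (hc : HasDerivAt c c' s) :
    HasDerivAt (fun s => ruledX t p (a s) (b s) (c s))
      (4 / 5 * t * (2 * (a s * a' + b s * b') * a s + (a s ^ 2 + b s ^ 2) * a')
        - 2 * (c' * b s + c s * b')
        + 4 / 5 * p * (2 * (a s * a' + b s * b') * b s + (a s ^ 2 + b s ^ 2) * b')) s := by
  have hq := (ha.fun_pow 2).fun_add (hb.fun_pow 2)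
  refine ((((hq.const_mul (4 / 5 * t)).fun_mul ha).fun_sub ((hc.const_mul 2).fun_mul hb)).fun_add
    ((hq.const_mul (4 / 5 * p)).fun_mul hb)).congr_deriv ?_
  push_cast
  ring

theorem hasDerivAt_ruledY (ha : HasDerivAt a a' s) (hb : HasDerivAt b b' s)
    (hc : HasDerivAt c c' s) :
    HasDerivAt (fun s => ruledY t p (a s) (b s) (c s))
      (4 / 5 * t * (2 * (a s * a' + b s * b') * b s + (a s ^ 2 + b s ^ 2) * b')
        + 2 * (c' * a s + c s * a')
        + 4 / 5 * p * (2 * (a s * a' + b s * b') * a s + (a s ^ 2 + b s ^ 2) * a')) s := by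
  have hq := (ha.fun_pow 2).fun_add (hb.fun_pow 2)
  refine ((((hq.const_mul (4 / 5 * t)).fun_mul hb).fun_add ((hc.const_mul 2).fun_mul ha)).fun_add
    ((hq.const_mul (4 / 5 * p)).fun_mul ha)).congr_deriv ?_
  push_cast
  ring

theorem hasDerivAt_ruledHeight (ha : HasDerivAt a a' s) (hb : HasDerivAt b b' s)
    (hc : HasDerivAt c c' s) :
    HasDerivAt (fun s => ruledHeight t p (a s) (b s) (c s))
      (3 * t * (c' * (1 + c s ^ 2) ^ 2 + 4 * c s ^ 2 * (1 + c s ^ 2) * c')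
        - 2 * p * (4 * (a' * b s * c s + a s * b' * c s + a s * b s * c')
          - 2 / 5 * t * (2 * (a s * a' - b s * b') * (a s ^ 2 + b s ^ 2)
            + (a s ^ 2 - b s ^ 2) * (2 * (a s * a' + b s * b'))))) s := by
  have hq := (ha.fun_pow 2).fun_add (hb.fun_pow 2)
  have hr := (ha.fun_pow 2).fun_sub (hb.fun_pow 2)
  refine (((hc.const_mul (3 * t)).fun_mul (((hc.fun_pow 2).const_add 1).fun_pow 2)).fun_sub
    (((((ha.const_mul 4).fun_mul hb).fun_mul hc).fun_sub
      ((hr.const_mul (2 / 5 * t)).fun_mul hq)).const_mul (2 * p))).congr_deriv ?_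
  push_cast
  ring

theorem hasDerivAt_ruledDenom (ha : HasDerivAt a a' s) (hb : HasDerivAt b b' s)
    (hc : HasDerivAt c c' s) :
    HasDerivAt (fun s => ruledDenom t p (a s) (b s) (c s))
      (4 * (a s ^ 2 + b s ^ 2) * (a s * a' + b s * b') + 8 * c s * c'
        + 16 / 5 * p * (c' * (a s ^ 2 - b s ^ 2) + 2 * c s * (a s * a' - b s * b')
          + 4 / 5 * t * ((a' * b s + a s * b') * (a s ^ 2 + b s ^ 2)
            + a s * b s * (2 * (a s * a' + b s * b'))))) s := by
  have hq := (ha.fun_pow 2).fun_add (hb.fun_pow 2)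
  have hr := (ha.fun_pow 2).fun_sub (hb.fun_pow 2)
  refine (((hq.fun_pow 2).fun_add ((hc.fun_pow 2).const_mul 4)).fun_add
    (((hc.fun_mul hr).fun_add (((ha.const_mul (4 / 5 * t)).fun_mul hb).fun_mul hq)).const_mul
      (16 / 5 * p))).congr_deriv ?_
  push_cast
  ring

theorem hasDerivAt_ruledScale {D' : ℝ} (hpos : 0 < ruledDenom t p (a s) (b s) (c s))
    (hD : HasDerivAt (fun s => ruledDenom t p (a s) (b s) (c s)) D' s) :
    ∃ g', HasDerivAt (fun s => ruledScale t p (a s) (b s) (c s)) g' s ∧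
      4 * g' * ruledDenom t p (a s) (b s) (c s) + ruledScale t p (a s) (b s) (c s) * D' = 0 := by
  have h₁ := ((hD.sqrt hpos.ne').sqrt (Real.sqrt_pos.2 hpos).ne').fun_inv
    (Real.sqrt_pos.2 (Real.sqrt_pos.2 hpos)).ne'
  refine ⟨_, h₁, ?_⟩
  unfold ruledScale
  have hu : 0 < √√(ruledDenom t p (a s) (b s) (c s)) := Real.sqrt_pos.2 (Real.sqrt_pos.2 hpos)
  have hu₂ : √(ruledDenom t p (a s) (b s) (c s)) = √√(ruledDenom t p (a s) (b s) (c s)) ^ 2 :=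
    (Real.sq_sqrt (Real.sqrt_nonneg _)).symm
  have hu₄ : ruledDenom t p (a s) (b s) (c s) = √√(ruledDenom t p (a s) (b s) (c s)) ^ 4 := by
    rw [show 4 = 2 * 2 from rfl, pow_mul, ← hu₂, Real.sq_sqrt hpos.le]
  generalize √√(ruledDenom t p (a s) (b s) (c s)) = u at *
  rw [hu₂, hu₄]
  field_simp
  ring

end Derivatives

set_option maxHeartbeats 800000 in
theorem closed_immersion {t p : ℝ} {a b c : ℝ → ℝ} {a' b' c' s : ℝ} (htp : t ^ 2 + p ^ 2 = 1)
    (ha : HasDerivAt a a' s) (hb : HasDerivAt b b' s) (hc : HasDerivAt c c' s)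
    (h : a s ^ 2 + b s ^ 2 + c s ^ 2 = 1) (h' : a s * a' + b s * b' + c s * c' = 0)
    (hx : HasDerivAt (fun s => closedX t p (a s) (b s) (c s)) 0 s)
    (hy : HasDerivAt (fun s => closedY t p (a s) (b s) (c s)) 0 s)
    (hz : HasDerivAt (fun s => closedZ t p (a s) (b s) (c s)) 0 s) :
    a' = 0 ∧ b' = 0 ∧ c' = 0 := by
  have hpos : 0 < ruledDenom t p (a s) (b s) (c s) := ruledDenom_pos htp (by rw [h]; norm_num)
  obtain ⟨q', hqd, hq'⟩ : ∃ q', q' = 2 * (a s * a' + b s * b') ∧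
      HasDerivAt (fun s => a s ^ 2 + b s ^ 2) q' s :=
    ⟨_, rfl, ((ha.fun_pow 2).fun_add (hb.fun_pow 2)).congr_deriv (by push_cast; ring)⟩
  obtain ⟨X', hXd, hX'⟩ : ∃ X', X' = _ ∧ HasDerivAt (fun s => ruledX t p (a s) (b s) (c s)) X' s :=
    ⟨_, rfl, hasDerivAt_ruledX ha hb hc⟩
  obtain ⟨Y', hYd, hY'⟩ : ∃ Y', Y' = _ ∧ HasDerivAt (fun s => ruledY t p (a s) (b s) (c s)) Y' s :=
    ⟨_, rfl, hasDerivAt_ruledY ha hb hc⟩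
  obtain ⟨N', hNd, hN'⟩ :
      ∃ N', N' = _ ∧ HasDerivAt (fun s => ruledHeight t p (a s) (b s) (c s)) N' s :=
    ⟨_, rfl, hasDerivAt_ruledHeight ha hb hc⟩
  obtain ⟨D', hD'⟩ : ∃ D', HasDerivAt (fun s => ruledDenom t p (a s) (b s) (c s)) D' s :=
    ⟨_, hasDerivAt_ruledDenom ha hb hc⟩
  obtain ⟨g', hg', hgD⟩ := hasDerivAt_ruledScale hpos hD'
  have hg := ruledScale_pos hpos
  have hgD₄ := ruledScale_pow_four hpos
  have hE' := (hN'.fun_mul (hg'.fun_pow 4)).exp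
  have hE := Real.exp_pos (ruledHeight t p (a s) (b s) (c s) * ruledScale t p (a s) (b s) (c s) ^ 4)
  have kx := hx.unique (hE'.fun_mul (hX'.fun_mul (hg'.fun_pow 3)))
  have ky := hy.unique (hE'.fun_mul (hY'.fun_mul (hg'.fun_pow 3)))
  have kz := hz.unique (hE'.fun_mul (((hq'.fun_mul (hg'.fun_pow 2)).const_mul (4 / 5)).const_sub 1))
  have hS := ruledX_sq_add_ruledY_sq htp (a s) (b s) (c s)
  have hS' := ((hX'.fun_pow 2).fun_add (hY'.fun_pow 2)).unique
    (((hq'.fun_mul hD').fun_sub ((hq'.fun_pow 3).const_mul (9 / 25))).congr_of_eventuallyEq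
      (.of_forall fun s => ruledX_sq_add_ruledY_sq htp (a s) (b s) (c s)))
  clear hx hy hz hE' hg' hpos hq' hX' hY' hN' hD' ha hb hc
  obtain ⟨X, hX⟩ : ∃ X, X = ruledX t p (a s) (b s) (c s) := ⟨_, rfl⟩
  obtain ⟨Y, hY⟩ : ∃ Y, Y = ruledY t p (a s) (b s) (c s) := ⟨_, rfl⟩
  obtain ⟨N, hN⟩ : ∃ N, N = ruledHeight t p (a s) (b s) (c s) := ⟨_, rfl⟩
  rw [← hX] at kx hS hS'
  rw [← hY] at ky hS hS'
  rw [← hN] at kx ky kz hE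
  unfold ruledX at hX
  unfold ruledY at hY
  unfold ruledHeight at hN
  generalize ruledDenom t p (a s) (b s) (c s) = D at *
  generalize ruledScale t p (a s) (b s) (c s) = g at *
  generalize a s = a at *
  generalize b s = b at *
  generalize c s = c at *
  generalize Real.exp (N * g ^ 4) = E at *
  obtain ⟨q, hq⟩ : ∃ q, q = a ^ 2 + b ^ 2 := ⟨_, rfl⟩
  rw [← hq] at kz hS hS'
  have hq0 : 0 ≤ q := by rw [hq]; positivity
  push_cast at kx ky kz hS'
  have hEg : E * g ^ 2 ≠ 0 := by positivity
  have h₁ : (N' * g ^ 4 + N * (4 * g ^ 3 * g')) * X * g + X' * g + 3 * X * g' = 0 := by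
    apply mul_left_cancel₀ hEg
    linear_combination -kx
  have h₂ : (N' * g ^ 4 + N * (4 * g ^ 3 * g')) * Y * g + Y' * g + 3 * Y * g' = 0 := by
    apply mul_left_cancel₀ hEg
    linear_combination -ky
  have h₃ : (N' * g ^ 4 + N * (4 * g ^ 3 * g')) * (1 - 4 / 5 * q * g ^ 2)
      - 4 / 5 * (q' * g ^ 2 + 2 * q * g * g') = 0 := by
    apply mul_left_cancel₀ hE.ne'
    linear_combination -kz
  obtain ⟨he, hqg⟩ := radial_derivs_eq_zero hq0 hS (by linear_combination hS') hgD₄ hgD h₁ h₂ h₃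
  rw [he] at h₁ h₂
  have hN₀ : N' * g + 4 * N * g' = 0 := by
    apply mul_left_cancel₀ (pow_pos hg 3).ne'
    linear_combination he
  have hq₀ : q' * g + 2 * q * g' = 0 := by
    apply mul_left_cancel₀ hg.ne'
    linear_combination hqg
  rcases hq0.eq_or_lt with hq0 | hq0
  · have ha : a = 0 := pow_eq_zero_iff two_ne_zero |>.1
      (le_antisymm (by linarith only [hq, hq0, sq_nonneg b]) (sq_nonneg a))
    have hb : b = 0 := pow_eq_zero_iff two_ne_zero |>.1
      (le_antisymm (by linarith only [hq, hq0, sq_nonneg a]) (sq_nonneg b))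
    subst ha hb
    have hc : c ≠ 0 := by rintro rfl; norm_num at h
    norm_num at hX hY
    subst hX hY
    norm_num [hc, hg.ne'] at h₁ h₂ h' hXd hYd
    subst hXd hYd
    norm_num [hc] at h₁ h₂
    exact ⟨h₂, h₁, h'⟩
  · refine tangent_eq_zero_of_scaled_derivs htp h h' (hq ▸ hq0) hq hqd (X := X) (Y := Y) (N := N)
      (X' := X') (Y' := Y') (N' := N') (by rw [hX, hq]) (by rw [hY, hq]) (by rw [hN, hq])
      (by rw [hXd, hqd, hq]) (by rw [hYd, hqd, hq]) (by rw [hNd, hqd, hq]) ?_ ?_ ?_ <;>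
      apply mul_left_cancel₀ hg.ne'
    · linear_combination 2 * q * h₁ - 3 * X * hq₀
    · linear_combination 2 * q * h₂ - 3 * Y * hq₀
    · linear_combination q * hN₀ - 2 * N * hq₀

theorem round_height_deriv_pos {ε l c G E : ℝ} (hε : ε ^ 2 = 1) (hl₀ : 0 ≤ l) (hl₁ : l ≤ 1)
    (hG : G * (1 + c ^ 2) = 1) (hE : 0 < E) :
    0 < (1 - l) * (E * (3 * (1 - 4 / 5 * (1 - c ^ 2) * G) + 16 / 5 * (ε * c) * G ^ 2)) + l := by
  have h₁ : 0 < 3 * (1 + c ^ 2) * (1 + 9 * c ^ 2) + 16 * (ε * c) := by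
    have h₂ : (ε * c) ^ 2 = c ^ 2 := by rw [mul_pow, hε, one_mul]
    nlinarith [sq_nonneg (ε * c + 4 / 15), sq_nonneg (c ^ 2)]
  have hG₀ : 0 < G := pos_of_mul_pos_left (hG ▸ one_pos) (by positivity)
  have h₃ : 3 * (1 - 4 / 5 * (1 - c ^ 2) * G) + 16 / 5 * (ε * c) * G ^ 2 =
      G ^ 2 * (3 * (1 + c ^ 2) * (1 + 9 * c ^ 2) + 16 * (ε * c)) / 5 := by
    linear_combination (-3 * (G * (1 + c ^ 2) + 1) + 12 / 5 * (1 - c ^ 2) * G) * hG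
  rw [h₃]
  rcases hl₀.eq_or_lt with rfl | hl
  · rw [sub_zero, one_mul, add_zero]
    positivity
  · have := sub_nonneg.2 hl₁
    positivity

theorem round_tangent_eq_zero {ε l c k a' b' : ℝ} (hε : ε ^ 2 = 1) (hl₀ : 0 ≤ l) (hl₁ : l ≤ 1)
    (hk : 0 < k)
    (hx : (1 - l) * k * (4 / 5 * ε * (1 - c ^ 2) * a' - 2 * c * b') + l * (ε * a') = 0)
    (hy : (1 - l) * k * (4 / 5 * ε * (1 - c ^ 2) * b' + 2 * c * a') + l * (ε * b') = 0) :
    a' = 0 ∧ b' = 0 := by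
  obtain ⟨u, hu⟩ : ∃ u, u = ε * ((1 - l) * k * (4 / 5 * (1 - c ^ 2)) + l) := ⟨_, rfl⟩
  obtain ⟨v, hv⟩ : ∃ v, v = 2 * c * ((1 - l) * k) := ⟨_, rfl⟩
  have huv : 0 < u ^ 2 + v ^ 2 := by
    by_cases hv₀ : v = 0
    · have : 0 < (1 - l) * k * (4 / 5 * (1 - c ^ 2)) + l := by
        rw [hv₀] at hv
        rcases hl₁.eq_or_lt with rfl | hl
        · simp
        · have hl' := sub_pos.2 hl
          have hc : c = 0 := by
            have := (mul_eq_zero.1 hv.symm).resolve_right (by positivity)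
            linarith
          subst hc
          norm_num
          positivity
      have hu' : 0 < u ^ 2 := by rw [hu, mul_pow, hε]; positivity
      positivity
    · positivity
  have e₁ : u * a' - v * b' = 0 := by rw [hu, hv]; linear_combination hx
  have e₂ : u * b' + v * a' = 0 := by rw [hu, hv]; linear_combination hy
  constructor <;> apply mul_left_cancel₀ huv.ne'
  · linear_combination u * e₁ + v * e₂
  · linear_combination u * e₂ - v * e₁

/-- First coordinate of the interpolation between the closed ruled surface and `t` times the
inclusion. -/
def blendX (t p l a b c : ℝ) : ℝ := (1 - l) * closedX t p a b c + l * (t * a)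

/-- Second coordinate of the interpolation between the closed ruled surface and `t` times the
inclusion. -/
def blendY (t p l a b c : ℝ) : ℝ := (1 - l) * closedY t p a b c + l * (t * b)

/-- Third coordinate of the interpolation between the closed ruled surface and `t` times the
inclusion. -/
def blendZ (t p l a b c : ℝ) : ℝ := (1 - l) * closedZ t p a b c + l * (t * c)

theorem round_immersion {ε l : ℝ} {a b c : ℝ → ℝ} {a' b' c' s : ℝ} (hε : ε ^ 2 = 1)
    (hl₀ : 0 ≤ l) (hl₁ : l ≤ 1)
    (ha : HasDerivAt a a' s) (hb : HasDerivAt b b' s) (hc : HasDerivAt c c' s)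
    (h : a s ^ 2 + b s ^ 2 + c s ^ 2 = 1) (h' : a s * a' + b s * b' + c s * c' = 0)
    (hx : HasDerivAt (fun s => blendX ε 0 l (a s) (b s) (c s)) 0 s)
    (hy : HasDerivAt (fun s => blendY ε 0 l (a s) (b s) (c s)) 0 s)
    (hz : HasDerivAt (fun s => blendZ ε 0 l (a s) (b s) (c s)) 0 s) :
    a' = 0 ∧ b' = 0 ∧ c' = 0 := by
  have hpos : 0 < ruledDenom ε 0 (a s) (b s) (c s) :=
    ruledDenom_pos (by linarith) (by rw [h]; norm_num)
  have hq' := (ha.fun_pow 2).fun_add (hb.fun_pow 2)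
  have hX' := hasDerivAt_ruledX (t := ε) (p := 0) ha hb hc
  have hY' := hasDerivAt_ruledY (t := ε) (p := 0) ha hb hc
  obtain ⟨N', hNd, hN'⟩ :
      ∃ N', N' = _ ∧ HasDerivAt (fun s => ruledHeight ε 0 (a s) (b s) (c s)) N' s :=
    ⟨_, rfl, hasDerivAt_ruledHeight ha hb hc⟩
  obtain ⟨g', hg', hgD⟩ := hasDerivAt_ruledScale hpos (hasDerivAt_ruledDenom ha hb hc)
  have hg := ruledScale_pos hpos
  have hgD₄ := ruledScale_pow_four hpos
  have hE' := (hN'.fun_mul (hg'.fun_pow 4)).exp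
  have kx := hx.unique (((hE'.fun_mul (hX'.fun_mul (hg'.fun_pow 3))).const_mul (1 - l)).fun_add
    ((ha.const_mul ε).const_mul l))
  have ky := hy.unique (((hE'.fun_mul (hY'.fun_mul (hg'.fun_pow 3))).const_mul (1 - l)).fun_add
    ((hb.const_mul ε).const_mul l))
  have kz := hz.unique (((hE'.fun_mul
    (((hq'.fun_mul (hg'.fun_pow 2)).const_mul (4 / 5)).const_sub 1)).const_mul (1 - l)).fun_add
    ((hc.const_mul ε).const_mul l))
  have hE := Real.exp_pos (ruledHeight ε 0 (a s) (b s) (c s) * ruledScale ε 0 (a s) (b s) (c s) ^ 4)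
  clear hx hy hz hE' hg' hpos hq' hX' hY' hN' ha hb hc
  generalize Real.exp
    (ruledHeight ε 0 (a s) (b s) (c s) * ruledScale ε 0 (a s) (b s) (c s) ^ 4) = E at *
  generalize ruledScale ε 0 (a s) (b s) (c s) = g at *
  unfold ruledX at kx
  unfold ruledY at ky
  obtain ⟨N, hN⟩ : ∃ N, N = ruledHeight ε 0 (a s) (b s) (c s) := ⟨_, rfl⟩
  rw [← hN] at kx ky kz
  unfold ruledHeight at hN
  unfold ruledDenom at hgD hgD₄
  generalize a s = a at *
  generalize b s = b at *
  generalize c s = c at *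
  push_cast at kx ky kz
  have hq : a ^ 2 + b ^ 2 = 1 - c ^ 2 := by linarith only [h]
  have hw : a * a' + b * b' = -(c * c') := by linarith only [h']
  have hG : g ^ 2 * (1 + c ^ 2) = 1 := by
    refine (pow_left_inj₀ (by positivity) zero_le_one two_ne_zero).1 ?_
    rw [hq] at hgD₄
    linear_combination hgD₄
  have hg' : g' = -(c * c' * g ^ 3) := by
    rw [hq, hw] at hgD
    have h₁ : (1 + c ^ 2) ^ 2 * g' = (1 + c ^ 2) ^ 2 * (-(c * c' * g ^ 3)) := by
      linear_combination hgD / 4 + c * c' * g * (1 + c ^ 2) * hG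
    exact mul_left_cancel₀ (by positivity) h₁
  have he : N' * g ^ 4 + N * (4 * g ^ 3 * g') = 3 * ε * c' := by
    rw [hN, hNd, hg']
    linear_combination 3 * ε * c' * (g ^ 2 * (1 + c ^ 2) + 1 + 4 * c ^ 2 * g ^ 2
      - 4 * c ^ 2 * g ^ 2 * (g ^ 2 * (1 + c ^ 2) + 1)) * hG
  rw [he] at kx ky kz
  have hc : c' = 0 := by
    have hf : (2 * a ^ 1 * a' + 2 * b ^ 1 * b') * g ^ 2 + (a ^ 2 + b ^ 2) * (2 * g ^ 1 * g') =
        -4 * c * c' * g ^ 4 := by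
      rw [hq, hg']
      linear_combination 2 * g ^ 2 * hw + 2 * c * c' * g ^ 2 * hG
    rw [hf, hq] at kz
    have h₁ := round_height_deriv_pos hε hl₀ hl₁ hG hE
    apply mul_left_cancel₀ h₁.ne'
    linear_combination -ε * kz
      - ((1 - l) * E * 3 * (1 - 4 / 5 * (1 - c ^ 2) * g ^ 2) * c' + l * c') * hε
  rw [hg', hc] at kx ky
  rw [hc, mul_zero, neg_zero] at hw
  rw [hw, hq] at kx ky
  obtain ⟨ha, hb⟩ := round_tangent_eq_zero (c := c) (a' := a') (b' := b') (k := E * g ^ 3)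
    hε hl₀ hl₁ (by positivity) (by linear_combination -kx) (by linear_combination -ky)
  exact ⟨ha, hb, hc⟩

theorem blend_immersion {t p l : ℝ} {a b c : ℝ → ℝ} {a' b' c' s : ℝ} (htp : t ^ 2 + p ^ 2 = 1)
    (hl₀ : 0 ≤ l) (hl₁ : l ≤ 1) (hlp : l = 0 ∨ p = 0)
    (ha : HasDerivAt a a' s) (hb : HasDerivAt b b' s) (hc : HasDerivAt c c' s)
    (h : a s ^ 2 + b s ^ 2 + c s ^ 2 = 1) (h' : a s * a' + b s * b' + c s * c' = 0)
    (hx : HasDerivAt (fun s => blendX t p l (a s) (b s) (c s)) 0 s)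
    (hy : HasDerivAt (fun s => blendY t p l (a s) (b s) (c s)) 0 s)
    (hz : HasDerivAt (fun s => blendZ t p l (a s) (b s) (c s)) 0 s) :
    a' = 0 ∧ b' = 0 ∧ c' = 0 := by
  rcases hlp with rfl | rfl
  · simp only [blendX, blendY, blendZ, sub_zero, one_mul, zero_mul, add_zero] at hx hy hz
    exact closed_immersion htp ha hb hc h h' hx hy hz
  · exact round_immersion (by linarith) hl₀ hl₁ ha hb hc h h' hx hy hz

/-- The angle parametrising the ruled surfaces, which runs from `0` to `π` for `τ ∈ [1/3, 2/3]`. -/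
def eversionAngle (τ : ℝ) : ℝ := Real.pi * Real.smoothTransition (3 * τ - 1)

/-- The weight of the round sphere, which falls from `1` to `0` for `τ ∈ [0, 1/3]` and returns to
`1` for `τ ∈ [2/3, 1]`. -/
def eversionWeight (τ : ℝ) : ℝ :=
  1 - Real.smoothTransition (3 * τ) + Real.smoothTransition (3 * τ - 2)

/-- The sphere eversion, extended by the same formula to all of `ℝ × ℝ³`. -/
def eversion (y : ℝ × E3) : E3 :=
  !₂[blendX (Real.cos (eversionAngle y.1)) (Real.sin (eversionAngle y.1)) (eversionWeight y.1)
      (y.2 0) (y.2 1) (y.2 2),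
    blendY (Real.cos (eversionAngle y.1)) (Real.sin (eversionAngle y.1)) (eversionWeight y.1)
      (y.2 0) (y.2 1) (y.2 2),
    blendZ (Real.cos (eversionAngle y.1)) (Real.sin (eversionAngle y.1)) (eversionWeight y.1)
      (y.2 0) (y.2 1) (y.2 2)]

theorem eversionWeight_cases (τ : ℝ) : eversionWeight τ = 0 ∨ Real.sin (eversionAngle τ) = 0 := by
  rcases le_total (3 * τ) 1 with h₁ | h₁
  · right
    rw [eversionAngle, Real.smoothTransition.zero_of_nonpos (by linarith), mul_zero, Real.sin_zero]
  rcases le_total (3 * τ) 2 with h₂ | h₂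
  · left
    rw [eversionWeight, Real.smoothTransition.one_of_one_le h₁,
      Real.smoothTransition.zero_of_nonpos (by linarith), sub_self, zero_add]
  · right
    rw [eversionAngle, Real.smoothTransition.one_of_one_le (by linarith), mul_one, Real.sin_pi]

theorem eversionWeight_nonneg (τ : ℝ) : 0 ≤ eversionWeight τ :=
  add_nonneg (sub_nonneg.2 (Real.smoothTransition.le_one _)) (Real.smoothTransition.nonneg _)

theorem eversionWeight_le_one (τ : ℝ) : eversionWeight τ ≤ 1 := by
  unfold eversionWeight
  rcases le_total (3 * τ) 2 with h | h
  · rw [Real.smoothTransition.zero_of_nonpos (by linarith : 3 * τ - 2 ≤ 0)]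
    linarith [Real.smoothTransition.nonneg (3 * τ)]
  · rw [Real.smoothTransition.one_of_one_le (by linarith : 1 ≤ 3 * τ)]
    linarith [Real.smoothTransition.le_one (3 * τ - 2)]

theorem contDiff_eversionAngle : ContDiff ℝ (⊤ : ℕ∞) eversionAngle :=
  contDiff_const.mul (Real.smoothTransition.contDiff.comp (by fun_prop))

theorem contDiff_eversionWeight : ContDiff ℝ (⊤ : ℕ∞) eversionWeight :=
  (contDiff_const.sub (Real.smoothTransition.contDiff.comp (by fun_prop))).add
    (Real.smoothTransition.contDiff.comp (by fun_prop))

instance fact_finrank_E3_s1 : Fact (Module.finrank ℝ E3 = 2 + 1) := ⟨finrank_euclideanSpace_fin⟩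

theorem E3.sum_sq_eq_one (x : S2) :
    (x : E3) 0 ^ 2 + (x : E3) 1 ^ 2 + (x : E3) 2 ^ 2 = 1 := by
  have h := EuclideanSpace.norm_sq_eq (x : E3)
  rw [norm_eq_of_mem_sphere x, Fin.sum_univ_three] at h
  simpa using h.symm

theorem contDiffAt_eversion (τ : ℝ) (x : S2) :
    ContDiffAt ℝ (⊤ : ℕ∞) eversion (τ, (x : E3)) := by
  have hα : ContDiffAt ℝ (⊤ : ℕ∞) (fun y : ℝ × E3 => eversionAngle y.1) (τ, (x : E3)) :=
    (contDiff_eversionAngle.comp contDiff_fst).contDiffAt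
  have hl : ContDiffAt ℝ (⊤ : ℕ∞) (fun y : ℝ × E3 => eversionWeight y.1) (τ, (x : E3)) :=
    (contDiff_eversionWeight.comp contDiff_fst).contDiffAt
  have ht := Real.contDiff_cos.contDiffAt.comp (τ, (x : E3)) hα
  have hp := Real.contDiff_sin.contDiffAt.comp (τ, (x : E3)) hα
  have hpos : 0 < ruledDenom (Real.cos (eversionAngle τ)) (Real.sin (eversionAngle τ))
      ((x : E3) 0) ((x : E3) 1) ((x : E3) 2) :=
    ruledDenom_pos (Real.cos_sq_add_sin_sq _) (by rw [E3.sum_sq_eq_one]; norm_num)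
  have hco (i : Fin 3) : ContDiffAt ℝ (⊤ : ℕ∞) (fun y : ℝ × E3 => y.2 i) (τ, (x : E3)) := by
    fun_prop
  have ha := hco 0
  have hb := hco 1
  have hc := hco 2
  have hD : ContDiffAt ℝ (⊤ : ℕ∞) (fun y : ℝ × E3 => ruledDenom (Real.cos (eversionAngle y.1))
      (Real.sin (eversionAngle y.1)) (y.2 0) (y.2 1) (y.2 2)) (τ, (x : E3)) := by
    unfold ruledDenom
    fun_prop
  have hg : ContDiffAt ℝ (⊤ : ℕ∞) (fun y : ℝ × E3 => ruledScale (Real.cos (eversionAngle y.1))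
      (Real.sin (eversionAngle y.1)) (y.2 0) (y.2 1) (y.2 2)) (τ, (x : E3)) :=
    ((hD.sqrt hpos.ne').sqrt (Real.sqrt_pos.2 hpos).ne').inv
      (Real.sqrt_pos.2 (Real.sqrt_pos.2 hpos)).ne'
  have hE : ContDiffAt ℝ (⊤ : ℕ∞) (fun y : ℝ × E3 => ruledExp (Real.cos (eversionAngle y.1))
      (Real.sin (eversionAngle y.1)) (y.2 0) (y.2 1) (y.2 2)) (τ, (x : E3)) := by
    unfold ruledExp ruledHeight
    fun_prop
  refine contDiffAt_euclidean.2 fun i => ?_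
  fin_cases i
  · change ContDiffAt ℝ (⊤ : ℕ∞) (fun y : ℝ × E3 => blendX _ _ _ _ _ _) _
    unfold blendX closedX ruledX
    fun_prop
  · change ContDiffAt ℝ (⊤ : ℕ∞) (fun y : ℝ × E3 => blendY _ _ _ _ _ _) _
    unfold blendY closedY ruledY
    fun_prop
  · change ContDiffAt ℝ (⊤ : ℕ∞) (fun y : ℝ × E3 => blendZ _ _ _ _ _ _) _
    unfold blendZ closedZ
    fun_prop

theorem eversion_immersion (τ : ℝ) (x : S2) :
    Function.Injective (mfderiv (𝓡 2) 𝓘(ℝ, E3) (fun x : S2 => eversion (τ, x)) x) := by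
  have hG : DifferentiableAt ℝ (fun y : E3 => eversion (τ, y)) (x : E3) :=
    ((contDiffAt_eversion τ x).comp (x : E3)
      (contDiffAt_const.prodMk contDiffAt_id)).differentiableAt (by simp)
  have hcoe : MDifferentiableAt (𝓡 2) 𝓘(ℝ, E3) (fun x : S2 => (x : E3)) x :=
    (contMDiff_coe_sphere (m := 1) x).mdifferentiableAt one_ne_zero
  have hcomp := mfderiv_comp x (g := fun y : E3 => eversion (τ, y)) hG.mdifferentiableAt hcoe
  rw [mfderiv_eq_fderiv] at hcomp
  have hinj := injective_mvfderiv_subtypeVal_sphere (n := 2) x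
  change Function.Injective
    (mfderiv (𝓡 2) 𝓘(ℝ, E3) ((fun y : E3 => eversion (τ, y)) ∘ fun x : S2 => (x : E3)) x)
  rw [hcomp]
  refine (injective_iff_map_eq_zero _).2 fun v hv => ?_
  obtain ⟨w, hw⟩ : ∃ w : E3, w = mfderiv (𝓡 2) 𝓘(ℝ, E3) (fun x : S2 => (x : E3)) x v := ⟨_, rfl⟩
  have hv₀ : fderiv ℝ (fun y : E3 => eversion (τ, y)) (x : E3) w = 0 := by rw [hw]; exact hv
  have hxw : inner ℝ (x : E3) w = 0 := by
    have : w ∈ (ℝ ∙ (x : E3))ᗮ := by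
      rw [← range_mvfderiv_subtypeVal (n := 2) x, hw]
      exact ⟨v, rfl⟩
    exact Submodule.mem_orthogonal_singleton_iff_inner_right.1 this
  suffices hw₀ : w = 0 by
    apply hinj
    rw [map_zero]
    exact hw.symm.trans hw₀
  have hγ : HasDerivAt (fun s : ℝ => (x : E3) + s • w) w 0 := by
    simpa using ((hasDerivAt_id (0 : ℝ)).smul_const w).const_add (x : E3)
  have hγ' (i : Fin 3) : HasDerivAt (fun s : ℝ => ((x : E3) + s • w) i) (w i) 0 :=
    (EuclideanSpace.proj (𝕜 := ℝ) i).hasFDerivAt.comp_hasDerivAt 0 hγ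
  have hF : HasDerivAt (fun s : ℝ => eversion (τ, (x : E3) + s • w)) 0 0 := by
    rw [← hv₀]
    have : HasFDerivAt (fun y : E3 => eversion (τ, y))
      (fderiv ℝ (fun y : E3 => eversion (τ, y)) (x : E3)) ((x : E3) + (0 : ℝ) • w) := by
      simpa using hG.hasFDerivAt
    exact this.comp_hasDerivAt 0 hγ
  have hF' (i : Fin 3) : HasDerivAt (fun s : ℝ => eversion (τ, (x : E3) + s • w) i) 0 0 :=
    ((EuclideanSpace.proj (𝕜 := ℝ) i).hasFDerivAt.comp_hasDerivAt 0 hF).congr_deriv (by simp)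
  have hsum : (x : E3) 0 * w 0 + (x : E3) 1 * w 1 + (x : E3) 2 * w 2 = 0 := by
    simpa [PiLp.inner_apply, Fin.sum_univ_three, mul_comm] using hxw
  obtain ⟨h₀, h₁, h₂⟩ := blend_immersion (Real.cos_sq_add_sin_sq (eversionAngle τ))
    (eversionWeight_nonneg τ) (eversionWeight_le_one τ) (eversionWeight_cases τ)
    (hγ' 0) (hγ' 1) (hγ' 2) (by simpa using E3.sum_sq_eq_one x) (by simpa using hsum)
    (hF' 0) (hF' 1) (hF' 2)
  ext i
  fin_cases i <;> assumption

theorem eversion_zero (x : E3) : eversion (0, x) = x := by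
  ext i
  fin_cases i <;> simp [eversion, blendX, blendY, blendZ, eversionAngle, eversionWeight,
    Real.smoothTransition.zero_of_nonpos]

theorem eversion_one (x : E3) : eversion (1, x) = -x := by
  have h₁ : eversionAngle 1 = Real.pi := by
    rw [eversionAngle, Real.smoothTransition.one_of_one_le (by norm_num), mul_one]
  have h₂ : eversionWeight 1 = 1 := by
    rw [eversionWeight, Real.smoothTransition.one_of_one_le (by norm_num),
      Real.smoothTransition.one_of_one_le (by norm_num)]
    norm_num
  ext i
  fin_cases i <;> simp [eversion, blendX, blendY, blendZ, h₁, h₂]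

theorem contMDiff_eversion : ContMDiff ((𝓘(ℝ, ℝ)).prod (𝓡 2)) 𝓘(ℝ, E3) (⊤ : ℕ∞)
    (fun y : ℝ × S2 => eversion (y.1, (y.2 : E3))) := by
  intro y
  have hi : ContMDiff ((𝓘(ℝ, ℝ)).prod (𝓡 2)) 𝓘(ℝ, ℝ × E3) (⊤ : ℕ∞)
      (fun y : ℝ × S2 => (y.1, (y.2 : E3))) :=
    contMDiff_fst.prodMk_space (contMDiff_coe_sphere.comp contMDiff_snd)
  exact ContMDiffAt.comp (g := eversion) y (contDiffAt_eversion y.1 y.2).contMDiffAt hi.contMDiffAt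

/-- The standard round sphere in ℝ³ can be everted: there is a homotopy through immersions
from the standard inclusion `x ↦ x` of `S²` into ℝ³ to the map `x ↦ -x`. -/
theorem standard_sphere_eversion :
    ∃ F : ℝ × S2 → E3,
      IsRegularHomotopy F (fun x : S2 => (x : E3)) (fun x : S2 => -(x : E3)) :=
  ⟨fun y => eversion (y.1, (y.2 : E3)), contMDiff_eversion, fun x => eversion_zero x,
    fun x => eversion_one x, fun τ =>
      ⟨contMDiff_eversion.comp (contMDiff_const.prodMk contMDiff_id), eversion_immersion τ⟩⟩
end
end
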